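/- Let σ ≥ 1, s > 3/2, δ ≥ 0 and α, β, γ, Γ ∈ ℝ. Then there exists a constant C > 0, depending only on s, α, β, γ, Γ, such that for every u : ℝ → ℝ with ‖u‖_{G^{δ}_{σ,s}} < ∞: |⟨Λ^{s} e^{δΛ^{1/σ}} [ (1−∂_{xx})^{-1}∂_x( −h(u) + u² + ½(∂_x u)² ) ], Λ^{s} e^{δΛ^{1/σ}} u⟩| ≤ C ( ‖u‖²_{G^{δ}_{σ,s}} + ‖u‖³_{G^{δ}_{σ,s}} + ‖u‖⁴_{G^{δ}_{σ,s}} + ‖u‖⁵_{G^{δ}_{σ,s}} ), where h(u) = (α+Γ)u + (β/3)u³ + (γ/4)u⁴. -/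

import Mathlib

open MeasureTheory Filter

/-- The Fourier transform with the convention `f̂(ξ) = ∫ e^{-i x ξ} f(x) dx`. -/
noncomputable def FT (f : ℝ → ℂ) (ξ : ℝ) : ℂ :=
  ∫ x : ℝ, Complex.exp (-Complex.I * (ξ : ℂ) * (x : ℂ)) * f x

/-- The inverse Fourier transform for the above convention. -/
noncomputable def FTinv (g : ℝ → ℂ) (x : ℝ) : ℂ :=
  (1 / (2 * Real.pi) : ℂ) * ∫ ξ : ℝ, Complex.exp (Complex.I * (ξ : ℂ) * (x : ℂ)) * g ξ

/-- The Fourier multiplier operator with symbol `m`. -/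
noncomputable def fourierMult (m : ℝ → ℂ) (f : ℝ → ℂ) : ℝ → ℂ :=
  FTinv fun ξ => m ξ * FT f ξ

/-- The weight defining the Gevrey norm `G^δ_{σ,s}`. -/
noncomputable def gevreyWeight (σ δ s : ℝ) (ξ : ℝ) : ℝ :=
  (1 + ξ ^ 2) ^ s * Real.exp (2 * δ * (1 + ξ ^ 2) ^ (1 / (2 * σ)))

/-- The Gevrey norm `‖f‖_{G^δ_{σ,s}}`. -/
noncomputable def gevreyNorm (σ δ s : ℝ) (f : ℝ → ℂ) : ℝ :=
  Real.sqrt (∫ ξ : ℝ, gevreyWeight σ δ s ξ * ‖FT f ξ‖ ^ 2)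

/-- Membership in the Gevrey space `G^δ_{σ,s}(ℝ)`: the Gevrey norm is finite. -/
def MemGevrey (σ δ s : ℝ) (f : ℝ → ℂ) : Prop :=
  Integrable (fun ξ : ℝ => gevreyWeight σ δ s ξ * ‖FT f ξ‖ ^ 2)

/-- The Sobolev `H^s` norm. -/
noncomputable def sobolevNorm (s : ℝ) (f : ℝ → ℂ) : ℝ :=
  Real.sqrt (∫ ξ : ℝ, (1 + ξ ^ 2) ^ s * ‖FT f ξ‖ ^ 2)

/-- Membership in `H^s(ℝ)`. -/
def MemHs (s : ℝ) (f : ℝ → ℂ) : Prop :=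
  Integrable (fun ξ : ℝ => (1 + ξ ^ 2) ^ s * ‖FT f ξ‖ ^ 2)

/-- The Fourier multiplier `Λ^r e^{δΛ^{1/σ}}` with symbol
`(1+ξ²)^{r/2} e^{δ(1+ξ²)^{1/(2σ)}}`; for `δ = 0` this is `Λ^r`. -/
noncomputable def GOp (σ δ r : ℝ) (f : ℝ → ℂ) : ℝ → ℂ :=
  fourierMult
    (fun ξ : ℝ =>
      (((1 + ξ ^ 2) ^ (r / 2) * Real.exp (δ * (1 + ξ ^ 2) ^ (1 / (2 * σ))) : ℝ) : ℂ)) f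

/-- The `L²(ℝ)` inner product. -/
noncomputable def L2inner (f g : ℝ → ℂ) : ℂ :=
  ∫ x : ℝ, f x * (starRingEnd ℂ) (g x)

/-- The `L²(ℝ)` norm. -/
noncomputable def L2norm (f : ℝ → ℂ) : ℝ :=
  Real.sqrt (∫ x : ℝ, ‖f x‖ ^ 2)

/-- The nonlinearity `h(u) = (α+Γ)u + (β/3)u³ + (γ/4)u⁴`. -/
noncomputable def hCH (α β γ Γ : ℝ) (w : ℂ) : ℂ :=
  (α + Γ : ℂ) * w + (β / 3 : ℂ) * w ^ 3 + (γ / 4 : ℂ) * w ^ 4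

/-- `P(u) = (1-∂_{xx})^{-1}∂_x(−h(u) + u² + ½(∂_x u)²)`, realised as the Fourier
multiplier with symbol `iξ/(1+ξ²)` applied to `−h(u) + u² + ½(∂_x u)²`;
the nonlocal term of the equation is `Q(u) = −P(u)`. -/
noncomputable def PCH (α β γ Γ : ℝ) (v : ℝ → ℂ) : ℝ → ℂ :=
  fourierMult (fun ξ : ℝ => Complex.I * (ξ : ℂ) / (1 + (ξ : ℂ) ^ 2))
    (fun x => -hCH α β γ Γ (v x) + (v x) ^ 2 + (deriv v x) ^ 2 / 2)

/-- The full right-hand side `F(u) = -(u+Γ)∂_x u - λu - P(u)` of the weakly dissipative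
Camassa–Holm equation `u_t = F(u)`. -/
noncomputable def FCH (α β γ Γ lam : ℝ) (v : ℝ → ℂ) : ℝ → ℂ := fun x =>
  -(v x + (Γ : ℂ)) * deriv v x - (lam : ℂ) * v x - PCH α β γ Γ v x

/-- pairing -/
noncomputable abbrev gvL : ℝ →ₗ[ℝ] ℝ →ₗ[ℝ] ℝ := LinearMap.mul ℝ ℝ

open Real (continuous_probChar exp norm_of_nonneg pi_ne_zero Gamma Gamma_pos_of_pos sin rpow_zero rpow_one rpow_neg inv_rpow rpow_le_rpow div_rpow rpow_add_one rpow_natCast rpow_le_rpow_of_exponent_le sin_pos_of_pos_of_lt_pi pi_pos rpow_add rpow_sub_one rpow_mul cos cos_nonneg_of_mem_Icc cos_le_one norm_eq_abs sin_le_one abs_sin_le_one pi_gt_three Gamma_nat_eq_factorial Gamma_mul_add_mul_le_rpow_Gamma_mul_rpow_Gamma mul_rpow zero_rpow sqrt le_sqrt_of_sq_le sq_sqrt one_rpow one_le_rpow exp_le_one_iff sqrt_le_sqrt sqrt_pos rpow_sub sqrt_eq_rpow abs_le_sqrt add_one_le_exp exp_nat_mul exp_le_exp one_le_exp rpow_nonneg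 sqrt_nonneg sqrt_le_left)
open Complex (norm_exp_ofReal_mul_I exp_add norm_real real_smul ofRealCLM ofReal_exp re normSq_eq_norm_sq exp_conj norm_exp re_ofReal_mul norm_I conj_ofReal continuous_conj ofReal_re continuous_re)
open Set (Iic Ioi Ioc Ioc_subset_Ioi_self uIcc left_mem_uIcc right_mem_uIcc indicator uIcc_of_le Icc indicator_of_mem indicator_of_notMem Ioc_union_Ioi_eq_Ioi Ioc_disjoint_Ioi abs_sub_right_of_mem_uIcc)
open ENNReal (ofReal_mul ofReal ofReal_pow ofReal_add ofReal_le_ofReal ofReal_ne_top tendsto_ofReal toReal_ofReal ofReal_lt_top mul_lt_top mul_top toReal_mul ofReal_tsum_of_nonneg ofReal_le_one ofReal_eq_zero one_le_ofReal tsum_le_tsum ofReal_add_le pow_lt_top)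

theorem gv_FT_eq (f : ℝ → ℂ) :
    FT f = VectorFourier.fourierIntegral Real.probChar volume gvL f := by
  ext ξ
  rw [VectorFourier.fourierIntegral_probChar]
  unfold FT
  congr 1; ext x
  simp only [LinearMap.mul_apply', smul_eq_mul]
  congr 2; push_cast; ring

theorem gv_FTinv_eq (f : ℝ → ℂ) (x : ℝ) :
    FTinv f x = (1 / (2 * Real.pi) : ℂ) * FT f (-x) := by
  unfold FT FTinv
  congr 2; ext y
  congr 2; push_cast; ring

theorem gvL_cont : Continuous fun p : ℝ × ℝ ↦ gvL p.1 p.2 := by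
  simp only [LinearMap.mul_apply']; fun_prop

theorem gv_FT_cont {f : ℝ → ℂ} (hf : Integrable f) : Continuous (FT f) := by
  rw [gv_FT_eq]
  exact VectorFourier.fourierIntegral_continuous continuous_probChar gvL_cont hf

theorem gv_norm_exp (a b : ℝ) : ‖Complex.exp (Complex.I * (a : ℂ) * (b : ℂ))‖ = 1 := by
  rw [show Complex.I * (a : ℂ) * (b : ℂ) = ((a * b : ℝ) : ℂ) * Complex.I by push_cast; ring]
  exact norm_exp_ofReal_mul_I _

theorem gv_norm_exp' (a b : ℝ) : ‖Complex.exp (-Complex.I * (a : ℂ) * (b : ℂ))‖ = 1 := by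
  rw [show -Complex.I * (a : ℂ) * (b : ℂ) = ((-(a * b) : ℝ) : ℂ) * Complex.I by push_cast; ring]
  exact norm_exp_ofReal_mul_I _

theorem gv_FT_norm (f : ℝ → ℂ) (ξ : ℝ) : ‖FT f ξ‖ ≤ ∫ x, ‖f x‖ := by
  unfold FT
  refine (norm_integral_le_integral_norm _).trans (le_of_eq ?_)
  congr 1; ext x
  rw [norm_mul, gv_norm_exp', one_mul]

theorem gv_FT_mul {f g : ℝ → ℂ} (hf : Integrable f) (hg : Integrable g) :
    ∫ ξ, FT f ξ * g ξ = ∫ x, f x * FT g x := by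
  have := VectorFourier.integral_fourierIntegral_smul_eq_flip (L := gvL)
    (μ := volume) (ν := volume) continuous_probChar gvL_cont hf hg
  rw [gv_FT_eq, gv_FT_eq]
  have h2 : gvL.flip = gvL := by
    ext; simp
  rw [h2] at this
  simpa only [smul_eq_mul] using this

theorem gv_FT_notInt {f : ℝ → ℂ} (hf : ¬ Integrable f) : FT f = 0 := by
  ext ξ
  unfold FT
  apply integral_undef
  intro h
  apply hf
  have := h.bdd_mul (c := 1) (f := fun x : ℝ => Complex.exp (Complex.I * (ξ : ℂ) * (x : ℂ)))
    (by fun_prop) (by filter_upwards with x; exact (gv_norm_exp _ _).le)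
  refine this.congr ?_
  filter_upwards with x
  rw [← mul_assoc, ← exp_add]
  simp

theorem gv_FTinv_notInt {f : ℝ → ℂ} (hf : ¬ Integrable f) : FTinv f = 0 := by
  ext x
  rw [gv_FTinv_eq, gv_FT_notInt hf]; simp

theorem gv_FTinv_cont {f : ℝ → ℂ} (hf : Integrable f) : Continuous (FTinv f) := by
  have : FTinv f = fun x => (1 / (2 * Real.pi) : ℂ) * FT f (-x) := by
    ext x; exact gv_FTinv_eq f x
  rw [this]
  have := gv_FT_cont hf
  fun_prop

theorem gv_FTinv_norm (f : ℝ → ℂ) (x : ℝ) : ‖FTinv f x‖ ≤ (1 / (2 * Real.pi)) * ∫ x, ‖f x‖ := by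
  rw [gv_FTinv_eq, norm_mul]
  have : ‖(1 / (2 * Real.pi) : ℂ)‖ = 1 / (2 * Real.pi) := by
    rw [show (1 / (2 * Real.pi) : ℂ) = ((1 / (2 * Real.pi) : ℝ) : ℂ) by push_cast; ring]
    rw [norm_real, norm_of_nonneg (by positivity)]
  rw [this]
  gcongr
  exact gv_FT_norm _ _

theorem gv_FT_fourier (f : ℝ → ℂ) (ξ : ℝ) : FT f ξ = FourierTransform.fourier f (ξ / (2 * Real.pi)) := by
  rw [Real.fourier_eq', FT]
  congr 1; ext x
  simp only [smul_eq_mul]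
  congr 2
  simp only [RCLike.inner_apply, conj_trivial]
  push_cast
  have : (Real.pi : ℂ) ≠ 0 := by exact_mod_cast pi_ne_zero
  field_simp

theorem gv_FTinv_fourierInv (f : ℝ → ℂ) (x : ℝ) :
    FTinv f x = FourierTransformInv.fourierInv (fun y => f ((2 * Real.pi) * y)) x := by
  rw [Real.fourierInv_eq', FTinv]
  have h := Measure.integral_comp_mul_left
    (fun y : ℝ => Complex.exp (Complex.I * (y : ℂ) * (x : ℂ)) * f y) (2 * Real.pi)
  rw [show (1 / (2 * Real.pi) : ℂ) = (|(2 * Real.pi)⁻¹| : ℝ) by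
    rw [abs_of_pos (by positivity)]; push_cast; ring]
  rw [← real_smul, ← h]
  congr 1; ext y
  simp only [smul_eq_mul]
  congr 2
  simp only [RCLike.inner_apply, conj_trivial]
  push_cast
  ring

theorem gv_inv1 {f : ℝ → ℂ} (hc : Continuous f) (hf : Integrable f) (hF : Integrable (FT f)) :
    FTinv (FT f) = f := by
  ext x
  rw [gv_FTinv_fourierInv]
  have h1 : (fun y => FT f (2 * Real.pi * y)) = FourierTransform.fourier f := by
    ext y; rw [gv_FT_fourier]; congr 1; field_simp
  rw [h1, hc.fourierInv_fourier_eq hf]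
  rw [← h1]
  exact hF.comp_mul_left' (by positivity)

theorem gv_inv2 {f : ℝ → ℂ} (hc : Continuous f) (hf : Integrable f) (hF : Integrable (FTinv f)) :
    FT (FTinv f) = f := by
  have hF' : Integrable (FT f) := by
    have : Integrable (fun x => (2 * Real.pi : ℂ) * FTinv f (-x)) := (hF.comp_neg).const_mul _
    refine this.congr ?_
    filter_upwards with x
    rw [gv_FTinv_eq, neg_neg]
    have : (Real.pi : ℂ) ≠ 0 := by exact_mod_cast pi_ne_zero
    field_simp
  have := gv_inv1 hc hf hF'
  ext x
  conv_rhs => rw [← this]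
  rw [gv_FTinv_eq]
  have h1 : FTinv f = fun x => (1 / (2 * Real.pi) : ℂ) * FT f (-x) := by
    ext x; exact gv_FTinv_eq f x
  rw [h1]
  unfold FT
  rw [← integral_const_mul, ← integral_neg_eq_self]
  congr 1; ext y
  push_cast
  rw [neg_neg]
  ring_nf

/-- a.e. inversion -/
theorem gv_inv_ae {f : ℝ → ℂ} (hf : Integrable f) (hF : Integrable (FT f)) :
    FTinv (FT f) =ᵐ[volume] f := by
  refine ae_eq_of_integral_contDiff_smul_eq ?_ hf.locallyIntegrable ?_
  · exact (gv_FTinv_cont hF).locallyIntegrable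
  intro φ hφ hs
  let S := HasCompactSupport.toSchwartzMap (f := fun x => ((φ x : ℝ) : ℂ))
    (hs.comp_left (g := fun x : ℝ => (x : ℂ)) (by simp)) (ofRealCLM.contDiff.comp hφ)
  have hS : ∀ x, S x = (φ x : ℂ) := fun x => rfl
  have hSi : Integrable (fun x => ((φ x : ℝ) : ℂ)) := by
    exact S.integrable
  have hSF : Integrable (FT (fun x => ((φ x : ℝ) : ℂ))) := by
    have h1 : FT (fun x => ((φ x : ℝ) : ℂ)) = fun ξ => (FourierTransform.fourier S) (ξ / (2 * Real.pi)) := by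
      ext ξ; rw [gv_FT_fourier, SchwartzMap.fourier_coe]; rfl
    rw [h1]
    exact (SchwartzMap.integrable _).comp_div (by positivity)
  set Φ : ℝ → ℂ := fun x => ((φ x : ℝ) : ℂ) with hΦ
  have hΦc : Continuous Φ := S.continuous
  -- Φ = FT (FTinv Φ)
  have hSF' : Integrable (FTinv Φ) := by
    have h1 : FTinv Φ = fun x => (1 / (2 * Real.pi) : ℂ) * FT Φ (-x) := by
      ext x; exact gv_FTinv_eq _ x
    rw [h1]; exact hSF.comp_neg.const_mul _
  have e1 : FT (FTinv Φ) = Φ := gv_inv2 hΦc hSi hSF'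
  have e2 : ∫ x, f x * Φ x = ∫ ξ, FT f ξ * FTinv Φ ξ := by
    rw [gv_FT_mul hf hSF', e1]
  have e3 : ∫ x, FTinv (FT f) x * Φ x = ∫ ξ, FT f ξ * FTinv Φ ξ := by
    simp_rw [gv_FTinv_eq]
    have := gv_FT_mul (hF.comp_neg) hSi
    have h4 : ∀ x, FT (FT f) (-x) = FT (fun t => FT f (-t)) x := by
      intro x
      conv_lhs => rw [FT]
      conv_rhs => rw [FT]
      rw [← integral_neg_eq_self]
      congr 1; ext y; push_cast; ring_nf
    have h5 : ∫ x, (1 / (2 * Real.pi) : ℂ) * FT (FT f) (-x) * Φ x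
        = (1 / (2 * Real.pi) : ℂ) * ∫ x, FT (fun t => FT f (-t)) x * Φ x := by
      rw [← integral_const_mul]; congr 1; ext x; rw [h4]; ring
    rw [h5, this, ← integral_neg_eq_self, ← integral_const_mul]
    congr 1; ext x; simp only [neg_neg]; ring
  calc ∫ x, φ x • FTinv (FT f) x = ∫ x, FTinv (FT f) x * Φ x := by
        congr 1; ext x; rw [real_smul, mul_comm]
    _ = ∫ x, f x * Φ x := by rw [e3, e2]
    _ = _ := by congr 1; ext x; rw [real_smul, mul_comm]

theorem gv_inv_ae' {f : ℝ → ℂ} (hf : Integrable f) (hF : Integrable (FTinv f)) :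
    FT (FTinv f) =ᵐ[volume] f := by
  have hF' : Integrable (FT f) := by
    have : Integrable (fun x => (2 * Real.pi : ℂ) * FTinv f (-x)) := (hF.comp_neg).const_mul _
    refine this.congr ?_
    filter_upwards with x
    rw [gv_FTinv_eq, neg_neg]
    have : (Real.pi : ℂ) ≠ 0 := by exact_mod_cast pi_ne_zero
    field_simp
  have := gv_inv_ae hf hF'
  refine Filter.EventuallyEq.trans (Filter.Eventually.of_forall fun x => ?_) this
  rw [gv_FTinv_eq]
  have h1 : FTinv f = fun x => (1 / (2 * Real.pi) : ℂ) * FT f (-x) := by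
    ext x; exact gv_FTinv_eq f x
  rw [h1]
  unfold FT
  rw [← integral_const_mul, ← integral_neg_eq_self]
  congr 1; ext y
  push_cast
  rw [neg_neg]
  ring_nf

theorem gv_fatou {α : Type*} [MeasurableSpace α] {μ : Measure α} {f : ℕ → α → ENNReal}
    {g : α → ENNReal} {C : ENNReal}
    (hm : ∀ n, AEMeasurable (f n) μ) (ht : ∀ᵐ x ∂μ, Tendsto (fun n => f n x) atTop (nhds (g x)))
    (hC : ∀ n, ∫⁻ x, f n x ∂μ ≤ C) : ∫⁻ x, g x ∂μ ≤ C := by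
  have h1 : ∫⁻ x, g x ∂μ = ∫⁻ x, liminf (fun n => f n x) atTop ∂μ := by
    apply lintegral_congr_ae
    filter_upwards [ht] with x hx
    exact hx.liminf_eq.symm
  rw [h1]
  refine (lintegral_liminf_le' hm).trans ?_
  refine liminf_le_of_frequently_le' (Frequently.of_forall hC)

theorem gv_expabs_int {η : ℝ} (hη : 0 < η) : Integrable (fun x : ℝ => ((exp (-η * |x|) : ℝ) : ℂ)) := by
  refine Integrable.ofReal (f := fun x : ℝ => exp (-η * |x|)) ?_
  rw [← integrableOn_univ, ← Set.Iic_union_Ioi (a := (0:ℝ))]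
  apply IntegrableOn.union
  · refine (integrableOn_exp_mul_Iic hη 0).congr_fun ?_ measurableSet_Iic
    intro x hx
    simp only
    rw [abs_of_nonpos hx]; ring_nf
  · refine (integrableOn_exp_mul_Ioi (a := -η) (by linarith) 0).congr_fun ?_ measurableSet_Ioi
    intro x hx
    simp only
    rw [abs_of_pos hx]

theorem gv_FT_expabs {η : ℝ} (hη : 0 < η) (ξ : ℝ) :
    FT (fun x : ℝ => ((exp (-η * |x|) : ℝ) : ℂ)) ξ = ((2 * η / (η ^ 2 + ξ ^ 2) : ℝ) : ℂ) := by
  have hI : Integrable (fun x : ℝ => Complex.exp (-Complex.I * (ξ : ℂ) * (x : ℂ)) *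
      ((exp (-η * |x|) : ℝ) : ℂ)) := by
    refine (gv_expabs_int hη).bdd_mul (c := 1) (by fun_prop) ?_
    filter_upwards with x; exact (gv_norm_exp' _ _).le
  unfold FT
  rw [← intervalIntegral.integral_Iic_add_Ioi (b := 0) hI.integrableOn hI.integrableOn]
  have h1 : ∫ x in Iic (0 : ℝ), Complex.exp (-Complex.I * (ξ : ℂ) * (x : ℂ)) *
      ((exp (-η * |x|) : ℝ) : ℂ) = ∫ x in Iic (0:ℝ), Complex.exp ((η - Complex.I * ξ) * (x : ℂ)) := by
    apply setIntegral_congr_fun measurableSet_Iic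
    intro x hx
    simp only
    rw [abs_of_nonpos hx, ofReal_exp, ← exp_add]
    congr 1; push_cast; ring
  have h2 : ∫ x in Ioi (0 : ℝ), Complex.exp (-Complex.I * (ξ : ℂ) * (x : ℂ)) *
      ((exp (-η * |x|) : ℝ) : ℂ) = ∫ x in Ioi (0:ℝ), Complex.exp ((-η - Complex.I * ξ) * (x : ℂ)) := by
    apply setIntegral_congr_fun measurableSet_Ioi
    intro x hx
    simp only
    rw [abs_of_pos hx, ofReal_exp, ← exp_add]
    congr 1; push_cast; ring
  rw [h1, h2, integral_exp_mul_complex_Iic (by simpa using hη), integral_exp_mul_complex_Ioi (by simpa using hη)]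
  have n1 : (η - Complex.I * ξ : ℂ) ≠ 0 := by
    intro h; have := congrArg re h; simp at this; linarith
  have n2 : (-η - Complex.I * ξ : ℂ) ≠ 0 := by
    intro h; have := congrArg re h; simp at this; linarith
  have n3 : ((η:ℂ) ^ 2 + (ξ:ℂ) ^ 2) ≠ 0 := by
    have : η ^ 2 + ξ ^ 2 ≠ 0 := by positivity
    exact_mod_cast this
  push_cast
  simp only [mul_zero, Complex.exp_zero]
  field_simp
  linear_combination (-2 * η * ξ ^ 2) * Complex.I_sq

theorem gv_cauchy_int {η : ℝ} (hη : 0 < η) : Integrable (fun ξ : ℝ => 1 / (η ^ 2 + ξ ^ 2)) := by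
  have := (integrable_inv_one_add_sq.comp_div hη.ne').const_mul (1 / η ^ 2)
  refine this.congr ?_
  filter_upwards with x
  field_simp

theorem gv_cauchy_integral {η : ℝ} (hη : 0 < η) : ∫ ξ : ℝ, 2 * η / (η ^ 2 + ξ ^ 2) = 2 * Real.pi := by
  have h : ∀ ξ : ℝ, 2 * η / (η ^ 2 + ξ ^ 2) = (2 / η) * (fun x : ℝ => (1 + x ^ 2)⁻¹) (ξ / η) := by
    intro ξ; field_simp
  rw [integral_congr_ae (ae_of_all _ h)]
  rw [integral_const_mul, Measure.integral_comp_div (fun x : ℝ => (1 + x ^ 2)⁻¹) η, integral_univ_inv_one_add_sq, abs_of_pos hη, smul_eq_mul]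
  field_simp

theorem gv_FT_cauchy {η : ℝ} (hη : 0 < η) (t : ℝ) :
    FT (fun ξ : ℝ => ((1 / (η ^ 2 + ξ ^ 2) : ℝ) : ℂ)) t = ((Real.pi / η * exp (-η * |t|) : ℝ) : ℂ) := by
  have e : FT (fun x : ℝ => ((exp (-η * |x|) : ℝ) : ℂ)) =
    fun ξ => ((2 * η : ℝ) : ℂ) * ((1 / (η ^ 2 + ξ ^ 2) : ℝ) : ℂ) := by
    ext ξ; rw [gv_FT_expabs hη, ← Complex.ofReal_mul]; congr 1; ring
  have h := gv_inv1 (f := fun x : ℝ => ((exp (-η * |x|) : ℝ) : ℂ)) (by fun_prop) (gv_expabs_int hη)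
    (by rw [e]; exact ((gv_cauchy_int hη).ofReal).const_mul _)
  have h := congrFun h (-t)
  rw [gv_FTinv_eq, neg_neg, e, abs_neg] at h
  have e2 : FT (fun ξ => ((2 * η : ℝ) : ℂ) * ((1 / (η ^ 2 + ξ ^ 2) : ℝ) : ℂ)) t =
     ((2 * η : ℝ) : ℂ) * FT (fun ξ => ((1 / (η ^ 2 + ξ ^ 2) : ℝ) : ℂ)) t := by
    unfold FT; rw [← integral_const_mul]; congr 1; ext x; ring
  rw [e2] at h
  rw [Complex.ofReal_mul, ← h]
  have : (Real.pi : ℂ) ≠ 0 := by exact_mod_cast pi_ne_zero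
  have : (η : ℂ) ≠ 0 := by exact_mod_cast hη.ne'
  push_cast; field_simp

theorem gv_lint_ofReal_cauchy {η : ℝ} (hη : 0 < η) (y : ℝ) :
    ∫⁻ ξ : ℝ, ofReal (2 * η / (η ^ 2 + (ξ - y) ^ 2)) = ofReal (2 * Real.pi) := by
  rw [lintegral_sub_right_eq_self (fun ξ : ℝ => ofReal (2 * η / (η ^ 2 + ξ ^ 2))) y]
  rw [← ofReal_integral_eq_lintegral_ofReal, gv_cauchy_integral hη]
  · refine ((gv_cauchy_int hη).const_mul (2 * η)).congr ?_
    filter_upwards with x; ring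
  · filter_upwards with x; positivity

theorem gv_bessel_aux {Φ : ℝ → ℂ} (hΦ : Integrable Φ) {η : ℝ} (hη : 0 < η) :
    ∫⁻ x, ofReal (‖FT Φ x‖ ^ 2 * exp (-η * |x|)) ≤
      ofReal (2 * Real.pi) * ∫⁻ x, ‖Φ x‖ₑ ^ 2 := by
  set k : ℝ → ℂ := fun x : ℝ => ((exp (-η * |x|) : ℝ) : ℂ) with hk
  have hki : Integrable k := gv_expabs_int hη
  have hc := gv_FT_cont hΦ
  have hg : Integrable (fun x => (starRingEnd ℂ) (FT Φ x) * k x) := by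
    refine hki.bdd_mul (c := ∫ x, ‖Φ x‖) (by fun_prop) ?_
    filter_upwards with x
    rw [RCLike.norm_conj]; exact gv_FT_norm _ _
  have hreal : ∀ x, FT Φ x * ((starRingEnd ℂ) (FT Φ x) * k x) = ((‖FT Φ x‖ ^ 2 * exp (-η * |x|) : ℝ) : ℂ) := by
    intro x
    rw [← mul_assoc, Complex.mul_conj, normSq_eq_norm_sq]
    simp [hk]
  have hint : Integrable (fun x => ‖FT Φ x‖ ^ 2 * exp (-η * |x|)) := by
    have h1 : Integrable (fun x => FT Φ x * ((starRingEnd ℂ) (FT Φ x) * k x)) := by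
      refine hg.bdd_mul (c := ∫ x, ‖Φ x‖) (by fun_prop) ?_
      filter_upwards with x
      exact gv_FT_norm _ _
    refine h1.norm.congr ?_
    filter_upwards with x
    rw [hreal, norm_real, norm_of_nonneg (by positivity)]
  rw [← ofReal_integral_eq_lintegral_ofReal hint (by filter_upwards with x; positivity)]
  have hval : ((∫ x, ‖FT Φ x‖ ^ 2 * exp (-η * |x|) : ℝ) : ℂ) =
      ∫ x, Φ x * FT (fun x => (starRingEnd ℂ) (FT Φ x) * k x) x := by
    rw [← gv_FT_mul hΦ hg, ← integral_complex_ofReal]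
    congr 1; ext x; rw [hreal]
  -- compute FT
  have hΦ' : Integrable (fun y => (starRingEnd ℂ) (Φ (-y))) := by
    have : Integrable (fun y => (starRingEnd ℂ) (Φ y)) := by
      exact (Complex.conjCLE.integrable_comp_iff).2 hΦ
    exact this.comp_neg
  have hconj : ∀ x, (starRingEnd ℂ) (FT Φ x) = FT (fun y => (starRingEnd ℂ) (Φ (-y))) x := by
    intro x
    unfold FT
    rw [← integral_conj, ← integral_neg_eq_self]
    congr 1; ext y
    rw [map_mul, ← exp_conj]
    simp
  have hFT : ∀ ξ, FT (fun x => (starRingEnd ℂ) (FT Φ x) * k x) ξ =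
      ∫ y, (starRingEnd ℂ) (Φ y) * ((2 * η / (η ^ 2 + (ξ - y) ^ 2) : ℝ) : ℂ) := by
    intro ξ
    have h1 : Integrable (fun x : ℝ => Complex.exp (-Complex.I * (ξ : ℂ) * (x : ℂ)) * k x) := by
      refine hki.bdd_mul (c := 1) (by fun_prop) ?_
      filter_upwards with x; exact (gv_norm_exp' _ _).le
    calc FT (fun x => (starRingEnd ℂ) (FT Φ x) * k x) ξ
        = ∫ x, FT (fun y => (starRingEnd ℂ) (Φ (-y))) x * (Complex.exp (-Complex.I * (ξ : ℂ) * (x : ℂ)) * k x) := by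
          conv_lhs => rw [FT]
          congr 1; ext x; rw [hconj]; ring
      _ = ∫ y, (starRingEnd ℂ) (Φ (-y)) * FT (fun x => Complex.exp (-Complex.I * (ξ : ℂ) * (x : ℂ)) * k x) y :=
          gv_FT_mul hΦ' h1
      _ = ∫ y, (starRingEnd ℂ) (Φ (-y)) * ((2 * η / (η ^ 2 + (ξ - (-y)) ^ 2) : ℝ) : ℂ) := by
          congr 1; ext y
          congr 1
          rw [sub_neg_eq_add, ← gv_FT_expabs hη]
          unfold FT
          congr 1; ext x
          rw [← mul_assoc, ← exp_add]
          congr 2; push_cast; ring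
      _ = _ := by
          rw [← integral_neg_eq_self]
          simp only [neg_neg]
  have hb : ∫ x, ‖FT Φ x‖ ^ 2 * exp (-η * |x|) =
      ‖∫ x, Φ x * ∫ y, (starRingEnd ℂ) (Φ y) * ((2 * η / (η ^ 2 + (x - y) ^ 2) : ℝ) : ℂ)‖ := by
    simp_rw [← hFT]
    rw [← hval, norm_real, norm_of_nonneg]
    exact integral_nonneg (fun x => by positivity)
  rw [hb, ofReal_norm]
  have hm : AEMeasurable (fun x => ‖Φ x‖ₑ) := hΦ.aestronglyMeasurable.enorm
  have hmk : Measurable (fun p : ℝ × ℝ => ofReal (2 * η / (η ^ 2 + (p.1 - p.2) ^ 2))) := by fun_prop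
  calc ‖∫ x, Φ x * ∫ y, (starRingEnd ℂ) (Φ y) * ((2 * η / (η ^ 2 + (x - y) ^ 2) : ℝ) : ℂ)‖ₑ
      ≤ ∫⁻ x, ‖Φ x * ∫ y, (starRingEnd ℂ) (Φ y) * ((2 * η / (η ^ 2 + (x - y) ^ 2) : ℝ) : ℂ)‖ₑ :=
        enorm_integral_le_lintegral_enorm _
    _ ≤ ∫⁻ x, ∫⁻ y, 2⁻¹ * (‖Φ x‖ₑ ^ 2 * ofReal (2 * η / (η ^ 2 + (x - y) ^ 2)))
          + 2⁻¹ * (‖Φ y‖ₑ ^ 2 * ofReal (2 * η / (η ^ 2 + (x - y) ^ 2))) := by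
        apply lintegral_mono
        intro x
        simp only
        rw [enorm_mul]
        calc _ ≤ ‖Φ x‖ₑ * ∫⁻ y, ‖(starRingEnd ℂ) (Φ y) * ((2 * η / (η ^ 2 + (x - y) ^ 2) : ℝ) : ℂ)‖ₑ := by
              gcongr; exact enorm_integral_le_lintegral_enorm _
          _ = ∫⁻ y, ‖Φ x‖ₑ * ‖(starRingEnd ℂ) (Φ y) * ((2 * η / (η ^ 2 + (x - y) ^ 2) : ℝ) : ℂ)‖ₑ := by
              rw [lintegral_const_mul' _ _ (by simp)]
          _ ≤ _ := by
              apply lintegral_mono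
              intro y
              simp only
              rw [← enorm_mul, ← ofReal_norm, ← ofReal_norm, ← ofReal_norm]
              rw [← ofReal_pow (by positivity), ← ofReal_pow (by positivity),
                ← ofReal_mul (by positivity), ← ofReal_mul (by positivity)]
              rw [show (2⁻¹ : ENNReal) = ofReal (2⁻¹) by
                rw [ENNReal.ofReal_inv_of_pos (by norm_num)]; simp]
              rw [← ofReal_mul (by positivity), ← ofReal_mul (by positivity),
                ← ofReal_add (by positivity) (by positivity)]
              apply ofReal_le_ofReal
              rw [norm_mul, norm_mul, RCLike.norm_conj, norm_real, norm_of_nonneg (by positivity)]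
              have h3 : 0 ≤ 2 * η / (η ^ 2 + (x - y) ^ 2) := by positivity
              nlinarith [mul_nonneg h3 (sq_nonneg (‖Φ x‖ - ‖Φ y‖))]
    _ = 2⁻¹ * (∫⁻ x, ∫⁻ y, ‖Φ x‖ₑ ^ 2 * ofReal (2 * η / (η ^ 2 + (x - y) ^ 2)))
          + 2⁻¹ * (∫⁻ x, ∫⁻ y, ‖Φ y‖ₑ ^ 2 * ofReal (2 * η / (η ^ 2 + (x - y) ^ 2))) := by
        rw [← lintegral_const_mul' _ _ (by simp), ← lintegral_const_mul' _ _ (by simp), ← lintegral_add_left']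
        · congr 1; ext x
          rw [lintegral_add_left', lintegral_const_mul' 2⁻¹ _ (by simp), lintegral_const_mul' 2⁻¹ _ (by simp)]
          exact (by fun_prop : Measurable (fun y => 2⁻¹ * (‖Φ x‖ₑ ^ 2 *
            ofReal (2 * η / (η ^ 2 + (x - y) ^ 2))))).aemeasurable
        · apply AEMeasurable.const_mul
          have : (fun x => ∫⁻ y, ‖Φ x‖ₑ ^ 2 * ofReal (2 * η / (η ^ 2 + (x - y) ^ 2))) =
             fun x => ‖Φ x‖ₑ ^ 2 * ∫⁻ y, ofReal (2 * η / (η ^ 2 + (x - y) ^ 2)) := by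
            ext x; rw [lintegral_const_mul' _ _ (by simp)]
          rw [this]
          exact (hm.pow_const 2).mul (Measurable.lintegral_prod_right' hmk).aemeasurable
    _ = ofReal (2 * Real.pi) * ∫⁻ x, ‖Φ x‖ₑ ^ 2 := by
        have e1 : ∫⁻ x, ∫⁻ y, ‖Φ x‖ₑ ^ 2 * ofReal (2 * η / (η ^ 2 + (x - y) ^ 2)) =
            ofReal (2 * Real.pi) * ∫⁻ x, ‖Φ x‖ₑ ^ 2 := by
          rw [← lintegral_const_mul' _ _ ofReal_ne_top]
          congr 1; ext x
          rw [lintegral_const_mul' _ _ (by simp), mul_comm]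
          congr 1
          rw [← gv_lint_ofReal_cauchy hη x]
          congr 1; ext y; congr 3; ring
        have e2 : ∫⁻ x, ∫⁻ y, ‖Φ y‖ₑ ^ 2 * ofReal (2 * η / (η ^ 2 + (x - y) ^ 2)) =
            ofReal (2 * Real.pi) * ∫⁻ x, ‖Φ x‖ₑ ^ 2 := by
          rw [lintegral_lintegral_swap]
          · rw [← lintegral_const_mul' _ _ ofReal_ne_top]
            congr 1; ext x
            rw [lintegral_const_mul' _ _ (by simp), mul_comm]
            congr 1
            rw [← gv_lint_ofReal_cauchy hη x]
          · exact ((hm.comp_quasiMeasurePreserving Measure.quasiMeasurePreserving_snd).pow_const 2).mul hmk.aemeasurable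
        rw [e1, e2, ← add_mul, ENNReal.inv_two_add_inv_two, one_mul]

theorem gv_bessel {Φ : ℝ → ℂ} (hΦ : Integrable Φ) :
    ∫⁻ x, ‖FT Φ x‖ₑ ^ 2 ≤ ofReal (2 * Real.pi) * ∫⁻ x, ‖Φ x‖ₑ ^ 2 := by
  have hc := gv_FT_cont hΦ
  refine gv_fatou (f := fun n x => ofReal (‖FT Φ x‖ ^ 2 * exp (-(1 / ((n : ℝ) + 1)) * |x|))) ?_ ?_
    (fun n => gv_bessel_aux hΦ (by positivity))
  · intro n
    exact Measurable.aemeasurable (by fun_prop)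
  · filter_upwards with x
    rw [← ofReal_norm, ← ofReal_pow (by positivity)]
    apply tendsto_ofReal
    have : Tendsto (fun n : ℕ => 1 / ((n : ℝ) + 1)) atTop (nhds 0) := tendsto_one_div_add_atTop_nhds_zero_nat
    have := ((this.neg.mul_const |x|).rexp).const_mul (‖FT Φ x‖ ^ 2)
    simpa using this

theorem gv_bessel' {Φ : ℝ → ℂ} (hΦ : Integrable Φ) :
    ∫⁻ x, ‖FTinv Φ x‖ₑ ^ 2 ≤ ofReal (1 / (2 * Real.pi)) * ∫⁻ x, ‖Φ x‖ₑ ^ 2 := by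
  have hn : ‖(1 / (2 * Real.pi) : ℂ)‖ₑ = ofReal (1 / (2 * Real.pi)) := by
    rw [show (1 / (2 * Real.pi) : ℂ) = ((1 / (2 * Real.pi) : ℝ) : ℂ) by push_cast; ring]
    rw [← ofReal_norm, norm_real, norm_of_nonneg (by positivity)]
  have h1 : ∫⁻ x, ‖FTinv Φ x‖ₑ ^ 2 = ofReal (1 / (2 * Real.pi)) ^ 2 * ∫⁻ x, ‖FT Φ x‖ₑ ^ 2 := by
    rw [← lintegral_const_mul' _ _ (by simp)]
    rw [← lintegral_neg_eq_self (fun x => ofReal (1 / (2 * Real.pi)) ^ 2 * ‖FT Φ x‖ₑ ^ 2)]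
    congr 1; ext x
    rw [gv_FTinv_eq, enorm_mul, hn, mul_pow]
  rw [h1]
  calc _ ≤ ofReal (1 / (2 * Real.pi)) ^ 2 * (ofReal (2 * Real.pi) * ∫⁻ x, ‖Φ x‖ₑ ^ 2) := by
        gcongr; exact gv_bessel hΦ
    _ = _ := by
        rw [← mul_assoc, ← ofReal_pow (by positivity), ← ofReal_mul (by positivity)]
        congr 2; field_simp

theorem gv_lint_rpow_exp {a s : ℝ} (ha : 0 < a) (hs : 0 < s) :
    ∫⁻ v in Ioi (0:ℝ), ofReal (v ^ (a - 1) * exp (-(s * v))) =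
      ofReal ((1 / s) ^ a * Gamma a) := by
  have h1 := Real.integral_rpow_mul_exp_neg_mul_Ioi ha hs
  rw [← h1, ofReal_integral_eq_lintegral_ofReal]
  · by_contra hcon
    rw [integral_undef hcon] at h1
    have : 0 < (1 / s) ^ a * Gamma a := mul_pos (by positivity) (Gamma_pos_of_pos ha)
    linarith
  · refine (ae_restrict_iff' measurableSet_Ioi).2 (ae_of_all _ fun v hv => ?_)
    have : (0:ℝ) < v := hv
    simp only [Pi.zero_apply]; positivity

theorem gv_stieltjes {θ b : ℝ} (h0 : 0 < θ) (h1 : θ < 1) (hb : 0 < b) :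
    ∫⁻ v in Ioi (0:ℝ), ofReal (v ^ (θ - 1) / (v + b)) =
      ofReal (Real.pi / sin (Real.pi * θ) * b ^ (θ - 1)) := by
  have e1 : ∀ v ∈ Ioi (0:ℝ), ofReal (v ^ (θ - 1) / (v + b)) =
      ∫⁻ s in Ioi (0:ℝ), ofReal (v ^ (θ - 1) * exp (-(s * v)) * exp (-(b * s))) := by
    intro v hv
    have hv : (0:ℝ) < v := hv
    have := gv_lint_rpow_exp (a := 1) (s := v + b) one_pos (by positivity)
    simp only [sub_self, rpow_zero, one_mul, rpow_one, Real.Gamma_one, mul_one] at this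
    rw [div_eq_mul_one_div, ofReal_mul (by positivity), ← this, ← lintegral_const_mul' _ _ ofReal_ne_top]
    congr 1; ext s
    rw [← ofReal_mul (by positivity), mul_assoc, ← Real.exp_add]
    congr 3; ring_nf
  rw [setLIntegral_congr_fun measurableSet_Ioi e1, lintegral_lintegral_swap]
  · have e2 : ∀ s ∈ Ioi (0:ℝ), ∫⁻ v in Ioi (0:ℝ),
        ofReal (v ^ (θ - 1) * exp (-(s * v)) * exp (-(b * s))) =
        ofReal (Gamma θ) * ofReal (s ^ ((1 - θ) - 1) * exp (-(b * s))) := by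
      intro s hs
      have hs : (0:ℝ) < s := hs
      have hg := Gamma_pos_of_pos h0
      calc _ = ∫⁻ v in Ioi (0:ℝ),
        ofReal (v ^ (θ - 1) * exp (-(s * v))) * ofReal (exp (-(b * s))) := by
            congr 1; ext v; rw [ENNReal.ofReal_mul' (by positivity)]
        _ = _ := by
            rw [lintegral_mul_const' _ _ ofReal_ne_top, gv_lint_rpow_exp h0 hs,
              ← ofReal_mul (by positivity), ← ofReal_mul (by positivity)]
            congr 1
            rw [show (1 - θ - 1 : ℝ) = -θ by ring, rpow_neg hs.le, one_div, inv_rpow hs.le]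
            ring
    rw [setLIntegral_congr_fun measurableSet_Ioi e2, lintegral_const_mul' _ _ ofReal_ne_top,
      gv_lint_rpow_exp (by linarith) hb, ← ofReal_mul (Gamma_pos_of_pos h0).le]
    congr 1
    rw [← Real.Gamma_mul_Gamma_one_sub, one_div, inv_rpow hb.le, ← rpow_neg hb.le,
      show -(1 - θ) = θ - 1 by ring]
    ring
  · apply Measurable.aemeasurable
    fun_prop

section
variable {α : Type*} [MeasurableSpace α] {μ : Measure α}

/-- hypotheses of the resolvent lemma -/
structure GvRes (μ : Measure α) (b A ψ Q : α → ℝ) (R : ℝ → ℝ) : Prop where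
  bm : Measurable b
  b1 : ∀ x, 1 ≤ b x
  A0 : ∀ x, 0 ≤ A x
  Q0 : ∀ x, 0 ≤ Q x
  Ai : Integrable A μ
  ψm : AEStronglyMeasurable ψ μ
  Qi : Integrable Q μ
  eq : ∀ᵐ x ∂μ, A x = Q x - 2 * ψ x
  ψA : ∀ x, |ψ x| ≤ A x
  R0 : ∀ v, 0 < v → 0 ≤ R v
  Ra : ∀ v w, 0 < v → v ≤ w → R w ≤ R v
  Rd : ∀ v, 0 < v → R v = ∫ x, ψ x / (v + b x) ∂μ

theorem gv_decay {R : ℝ → ℝ} {τ : ℝ} (hτ : 0 ≤ τ) (R0 : ∀ v, 0 < v → 0 ≤ R v)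
    (Ra : ∀ v w, 0 < v → v ≤ w → R w ≤ R v)
    (hI : IntegrableOn (fun v => v ^ τ * R v) (Ioi 0)) :
    Tendsto (fun v => v ^ (τ + 1) * R v) atTop (nhds 0) := by
  -- tail integral
  have ht : Tendsto (fun v : ℝ => ∫ w in Ioi v, w ^ τ * R w) atTop (nhds 0) := by
    have h1 := intervalIntegral_tendsto_integral_Ioi 0 hI tendsto_id
    have h2 := h1.const_sub (∫ w in Ioi 0, w ^ τ * R w)
    rw [sub_self] at h2
    refine h2.congr' ?_
    filter_upwards [eventually_ge_atTop 0] with v hv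
    have := intervalIntegral.integral_Ioi_sub_Ioi (f := fun w => w ^ τ * R w) (μ := volume) hI hv
    simp only [id]
    rw [← this]; ring
  have ht2 : Tendsto (fun v : ℝ => (2 ^ (τ + 1)) * ∫ w in Ioi (v / 2), w ^ τ * R w) atTop (nhds 0) := by
    have := (ht.comp (tendsto_id.atTop_div_const (by norm_num : (0:ℝ) < 2))).const_mul ((2:ℝ) ^ (τ + 1))
    simpa using this
  refine tendsto_of_tendsto_of_tendsto_of_le_of_le' tendsto_const_nhds ht2 ?_ ?_
  · filter_upwards [eventually_gt_atTop 0] with v hv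
    exact mul_nonneg (by positivity) (R0 v hv)
  · filter_upwards [eventually_gt_atTop 0] with v hv
    have hI2 : IntegrableOn (fun w => w ^ τ * R w) (Ioi (v / 2)) :=
      hI.mono_set (Set.Ioi_subset_Ioi (by positivity))
    have h1 : ∫ w in Ioc (v / 2) v, (v / 2) ^ τ * R v ≤ ∫ w in Ioc (v / 2) v, w ^ τ * R w := by
      refine setIntegral_mono_on (integrableOn_const (by simp)) (hI2.mono_set Ioc_subset_Ioi_self) measurableSet_Ioc ?_
      intro w hw
      have hw0 : 0 < w := lt_trans (by positivity) hw.1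
      exact mul_le_mul (rpow_le_rpow (by positivity) hw.1.le hτ) (Ra w v hw0 hw.2) (R0 v hv) (by positivity)
    have h2 : ∫ w in Ioc (v / 2) v, w ^ τ * R w ≤ ∫ w in Ioi (v / 2), w ^ τ * R w := by
      refine setIntegral_mono_set hI2 ?_ (Ioc_subset_Ioi_self.eventuallyLE)
      refine (ae_restrict_iff' measurableSet_Ioi).2 (ae_of_all _ fun w hw => ?_)
      have : (0:ℝ) < w := lt_trans (by positivity) hw
      exact mul_nonneg (by positivity) (R0 w this)
    have h3 : ∫ w in Ioc (v / 2) v, (v / 2) ^ τ * R v = (v / 2) * ((v / 2) ^ τ * R v) := by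
      rw [setIntegral_const]; simp [Measure.real]
      left; rw [toReal_ofReal (by linarith)]; ring
    have h4 : v ^ (τ + 1) * R v = 2 ^ (τ + 1) * ((v / 2) * ((v / 2) ^ τ * R v)) := by
      rw [div_rpow hv.le (by norm_num), rpow_add_one hv.ne', rpow_add_one (by norm_num)]
      field_simp
    rw [h4]
    gcongr
    rw [← h3]; exact h1.trans h2

theorem gv_decay_nat {R : ℝ → ℝ} {τ : ℝ} (hτ : 0 ≤ τ) (R0 : ∀ v, 0 < v → 0 ≤ R v)
    (Ra : ∀ v w, 0 < v → v ≤ w → R w ≤ R v)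
    (hI : IntegrableOn (fun v => v ^ τ * R v) (Ioi 0)) {i : ℕ} (hi : (i : ℝ) ≤ τ) :
    Tendsto (fun v => v ^ (i + 1) * R v) atTop (nhds 0) := by
  refine tendsto_of_tendsto_of_tendsto_of_le_of_le' tendsto_const_nhds (gv_decay hτ R0 Ra hI) ?_ ?_
  · filter_upwards [eventually_gt_atTop 0] with v hv
    exact mul_nonneg (by positivity) (R0 v hv)
  · filter_upwards [eventually_ge_atTop 1] with v hv
    have := R0 v (by linarith)
    gcongr
    rw [← rpow_natCast]
    apply rpow_le_rpow_of_exponent_le hv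
    push_cast; linarith

theorem gv_res_int {b ψ : α → ℝ} (bm : Measurable b) (b1 : ∀ x, 1 ≤ b x) {i : ℕ} {v : ℝ} (hv : 0 < v)
    (hψ : Integrable (fun x => b x ^ i * ψ x) μ) :
    Integrable (fun x => b x ^ i * ψ x / (v + b x)) μ ∧ Integrable (fun x => b x ^ (i + 1) * ψ x / (v + b x)) μ := by
  constructor
  · have := hψ.bdd_mul (c := 1) (f := fun x => 1 / (v + b x)) (by apply Measurable.aestronglyMeasurable; fun_prop) (by
      filter_upwards with x
      have := b1 x
      rw [norm_of_nonneg (by positivity), div_le_one (by positivity)]; linarith)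
    refine this.congr ?_
    filter_upwards with x; ring
  · have := hψ.bdd_mul (c := 1) (f := fun x => b x / (v + b x)) (by apply Measurable.aestronglyMeasurable; fun_prop) (by
      filter_upwards with x
      have := b1 x
      rw [norm_of_nonneg (by positivity), div_le_one (by positivity)]; linarith)
    refine this.congr ?_
    filter_upwards with x; ring

theorem gv_res_moment {b A ψ Q : α → ℝ} {R : ℝ → ℝ} (H : GvRes μ b A ψ Q R) {τ : ℝ} (hτ : 0 ≤ τ)
    (hI : IntegrableOn (fun v => v ^ τ * R v) (Ioi 0)) {i : ℕ} (hi : (i : ℝ) ≤ τ)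
    (hA : Integrable (fun x => b x ^ i * ψ x) μ)
    (hM : ∀ v, 0 < v → ∫ x, b x ^ i * ψ x / (v + b x) ∂μ = (-v) ^ i * R v) :
    ∫ x, b x ^ i * ψ x ∂μ = 0 ∧
      ∀ v, 0 < v → ∫ x, b x ^ (i + 1) * ψ x / (v + b x) ∂μ = (-v) ^ (i + 1) * R v := by
  have h0 : ∫ x, b x ^ i * ψ x ∂μ = 0 := by
    have t1 : Tendsto (fun n : ℕ => ∫ x, ((n : ℝ) + 1) * (b x ^ i * ψ x / (((n : ℝ) + 1) + b x)) ∂μ) atTop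
        (nhds (∫ x, b x ^ i * ψ x ∂μ)) := by
      refine tendsto_integral_of_dominated_convergence (fun x => ‖b x ^ i * ψ x‖) ?_ hA.norm ?_ ?_
      · intro n
        exact ((gv_res_int H.bm H.b1 (by positivity) hA).1.const_mul _).aestronglyMeasurable
      · intro n
        filter_upwards with x
        have hb := H.b1 x
        rw [show ((n : ℝ) + 1) * (b x ^ i * ψ x / (((n : ℝ) + 1) + b x)) =
          (((n : ℝ) + 1) / (((n : ℝ) + 1) + b x)) * (b x ^ i * ψ x) by ring, norm_mul]
        apply mul_le_of_le_one_left (norm_nonneg _)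
        rw [norm_of_nonneg (by positivity), div_le_one (by positivity)]; linarith
      · filter_upwards with x
        have hb := H.b1 x
        have h1 : Tendsto (fun n : ℕ => 1 - b x / (((n : ℝ) + 1) + b x)) atTop (nhds (1 - 0)) := by
          refine tendsto_const_nhds.sub (Tendsto.const_div_atTop ?_ _)
          exact tendsto_atTop_add_const_right _ _ (tendsto_atTop_add_const_right _ _ tendsto_natCast_atTop_atTop)
        have h2 := h1.mul_const (b x ^ i * ψ x)
        simp only [sub_zero, one_mul] at h2
        refine h2.congr fun n => ?_
        have : ((n : ℝ) + 1) + b x ≠ 0 := by positivity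
        field_simp; ring
    have t2 : Tendsto (fun n : ℕ => ∫ x, ((n : ℝ) + 1) * (b x ^ i * ψ x / (((n : ℝ) + 1) + b x)) ∂μ) atTop
        (nhds 0) := by
      have h3 := (gv_decay_nat hτ H.R0 H.Ra hI hi).comp
        (tendsto_atTop_add_const_right _ 1 (tendsto_natCast_atTop_atTop (R := ℝ)))
      have h4 := h3.const_mul ((-1 : ℝ) ^ i)
      rw [mul_zero] at h4
      refine h4.congr fun n => ?_
      rw [integral_const_mul, hM _ (by positivity), neg_pow ((n:ℝ)+1)]
      simp only [Function.comp]
      ring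
    exact tendsto_nhds_unique t1 t2
  refine ⟨h0, fun v hv => ?_⟩
  have h5 : ∫ x, b x ^ (i + 1) * ψ x / (v + b x) ∂μ = ∫ x, (b x ^ i * ψ x - v * (b x ^ i * ψ x / (v + b x))) ∂μ := by
    congr 1; ext x
    have hb := H.b1 x
    have : v + b x ≠ 0 := by positivity
    field_simp; ring
  rw [h5, integral_sub hA ((gv_res_int H.bm H.b1 hv hA).1.const_mul _), h0, integral_const_mul, hM v hv]
  ring

theorem gv_res_induct {b A ψ Q : α → ℝ} {R : ℝ → ℝ} (H : GvRes μ b A ψ Q R) {τ : ℝ} (hτ : 0 ≤ τ)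
    (hI : IntegrableOn (fun v => v ^ τ * R v) (Ioi 0))
    (hQ : Integrable (fun x => b x ^ τ * Q x) μ) (i : ℕ) (hi : (i : ℝ) ≤ τ) :
    Integrable (fun x => b x ^ i * A x) μ ∧ Integrable (fun x => b x ^ i * ψ x) μ ∧
    Integrable (fun x => b x ^ i * Q x) μ ∧
     ∀ v, 0 < v → ∫ x, b x ^ i * ψ x / (v + b x) ∂μ = (-v) ^ i * R v := by
  have bm := H.bm
  have hQi : ∀ i : ℕ, (i : ℝ) ≤ τ → Integrable (fun x => b x ^ i * Q x) μ := by
    intro i hi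
    refine hQ.mono' (by have := H.Qi.aestronglyMeasurable; fun_prop) ?_
    filter_upwards with x
    have := H.b1 x
    have := H.Q0 x
    rw [norm_of_nonneg (by positivity)]
    gcongr
    rw [← rpow_natCast]
    exact rpow_le_rpow_of_exponent_le (H.b1 x) hi
  have hψi : ∀ i : ℕ, Integrable (fun x => b x ^ i * A x) μ → Integrable (fun x => b x ^ i * ψ x) μ := by
    intro i h
    refine h.mono' (by have := H.ψm; fun_prop) ?_
    filter_upwards with x
    have := H.b1 x
    rw [norm_mul, norm_of_nonneg (by positivity)]
    gcongr
    exact H.ψA x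
  induction i with
  | zero =>
    refine ⟨by simpa using H.Ai, hψi 0 (by simpa using H.Ai), by simpa using H.Qi, fun v hv => ?_⟩
    simp [H.Rd v hv]
  | succ i ih =>
    have hi' : (i : ℝ) ≤ τ := by push_cast at hi; linarith
    obtain ⟨hA, hψ, hq, hM⟩ := ih hi'
    obtain ⟨-, hM'⟩ := gv_res_moment H hτ hI hi' hψ hM
    have hA' : Integrable (fun x => b x ^ (i + 1) * A x) μ := by
      have hdec := gv_decay_nat hτ H.R0 H.Ra hI hi
      have hbd : ∃ N : ℕ, ∀ n : ℕ, N ≤ n → ((n:ℝ) + 1) ^ (i + 1 + 1) * R ((n:ℝ) + 1) ≤ 1 := by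
        have := (hdec.comp
          (tendsto_atTop_add_const_right _ 1 (tendsto_natCast_atTop_atTop (R := ℝ)))).eventually_le_const
          (zero_lt_one)
        exact eventually_atTop.1 this
      obtain ⟨N, hN⟩ := hbd
      have hfin : ∫⁻ x, ofReal (b x ^ (i + 1) * A x) ∂μ ≤
          ofReal (∫ x, b x ^ (i + 1) * Q x ∂μ + 2) := by
        refine gv_fatou (f := fun n x => ofReal ((((n + N : ℕ) : ℝ) + 1) *
          (b x ^ (i + 1) * A x / ((((n + N : ℕ) : ℝ) + 1) + b x)))) ?_ ?_ ?_
        · intro n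
          exact (((gv_res_int H.bm H.b1 (by positivity) hA).2.const_mul _).aestronglyMeasurable.aemeasurable).ennreal_ofReal
        · filter_upwards with x
          apply tendsto_ofReal
          have hb := H.b1 x
          have h1 : Tendsto (fun n : ℕ => 1 - b x / (((n : ℝ) + 1) + b x)) atTop (nhds (1 - 0)) := by
            refine tendsto_const_nhds.sub (Tendsto.const_div_atTop ?_ _)
            exact tendsto_atTop_add_const_right _ _ (tendsto_atTop_add_const_right _ _ tendsto_natCast_atTop_atTop)
          have h2 := (h1.comp (tendsto_add_atTop_nat N)).mul_const (b x ^ (i + 1) * A x)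
          simp only [sub_zero, one_mul] at h2
          refine h2.congr fun n => ?_
          have : ((n + N : ℕ) : ℝ) + 1 + b x ≠ 0 := by positivity
          simp only [Function.comp]
          field_simp; ring
        · intro n
          set v : ℝ := ((n + N : ℕ) : ℝ) + 1 with hv
          have hv0 : 0 < v := by positivity
          have iA := (gv_res_int H.bm H.b1 hv0 hA).2
          have iQ := (gv_res_int H.bm H.b1 hv0 hq).2
          have iψ := (gv_res_int H.bm H.b1 hv0 hψ).2
          rw [← ofReal_integral_eq_lintegral_ofReal (iA.const_mul _)]
          · apply ofReal_le_ofReal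
            have e : ∫ x, v * (b x ^ (i + 1) * A x / (v + b x)) ∂μ =
                ∫ x, (v * (b x ^ (i + 1) * Q x / (v + b x)) - 2 * v * (b x ^ (i + 1) * ψ x / (v + b x))) ∂μ := by
              apply integral_congr_ae
              filter_upwards [H.eq] with x hx
              rw [hx]; ring
            rw [e, integral_sub (iQ.const_mul _) (iψ.const_mul _), integral_const_mul (2 * v), hM' v hv0]
            have h1 : ∫ x, v * (b x ^ (i + 1) * Q x / (v + b x)) ∂μ ≤ ∫ x, b x ^ (i + 1) * Q x ∂μ := by
              refine integral_mono (iQ.const_mul _) (hQi (i + 1) hi) fun x => ?_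
              have hb := H.b1 x
              have := H.Q0 x
              simp only
              rw [show v * (b x ^ (i + 1) * Q x / (v + b x)) = (v / (v + b x)) * (b x ^ (i + 1) * Q x) by ring]
              apply mul_le_of_le_one_left (by positivity)
              rw [div_le_one (by positivity)]; linarith
            have h2 : |2 * v * ((-v) ^ (i + 1) * R v)| ≤ 2 := by
              rw [abs_mul, abs_mul (_ ^ _), abs_pow, abs_neg, abs_of_pos hv0, abs_of_nonneg (H.R0 v hv0),
                abs_of_pos (by positivity)]
              have := hN (n + N) (by omega)
              rw [← hv] at this
              calc 2 * v * (v ^ (i + 1) * R v) = 2 * (v ^ (i + 1 + 1) * R v) := by ring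
                _ ≤ 2 := by linarith
            linarith [neg_abs_le (2 * v * ((-v) ^ (i + 1) * R v))]
          · filter_upwards with x
            have hb := H.b1 x
            have := H.A0 x
            simp only [Pi.zero_apply]; positivity
      refine ⟨by have := H.Ai.aestronglyMeasurable; fun_prop, ?_⟩
      rw [hasFiniteIntegral_iff_ofReal]
      · exact hfin.trans_lt ofReal_lt_top
      · filter_upwards with x
        have hb := H.b1 x
        have := H.A0 x
        simp only [Pi.zero_apply]; positivity
    exact ⟨hA', hψi _ hA', hQi _ hi, hM'⟩
end

section
variable {α : Type*} [MeasurableSpace α] {μ : Measure α}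

theorem gv_res_tonelli [SFinite μ] {b F : α → ℝ} (bm : Measurable b) (b1 : ∀ x, 1 ≤ b x) (F0 : ∀ x, 0 ≤ F x)
    {k : ℕ} (hF : Integrable (fun x => b x ^ k * F x) μ) {θ : ℝ} (h0 : 0 < θ) (h1 : θ < 1) :
    ∫⁻ v in Ioi (0:ℝ), ofReal (v ^ (θ - 1) * ∫ x, b x ^ (k + 1) * F x / (v + b x) ∂μ) =
      ofReal (Real.pi / sin (Real.pi * θ)) * ∫⁻ x, ofReal (b x ^ ((k : ℝ) + θ) * F x) ∂μ := by
  have hsin : 0 < sin (Real.pi * θ) := by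
    apply sin_pos_of_pos_of_lt_pi
    · positivity
    · nlinarith [pi_pos]
  have e1 : ∀ v ∈ Ioi (0:ℝ), ofReal (v ^ (θ - 1) * ∫ x, b x ^ (k + 1) * F x / (v + b x) ∂μ) =
      ∫⁻ x, ofReal (b x ^ k * F x) * ofReal (b x * (v ^ (θ - 1) / (v + b x))) ∂μ := by
    intro v hv
    have hv : (0:ℝ) < v := hv
    rw [ofReal_mul (by positivity), ofReal_integral_eq_lintegral_ofReal (gv_res_int bm b1 hv hF).2,
      ← lintegral_const_mul' _ _ ofReal_ne_top]
    · congr 1; ext x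
      have := b1 x
      have := F0 x
      rw [← ofReal_mul (by positivity), ← ofReal_mul (by positivity)]
      congr 1; ring
    · filter_upwards with x
      have := b1 x
      have := F0 x
      simp only [Pi.zero_apply]; positivity
  rw [setLIntegral_congr_fun measurableSet_Ioi e1, lintegral_lintegral_swap,
    ← lintegral_const_mul' _ _ ofReal_ne_top]
  · congr 1; ext x
    have hb := b1 x
    have := F0 x
    rw [lintegral_const_mul' _ _ ofReal_ne_top]
    have e2 : ∀ v : ℝ, ofReal (b x * (v ^ (θ - 1) / (v + b x))) =
      ofReal (b x) * ofReal (v ^ (θ - 1) / (v + b x)) := fun v =>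
        ofReal_mul (by positivity)
    simp_rw [e2]
    rw [lintegral_const_mul' _ _ ofReal_ne_top, gv_stieltjes h0 h1 (by positivity),
      ← ofReal_mul (by positivity), ← ofReal_mul (by positivity), ← ofReal_mul (by positivity)]
    congr 1
    rw [rpow_add (by positivity), rpow_natCast, rpow_sub_one (by positivity)]
    field_simp
  · have m1 : AEMeasurable (fun p : ℝ × α => ofReal (b p.2 ^ k * F p.2)) ((volume.restrict (Ioi 0)).prod μ) :=
      (hF.aestronglyMeasurable.comp_snd).aemeasurable.ennreal_ofReal
    have m2 : AEMeasurable (fun p : ℝ × α => ofReal (b p.2 * (p.1 ^ (θ - 1) / (p.1 + b p.2)))) ((volume.restrict (Ioi 0)).prod μ) := by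
      apply Measurable.aemeasurable
      fun_prop
    exact m1.mul m2

theorem gv_resolvent [SFinite μ] {b A ψ Q : α → ℝ} {R : ℝ → ℝ} (H : GvRes μ b A ψ Q R) {τ : ℝ} (hτ : 0 ≤ τ)
    (hI : IntegrableOn (fun v => v ^ τ * R v) (Ioi 0))
    (hQ : Integrable (fun x => b x ^ τ * Q x) μ) :
    Integrable (fun x => b x ^ τ * A x) μ ∧
    ∫ x, b x ^ τ * A x ∂μ = ∫ x, b x ^ τ * Q x ∂μ +
      2 / Real.pi * sin (Real.pi * τ) * ∫ v in Ioi 0, v ^ τ * R v := by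
  have bm := H.bm
  obtain ⟨k, θ, hk, hθ0, hθ1⟩ : ∃ (k : ℕ) (θ : ℝ), τ = k + θ ∧ 0 ≤ θ ∧ θ < 1 :=
    ⟨⌊τ⌋₊, τ - ⌊τ⌋₊, by ring, by linarith [Nat.floor_le hτ], by linarith [Nat.lt_floor_add_one τ]⟩
  have hkτ : (k : ℝ) ≤ τ := by linarith
  obtain ⟨iA, iψ, iQ, hM⟩ := gv_res_induct H hτ hI hQ k hkτ
  obtain ⟨hz, hM'⟩ := gv_res_moment H hτ hI hkτ iψ hM
  rcases hθ0.eq_or_lt with hθ | hθ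
  · subst hθ
    have : τ = k := by linarith
    subst this
    simp only [rpow_natCast] at *
    refine ⟨iA, ?_⟩
    have hs : sin (Real.pi * k) = 0 := by rw [mul_comm]; exact Real.sin_nat_mul_pi k
    rw [hs]
    have e : ∫ x, b x ^ k * A x ∂μ = ∫ x, (b x ^ k * Q x - 2 * (b x ^ k * ψ x)) ∂μ := by
      apply integral_congr_ae
      filter_upwards [H.eq] with x hx
      rw [hx]; ring
    rw [e, integral_sub iQ (iψ.const_mul _), integral_const_mul, hz]
    ring
  · have hsin : 0 < sin (Real.pi * θ) := by
      apply sin_pos_of_pos_of_lt_pi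
      · positivity
      · nlinarith [pi_pos]
    have hsτ : sin (Real.pi * τ) = (-1) ^ k * sin (Real.pi * θ) := by
      rw [hk, mul_add, add_comm, mul_comm Real.pi k, Real.sin_add_nat_mul_pi]
    have tA := gv_res_tonelli bm H.b1 H.A0 iA hθ hθ1
    have tQ := gv_res_tonelli bm H.b1 H.Q0 iQ hθ hθ1
    rw [← hk] at tA tQ
    set cA : ℝ → ℝ := fun v => v ^ (θ - 1) * ∫ x, b x ^ (k + 1) * A x / (v + b x) ∂μ with hcA
    set cQ : ℝ → ℝ := fun v => v ^ (θ - 1) * ∫ x, b x ^ (k + 1) * Q x / (v + b x) ∂μ with hcQ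
    have A0 : ∀ v ∈ Ioi (0:ℝ), 0 ≤ cA v := fun v hv => by
      have hv : (0:ℝ) < v := hv
      refine mul_nonneg (by positivity) (integral_nonneg fun x => ?_)
      have := H.b1 x
      have := H.A0 x
      simp only [Pi.zero_apply]; positivity
    have Q0 : ∀ v ∈ Ioi (0:ℝ), 0 ≤ cQ v := fun v hv => by
      have hv : (0:ℝ) < v := hv
      refine mul_nonneg (by positivity) (integral_nonneg fun x => ?_)
      have := H.b1 x
      have := H.Q0 x
      simp only [Pi.zero_apply]; positivity
    have A0' : 0 ≤ᵐ[volume.restrict (Ioi 0)] cA := (ae_restrict_iff' measurableSet_Ioi).2 (ae_of_all _ A0)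
    have Q0' : 0 ≤ᵐ[volume.restrict (Ioi 0)] cQ := (ae_restrict_iff' measurableSet_Ioi).2 (ae_of_all _ Q0)
    have hAQ : ∀ v ∈ Ioi (0:ℝ), cA v = cQ v + 2 * (-1) ^ k * (v ^ τ * R v) := by
      intro v hv
      have hv : (0:ℝ) < v := hv
      have jA := (gv_res_int H.bm H.b1 hv iA).2
      have jQ := (gv_res_int H.bm H.b1 hv iQ).2
      have jψ := (gv_res_int H.bm H.b1 hv iψ).2
      have e : ∫ x, (b x ^ (k + 1) * A x / (v + b x)) ∂μ =
          ∫ x, ((b x ^ (k + 1) * Q x / (v + b x)) - 2 * (b x ^ (k + 1) * ψ x / (v + b x))) ∂μ := by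
        apply integral_congr_ae
        filter_upwards [H.eq] with x hx
        rw [hx]; ring
      simp only [hcA, hcQ]
      rw [e, integral_sub jQ (jψ.const_mul _), integral_const_mul, hM' v hv, hk, rpow_add hv,
        rpow_natCast, neg_pow v, rpow_sub_one hv.ne']
      field_simp
      ring
    have mQ : AEStronglyMeasurable cQ (volume.restrict (Ioi 0)) := by
      apply AEStronglyMeasurable.mul
      · apply Measurable.aestronglyMeasurable; fun_prop
      · have : AEStronglyMeasurable (fun p : ℝ × α => b p.2 * (b p.2 ^ k * Q p.2) / (p.1 + b p.2)) ((volume.restrict (Ioi 0)).prod μ) := by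
          have h2 := iQ.aestronglyMeasurable.comp_snd (μ := volume.restrict (Ioi (0:ℝ)))
          have h3 : AEStronglyMeasurable (fun p : ℝ × α => b p.2 / (p.1 + b p.2)) ((volume.restrict (Ioi 0)).prod μ) := by
            apply Measurable.aestronglyMeasurable; fun_prop
          refine (h3.mul h2).congr (ae_of_all _ fun p => ?_)
          simp only [Pi.mul_apply]; ring
        have h4 := this.integral_prod_right'
        refine h4.congr (ae_of_all _ fun v => ?_)
        simp only
        congr 1; ext x; ring
    have hpos : 0 < Real.pi / sin (Real.pi * θ) := by positivity
    have nQ : 0 ≤ᵐ[μ] fun x => b x ^ τ * Q x := by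
      filter_upwards with x
      have := H.b1 x
      have := H.Q0 x
      simp only [Pi.zero_apply]; positivity
    have nA : 0 ≤ᵐ[μ] fun x => b x ^ τ * A x := by
      filter_upwards with x
      have := H.b1 x
      have := H.A0 x
      simp only [Pi.zero_apply]; positivity
    have kQ : IntegrableOn cQ (Ioi 0) := by
      refine ⟨mQ, ?_⟩
      rw [hasFiniteIntegral_iff_ofReal Q0', tQ, ← ofReal_integral_eq_lintegral_ofReal hQ nQ]
      exact mul_lt_top ofReal_lt_top ofReal_lt_top
    have hR : IntegrableOn (fun v => 2 * (-1) ^ k * (v ^ τ * R v)) (Ioi 0) := hI.const_mul _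
    have kA : IntegrableOn cA (Ioi 0) :=
      (kQ.add hR).congr_fun (fun v hv => (hAQ v hv).symm) measurableSet_Ioi
    have hint : ∫ v in Ioi 0, cA v = (∫ v in Ioi 0, cQ v) + 2 * (-1) ^ k * ∫ v in Ioi 0, v ^ τ * R v := by
      rw [setIntegral_congr_fun measurableSet_Ioi hAQ, integral_add kQ hR, integral_const_mul]
    have fA : Integrable (fun x => b x ^ τ * A x) μ := by
      refine ⟨by have := H.Ai.aestronglyMeasurable; have : Measurable (fun x => b x ^ τ) := by fun_prop
                 exact this.aestronglyMeasurable.mul H.Ai.aestronglyMeasurable, ?_⟩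
      rw [hasFiniteIntegral_iff_ofReal nA]
      by_contra hcon
      simp only [not_lt, top_le_iff] at hcon
      rw [hcon, mul_top (by simpa using hpos)] at tA
      have := (hasFiniteIntegral_iff_ofReal A0').1 kA.2
      rw [tA] at this
      exact lt_irrefl _ this
    refine ⟨fA, ?_⟩
    have e1 : ∫ v in Ioi 0, cA v = Real.pi / sin (Real.pi * θ) * ∫ x, b x ^ τ * A x ∂μ := by
      rw [integral_eq_lintegral_of_nonneg_ae A0' kA.1, tA, toReal_mul,
        toReal_ofReal hpos.le, integral_eq_lintegral_of_nonneg_ae nA fA.1]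
    have e2 : ∫ v in Ioi 0, cQ v = Real.pi / sin (Real.pi * θ) * ∫ x, b x ^ τ * Q x ∂μ := by
      rw [integral_eq_lintegral_of_nonneg_ae Q0' kQ.1, tQ, toReal_mul,
        toReal_ofReal hpos.le, integral_eq_lintegral_of_nonneg_ae nQ hQ.1]
    rw [e1, e2] at hint
    rw [hsτ]
    have hpi := pi_pos
    field_simp at hint ⊢
    linarith
end

theorem gv_hasSum_exp (z : ℝ) : HasSum (fun j : ℕ => z ^ j / (j.factorial : ℝ)) (exp z) := by
  have := NormedSpace.expSeries_div_hasSum_exp (𝔸 := ℝ) z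
  rwa [← Real.exp_eq_exp_ℝ] at this

theorem gv_hasSum_pow {b r a e : ℝ} (hb : 0 < b) :
    HasSum (fun j : ℕ => e ^ j / (j.factorial : ℝ) * b ^ (r + a * j)) (b ^ r * exp (e * b ^ a)) := by
  have h := (gv_hasSum_exp (e * b ^ a)).mul_left (b ^ r)
  have e : (fun j : ℕ => e ^ j / (j.factorial : ℝ) * b ^ (r + a * j)) =
      fun j : ℕ => b ^ r * ((e * b ^ a) ^ j / (j.factorial : ℝ)) := by
    funext j
    rw [rpow_add hb, rpow_mul hb.le, rpow_natCast, mul_pow]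
    ring
  rw [e]; exact h

theorem gv_sin_series {v r a e : ℝ} (hv : 0 < v) (he : 0 ≤ e) :
    ∑' j : ℕ, e ^ j / (j.factorial : ℝ) * sin (Real.pi * (r + a * j)) * v ^ (r + a * j) ≤
     v ^ r * exp (e * cos (Real.pi * a) * v ^ a) := by
  have h0 := NormedSpace.expSeries_div_hasSum_exp (𝔸 := ℂ) ((e * v ^ a : ℝ) * Complex.exp ((Real.pi * a : ℝ) * Complex.I))
  rw [← Complex.exp_eq_exp_ℂ] at h0
  have h1 := h0.mul_left (((v ^ r : ℝ) : ℂ) * Complex.exp ((Real.pi * r : ℝ) * Complex.I))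
  have h2 := Complex.hasSum_im h1
  have h3 : ∀ j : ℕ, (((v ^ r : ℝ) : ℂ) * Complex.exp ((Real.pi * r : ℝ) * Complex.I) *
     (((e * v ^ a : ℝ) * Complex.exp ((Real.pi * a : ℝ) * Complex.I)) ^ j / (j.factorial : ℂ))).im =
     e ^ j / (j.factorial : ℝ) * sin (Real.pi * (r + a * j)) * v ^ (r + a * j) := by
    intro j
    have : ((v ^ r : ℝ) : ℂ) * Complex.exp ((Real.pi * r : ℝ) * Complex.I) *
     (((e * v ^ a : ℝ) * Complex.exp ((Real.pi * a : ℝ) * Complex.I)) ^ j / (j.factorial : ℂ)) =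
     ((e ^ j / (j.factorial : ℝ) * v ^ (r + a * j) : ℝ) : ℂ) * Complex.exp ((Real.pi * (r + a * j) : ℝ) * Complex.I) := by
      rw [rpow_add hv, rpow_mul hv.le, rpow_natCast, mul_pow, ← Complex.exp_nat_mul]
      have : Complex.exp ((Real.pi * (r + a * j) : ℝ) * Complex.I) = Complex.exp ((Real.pi * r : ℝ) * Complex.I) *
        Complex.exp (j * ((Real.pi * a : ℝ) * Complex.I)) := by
        rw [← exp_add]; congr 1; push_cast; ring
      rw [this]; push_cast; ring
    rw [this, Complex.im_ofReal_mul, Complex.exp_ofReal_mul_I_im]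
    ring
  simp_rw [h3] at h2
  rw [h2.tsum_eq]
  refine (Complex.abs_im_le_norm _ |> (le_abs_self _).trans).trans ?_
  rw [norm_mul, norm_mul, norm_exp_ofReal_mul_I, norm_exp, norm_real,
    norm_of_nonneg (by positivity)]
  rw [mul_one]
  gcongr
  rw [re_ofReal_mul, Complex.exp_ofReal_mul_I_re]
  apply le_of_eq; ring

theorem gv_expsum {α : Type*} [MeasurableSpace α] {μ : Measure α} [SFinite μ]
    {b A ψ Q : α → ℝ} {R : ℝ → ℝ} (H : GvRes μ b A ψ Q R) {r a e : ℝ} (hr : 0 ≤ r) (ha : 0 ≤ a) (ha1 : a ≤ 1 / 2)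
    (he : 0 ≤ e)
    (hI : ∀ j : ℕ, IntegrableOn (fun v => v ^ (r + a * j) * R v) (Ioi 0))
    (hS : Summable fun j : ℕ => e ^ j / (j.factorial : ℝ) * ∫ v in Ioi 0, v ^ (r + a * j) * R v)
    (hQ : Integrable (fun x => b x ^ r * exp (e * b x ^ a) * Q x) μ) :
    ∫⁻ x, ofReal (b x ^ r * exp (e * b x ^ a) * A x) ∂μ ≤
      ofReal (∫ x, b x ^ r * exp (e * b x ^ a) * Q x ∂μ +
        ∑' j : ℕ, (e * cos (Real.pi * a)) ^ j / (j.factorial : ℝ) * ∫ v in Ioi 0, v ^ (r + a * j) * R v) := by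
  have bm := H.bm
  have hb : ∀ x, 0 < b x := fun x => by linarith [H.b1 x]
  have hc0 : 0 ≤ cos (Real.pi * a) := by
    apply cos_nonneg_of_mem_Icc
    constructor <;> nlinarith [pi_pos]
  have hc1 := cos_le_one (Real.pi * a)
  set c := cos (Real.pi * a) with hc
  set I : ℕ → ℝ := fun j => ∫ v in Ioi 0, v ^ (r + a * j) * R v with hIdef
  have I0 : ∀ j, 0 ≤ I j := fun j => by
    refine setIntegral_nonneg measurableSet_Ioi fun v hv => ?_
    have hv : (0:ℝ) < v := hv
    exact mul_nonneg (by positivity) (H.R0 v hv)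
  set d : ℕ → ℝ := fun j => e ^ j / (j.factorial : ℝ) with hd
  have d0 : ∀ j, 0 ≤ d j := fun j => by positivity
  have hτ : ∀ j : ℕ, 0 ≤ r + a * j := fun j => by positivity
  -- Q moments
  have hQj : ∀ j, Integrable (fun x => d j * (b x ^ (r + a * j) * Q x)) μ := by
    intro j
    refine hQ.mono' ?_ ?_
    · apply AEStronglyMeasurable.const_mul
      exact (Measurable.aestronglyMeasurable (by fun_prop)).mul H.Qi.aestronglyMeasurable
    · filter_upwards with x
      have hx := hb x
      have := H.Q0 x
      rw [norm_of_nonneg (by have := d0 j; positivity), ← mul_assoc]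
      refine mul_le_mul_of_nonneg_right ?_ this
      exact le_hasSum (gv_hasSum_pow hx) j (fun i _ => by positivity)
  have sQ : HasSum (fun j => d j * ∫ x, b x ^ (r + a * j) * Q x ∂μ)
      (∫ x, b x ^ r * exp (e * b x ^ a) * Q x ∂μ) := by
    have hh : ∀ x, HasSum (fun j : ℕ => d j * (b x ^ (r + a * j) * Q x)) (b x ^ r * exp (e * b x ^ a) * Q x) := by
      intro x
      have := (gv_hasSum_pow (r := r) (a := a) (e := e) (hb x)).mul_right (Q x)
      simpa only [mul_assoc] using this
    have := hasSum_integral_of_dominated_convergence (μ := μ) (F := fun j x => d j * (b x ^ (r + a * j) * Q x))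
      (f := fun x => b x ^ r * exp (e * b x ^ a) * Q x)
      (fun j x => d j * (b x ^ (r + a * j) * Q x)) (fun j => (hQj j).1) (fun j => by
        filter_upwards with x
        have hx := hb x
        have := H.Q0 x
        have := d0 j
        rw [norm_of_nonneg (by positivity)]) (ae_of_all _ fun x => (hh x).summable)
        (hQ.congr (ae_of_all _ fun x => (hh x).tsum_eq.symm)) (ae_of_all _ hh)
    simpa only [integral_const_mul] using this
  -- the difference series
  have hdiff : 0 ≤ ∑' j : ℕ, d j * (c ^ j - sin (Real.pi * (r + a * j))) * I j := by
    have hn : ∀ j : ℕ, ‖c ^ j - sin (Real.pi * (r + a * j))‖ ≤ 2 := fun j => by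
      rw [norm_eq_abs, abs_le]
      have h1 := pow_le_one₀ (n := j) hc0 hc1
      have h2 := pow_nonneg hc0 j
      have h3 := sin_le_one (Real.pi * (r + a * j))
      have h4 := Real.neg_one_le_sin (Real.pi * (r + a * j))
      constructor <;> linarith
    have hs := hasSum_integral_of_summable_integral_norm (μ := volume.restrict (Ioi (0:ℝ)))
      (F := fun (j : ℕ) (v : ℝ) => d j * (c ^ j - sin (Real.pi * (r + a * j))) * (v ^ (r + a * j) * R v))
      (fun j => (hI j).const_mul _) ?_
    · have h5 : ∀ j : ℕ, ∫ v in Ioi (0:ℝ), d j * (c ^ j - sin (Real.pi * (r + a * j))) * (v ^ (r + a * j) * R v) =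
        d j * (c ^ j - sin (Real.pi * (r + a * j))) * I j := fun j => integral_const_mul _ _
      simp_rw [h5] at hs
      rw [hs.tsum_eq]
      refine setIntegral_nonneg measurableSet_Ioi fun v hv => ?_
      have hv : (0:ℝ) < v := hv
      have h6 := gv_hasSum_pow (b := v) (r := r) (a := a) (e := e * c) hv
      have h7 := gv_sin_series (r := r) (a := a) hv he
      have h8 : Summable fun j : ℕ => e ^ j / (j.factorial : ℝ) * sin (Real.pi * (r + a * j)) * v ^ (r + a * j) := by
        refine Summable.of_norm_bounded (gv_hasSum_pow (b := v) (r := r) (a := a) (e := e) hv).summable fun j => ?_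
        rw [norm_mul, norm_mul, norm_of_nonneg (d0 j), norm_of_nonneg (by positivity : 0 ≤ v ^ (r + a * j)),
          mul_right_comm]
        exact mul_le_of_le_one_right (mul_nonneg (d0 j) (by positivity)) (abs_sin_le_one _)
      have h9 : ∀ j : ℕ, d j * (c ^ j - sin (Real.pi * (r + a * j))) * (v ^ (r + a * j) * R v) =
        ((e * c) ^ j / (j.factorial : ℝ) * v ^ (r + a * j) - e ^ j / (j.factorial : ℝ) * sin (Real.pi * (r + a * j)) * v ^ (r + a * j)) * R v := by
        intro j
        rw [mul_pow]; simp only [hd]; ring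
      simp_rw [h9]
      rw [tsum_mul_right, h6.summable.tsum_sub h8, h6.tsum_eq]
      exact mul_nonneg (by linarith) (H.R0 v hv)
    · refine Summable.of_nonneg_of_le (fun j => integral_nonneg fun v => norm_nonneg _) (fun j => ?_) (hS.mul_left 2)
      have : ∫ v in Ioi (0:ℝ), ‖d j * (c ^ j - sin (Real.pi * (r + a * j))) * (v ^ (r + a * j) * R v)‖ =
        d j * ‖c ^ j - sin (Real.pi * (r + a * j))‖ * I j := by
        rw [hIdef, ← integral_const_mul]
        refine setIntegral_congr_fun measurableSet_Ioi fun v hv => ?_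
        have hv : (0:ℝ) < v := hv
        skip
        rw [norm_mul, norm_mul, norm_of_nonneg (d0 j), norm_of_nonneg (mul_nonneg (by positivity) (H.R0 v hv))]
      rw [this]
      have h1 := mul_le_mul_of_nonneg_left (hn j) (mul_nonneg (d0 j) (I0 j))
      have h2 : (2:ℝ) * (e ^ j / (j.factorial : ℝ) * ∫ v in Ioi 0, v ^ (r + a * j) * R v) = 2 * (d j * I j) := rfl
      rw [h2]
      linarith
  have sI : Summable fun j => d j * I j := hS
  have sc : Summable fun j => d j * c ^ j * I j := by
    refine Summable.of_nonneg_of_le (fun j => mul_nonneg (mul_nonneg (d0 j) (pow_nonneg hc0 j)) (I0 j)) (fun j => ?_) sI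
    exact mul_le_mul_of_nonneg_right (mul_le_of_le_one_right (d0 j) (pow_le_one₀ hc0 hc1)) (I0 j)
  have ss : Summable fun j => d j * sin (Real.pi * (r + a * j)) * I j := by
    refine Summable.of_norm_bounded sI (fun j => ?_)
    rw [norm_mul, norm_mul, norm_of_nonneg (d0 j), norm_of_nonneg (I0 j)]
    exact mul_le_mul_of_nonneg_right (mul_le_of_le_one_right (d0 j) (abs_sin_le_one _)) (I0 j)
  have hcmp : ∑' j : ℕ, d j * sin (Real.pi * (r + a * j)) * I j ≤ ∑' j, d j * c ^ j * I j := by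
    have : ∀ j : ℕ, d j * (c ^ j - sin (Real.pi * (r + a * j))) * I j = d j * c ^ j * I j - d j * sin (Real.pi * (r + a * j)) * I j :=
      fun j => by ring
    simp_rw [this] at hdiff
    rw [sc.tsum_sub ss] at hdiff
    linarith
  -- resolvent at each exponent
  have hpos : ∀ x j, 0 ≤ d j * (b x ^ (r + a * j) * A x) := fun x j => by
    have := hb x
    have := H.A0 x
    have := d0 j
    positivity
  have key : ∀ j : ℕ, ∫⁻ x, ofReal (d j * (b x ^ (r + a * j) * A x)) ∂μ =
      ofReal (d j * ∫ x, b x ^ (r + a * j) * Q x ∂μ + 2 / Real.pi * (d j * sin (Real.pi * (r + a * j)) * I j))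
      ∧ 0 ≤ d j * ∫ x, b x ^ (r + a * j) * Q x ∂μ + 2 / Real.pi * (d j * sin (Real.pi * (r + a * j)) * I j) := by
    intro j
    by_cases hdj : d j = 0
    · simp [hdj]
    have hq : Integrable (fun x => b x ^ (r + a * j) * Q x) μ := by
      have := (hQj j).const_mul (d j)⁻¹
      refine this.congr (ae_of_all _ fun x => ?_)
      simp only; field_simp
    obtain ⟨k1, k2⟩ := gv_resolvent H (hτ j) (hI j) hq
    rw [← ofReal_integral_eq_lintegral_ofReal (k1.const_mul _) (ae_of_all _ fun x => hpos x j), integral_const_mul, k2]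
    have e9 : d j * (∫ x, b x ^ (r + a * j) * Q x ∂μ + 2 / Real.pi * sin (Real.pi * (r + a * j)) * I j) =
      d j * ∫ x, b x ^ (r + a * j) * Q x ∂μ + 2 / Real.pi * (d j * sin (Real.pi * (r + a * j)) * I j) := by ring
    refine ⟨by rw [← e9], ?_⟩
    rw [← e9]
    have := k2.symm
    rw [show (∫ v in Ioi 0, v ^ (r + a * j) * R v) = I j from rfl] at this
    rw [this]
    refine mul_nonneg (d0 j) (integral_nonneg fun x => ?_)
    have := hb x
    have := H.A0 x
    simp only [Pi.zero_apply]; positivity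
  have hA : ∫⁻ x, ofReal (b x ^ r * exp (e * b x ^ a) * A x) ∂μ =
      ∑' j, ∫⁻ x, ofReal (d j * (b x ^ (r + a * j) * A x)) ∂μ := by
    rw [← lintegral_tsum]
    · congr 1; ext x
      have := (gv_hasSum_pow (r := r) (a := a) (e := e) (hb x)).mul_right (A x)
      rw [← this.tsum_eq]
      simp_rw [mul_assoc]
      rw [ofReal_tsum_of_nonneg]
      · exact fun j => hpos x j
      · simpa only [mul_assoc] using this.summable
    · intro j
      apply AEMeasurable.ennreal_ofReal
      apply AEMeasurable.const_mul
      exact (Measurable.aemeasurable (by fun_prop)).mul H.Ai.aestronglyMeasurable.aemeasurable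
  rw [hA]
  simp_rw [fun j => (key j).1]
  have ssum := sQ.summable.add (ss.mul_left (2 / Real.pi))
  rw [← ofReal_tsum_of_nonneg (fun j => (key j).2) ssum]
  apply ofReal_le_ofReal
  rw [sQ.summable.tsum_add (ss.mul_left (2 / Real.pi)), sQ.tsum_eq, tsum_mul_left]
  have e10 : ∑' j : ℕ, (e * c) ^ j / (j.factorial : ℝ) * I j = ∑' j, d j * c ^ j * I j := by
    congr 1; ext j; rw [mul_pow]; simp only [hd]; ring
  rw [e10]
  have hp : 2 / Real.pi ≤ 1 := by
    rw [div_le_one pi_pos]; linarith [pi_gt_three]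
  have h11 : 0 ≤ ∑' j, d j * c ^ j * I j := tsum_nonneg fun j => mul_nonneg (mul_nonneg (d0 j) (pow_nonneg hc0 j)) (I0 j)
  have h12 : 0 ≤ 2 / Real.pi := by positivity
  have := mul_le_mul_of_nonneg_left hcmp h12
  nlinarith

/-- remainder of the exponential series at `I * y` -/
noncomputable def gvRem (n : ℕ) (y : ℝ) : ℂ :=
  Complex.exp (Complex.I * y) - ∑ k ∈ Finset.range n, (Complex.I * y) ^ k / (k.factorial : ℂ)

noncomputable def gvJ (G : ℝ → ℂ) (k : ℕ) (z : ℝ) : ℂ :=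
  ∫ ξ : ℝ, Complex.exp (Complex.I * (ξ : ℂ) * (z : ℂ)) * ((Complex.I * (ξ : ℂ)) ^ k * G ξ)

theorem gvRem_cont (n : ℕ) : Continuous (gvRem n) := by
  unfold gvRem
  fun_prop

theorem gvRem_succ (n : ℕ) (y : ℝ) : gvRem (n + 1) y = gvRem n y - (Complex.I * y) ^ n / (n.factorial : ℂ) := by
  unfold gvRem; rw [Finset.sum_range_succ]; ring

theorem gvRem_zero_right (n : ℕ) : gvRem (n + 1) 0 = 0 := by
  unfold gvRem
  rw [Finset.sum_range_succ']
  simp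

theorem gvRem_deriv (n : ℕ) (y : ℝ) : HasDerivAt (gvRem (n + 1)) (Complex.I * gvRem n y) y := by
  induction n with
  | zero =>
    have h : HasDerivAt (fun y : ℝ => Complex.exp (Complex.I * y)) (Complex.exp (Complex.I * y) * (Complex.I * 1)) y :=
      ((ofRealCLM.hasDerivAt (x := y)).const_mul Complex.I).cexp
    have h2 := h.sub_const 1
    have e : gvRem (0 + 1) = fun y : ℝ => Complex.exp (Complex.I * y) - 1 := by
      funext y; simp [gvRem]
    rw [e]
    refine h2.congr_deriv ?_
    simp [gvRem]; ring
  | succ n ih =>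
    have e : gvRem (n + 1 + 1) = fun y : ℝ => gvRem (n + 1) y - (Complex.I * y) ^ (n + 1) / ((n + 1).factorial : ℂ) := by
      funext y; exact gvRem_succ _ _
    rw [e]
    have h2 : HasDerivAt (fun y : ℝ => (Complex.I * y) ^ (n + 1) / ((n + 1).factorial : ℂ))
        (((n + 1 : ℕ) : ℂ) * (Complex.I * y) ^ n * (Complex.I * 1) / ((n + 1).factorial : ℂ)) y :=
      (((ofRealCLM.hasDerivAt (x := y)).const_mul Complex.I).pow (n + 1)).div_const _
    refine (ih.sub h2).congr_deriv ?_
    rw [gvRem_succ, Nat.factorial_succ]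
    have : ((n : ℂ) + 1) ≠ 0 := by exact_mod_cast Nat.succ_ne_zero n
    have : (n.factorial : ℂ) ≠ 0 := by exact_mod_cast Nat.factorial_ne_zero n
    push_cast
    field_simp

theorem gvRem_neg (n : ℕ) (y : ℝ) : gvRem n (-y) = (starRingEnd ℂ) (gvRem n y) := by
  unfold gvRem
  simp [← exp_conj, map_sum]

theorem gvRem_bound_pos (n : ℕ) : ∀ y : ℝ, 0 ≤ y → ‖gvRem n y‖ ≤ y ^ n / (n.factorial : ℝ) := by
  induction n with
  | zero => intro y hy; simp [gvRem, norm_exp]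
  | succ n ih =>
    intro y hy
    have := image_norm_le_of_norm_deriv_right_le_deriv_boundary (f := gvRem (n + 1)) (f' := fun y => Complex.I * gvRem n y)
      (a := 0) (b := y) (B := fun y => y ^ (n + 1) / ((n + 1).factorial : ℝ)) (B' := fun y => y ^ n / (n.factorial : ℝ))
      (gvRem_cont _).continuousOn (fun x _ => (gvRem_deriv n x).hasDerivWithinAt) (by simp [gvRem_zero_right])
      (fun x => by
        have := (hasDerivAt_pow (n + 1) x).div_const ((n + 1).factorial : ℝ)
        refine this.congr_deriv ?_
        rw [Nat.factorial_succ]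
        push_cast
        have : (n.factorial : ℝ) ≠ 0 := by exact_mod_cast Nat.factorial_ne_zero n
        field_simp)
      (fun x hx => by
        rw [norm_mul, norm_I, one_mul]; exact ih x hx.1)
    exact this (Set.right_mem_Icc.2 hy)

theorem gvRem_bound (n : ℕ) (y : ℝ) : ‖gvRem n y‖ ≤ |y| ^ n / (n.factorial : ℝ) := by
  rcases le_total 0 y with h | h
  · rw [abs_of_nonneg h]; exact gvRem_bound_pos n y h
  · have := gvRem_bound_pos n (-y) (by linarith)
    rwa [gvRem_neg, RCLike.norm_conj, ← abs_of_nonpos h] at this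

theorem gvRem_bound2 (n : ℕ) (y : ℝ) : ‖gvRem (n + 1) y‖ ≤ 2 * (|y| ^ n / (n.factorial : ℝ)) := by
  rw [gvRem_succ]
  refine (norm_sub_le _ _).trans ?_
  have h1 := gvRem_bound n y
  have h2 : ‖(Complex.I * y) ^ n / (n.factorial : ℂ)‖ = |y| ^ n / (n.factorial : ℝ) := by
    simp
  linarith

theorem gvRem_bound3 (n : ℕ) (y β : ℝ) (h0 : (n : ℝ) ≤ β) (h1 : β ≤ n + 1) :
    ‖gvRem (n + 1) y‖ ≤ 2 * (|y| ^ β / Gamma (β + 1)) := by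
  by_cases hy : y = 0
  · subst hy
    rw [gvRem_zero_right, norm_zero]
    have := Gamma_pos_of_pos (s := β + 1) (by have := n.cast_nonneg (α := ℝ); linarith)
    positivity
  have hy' : 0 < |y| := abs_pos.2 hy
  set t : ℝ := β - n with ht
  have ht0 : 0 ≤ t := by linarith
  have ht1 : t ≤ 1 := by linarith
  have hg : 0 < Gamma (β + 1) := Gamma_pos_of_pos (s := β + 1) (by have := n.cast_nonneg (α := ℝ); linarith)
  have hgam : Gamma (β + 1) ≤ ((n + 1).factorial : ℝ) ^ t * (n.factorial : ℝ) ^ (1 - t) := by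
    rcases ht0.eq_or_lt with h | h
    · have : β = n := by linarith
      rw [← h, this, Gamma_nat_eq_factorial]; simp
    rcases ht1.eq_or_lt with h' | h'
    · have : β = (n + 1 : ℕ) := by push_cast; linarith
      rw [h', this, Gamma_nat_eq_factorial]; simp
    have := Gamma_mul_add_mul_le_rpow_Gamma_mul_rpow_Gamma (s := ((n + 1 : ℕ) : ℝ) + 1) (t := (n : ℝ) + 1)
      (a := t) (b := 1 - t) (by positivity) (by positivity) h (by linarith) (by ring)
    rw [Gamma_nat_eq_factorial, Gamma_nat_eq_factorial] at this
    convert this using 2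
    push_cast; rw [ht]; ring
  have e1 : ‖gvRem (n + 1) y‖ = ‖gvRem (n + 1) y‖ ^ t * ‖gvRem (n + 1) y‖ ^ (1 - t) := by
    rw [← Real.rpow_add_of_nonneg (norm_nonneg _) ht0 (by linarith)]; simp
  have f1 : (0:ℝ) < ((n + 1).factorial : ℝ) := by positivity
  have f2 : (0:ℝ) < (n.factorial : ℝ) := by positivity
  calc ‖gvRem (n + 1) y‖ = ‖gvRem (n + 1) y‖ ^ t * ‖gvRem (n + 1) y‖ ^ (1 - t) := e1
    _ ≤ (|y| ^ (n + 1) / ((n + 1).factorial : ℝ)) ^ t * (2 * (|y| ^ n / (n.factorial : ℝ))) ^ (1 - t) := by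
        refine mul_le_mul (rpow_le_rpow (norm_nonneg _) (gvRem_bound _ _) ht0)
          (rpow_le_rpow (norm_nonneg _) (gvRem_bound2 _ _) (by linarith)) (by positivity) (by positivity)
    _ = (2:ℝ) ^ (1 - t) * (|y| ^ β / (((n + 1).factorial : ℝ) ^ t * (n.factorial : ℝ) ^ (1 - t))) := by
        rw [mul_rpow (by norm_num) (by positivity), div_rpow (by positivity) (by positivity),
          div_rpow (by positivity) (by positivity), ← rpow_natCast, ← rpow_natCast, ← rpow_mul hy'.le,
          ← rpow_mul hy'.le]
        have : |y| ^ β = |y| ^ (((n + 1 : ℕ) : ℝ) * t) * |y| ^ ((n : ℝ) * (1 - t)) := by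
          rw [← rpow_add hy']; congr 1; push_cast; rw [ht]; ring
        rw [this]; field_simp
    _ ≤ 2 * (|y| ^ β / Gamma (β + 1)) := by
        gcongr
        calc (2:ℝ) ^ (1 - t) ≤ 2 ^ (1:ℝ) := rpow_le_rpow_of_exponent_le (by norm_num) (by linarith)
          _ = 2 := rpow_one 2

theorem gv_expand {G : ℝ → ℂ} (n : ℕ) (hG : Integrable G)
    (hk : ∀ k < n, Integrable (fun ξ : ℝ => (ξ : ℂ) ^ k * G ξ)) (z h : ℝ) :
    Integrable (fun ξ : ℝ => Complex.exp (Complex.I * (ξ : ℂ) * (z : ℂ)) * (gvRem n (h * ξ) * G ξ)) ∧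
    2 * Real.pi * FTinv G (z + h) = ∑ k ∈ Finset.range n, (h : ℂ) ^ k / (k.factorial : ℂ) * gvJ G k z +
      ∫ ξ : ℝ, Complex.exp (Complex.I * (ξ : ℂ) * (z : ℂ)) * (gvRem n (h * ξ) * G ξ) := by
  have hint : ∀ (z : ℝ) (F : ℝ → ℂ), Integrable F → Integrable (fun ξ : ℝ => Complex.exp (Complex.I * (ξ : ℂ) * (z : ℂ)) * F ξ) := by
    intro z F hF
    refine hF.bdd_mul (c := 1) (Continuous.aestronglyMeasurable (by fun_prop)) (ae_of_all _ fun ξ => ?_)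
    exact (gv_norm_exp _ _).le
  have hterm : ∀ k < n, Integrable (fun ξ : ℝ => (h : ℂ) ^ k / (k.factorial : ℂ) *
      (Complex.exp (Complex.I * (ξ : ℂ) * (z : ℂ)) * ((Complex.I * (ξ : ℂ)) ^ k * G ξ))) := by
    intro k hkn
    refine (hint z _ ?_).const_mul _
    refine ((hk k hkn).const_mul (Complex.I ^ k)).congr (ae_of_all _ fun ξ => ?_)
    simp only; rw [mul_pow]; ring
  have e : ∀ ξ : ℝ, Complex.exp (Complex.I * (ξ : ℂ) * (z : ℂ)) * (gvRem n (h * ξ) * G ξ) =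
      Complex.exp (Complex.I * (ξ : ℂ) * ((z + h : ℝ) : ℂ)) * G ξ - ∑ k ∈ Finset.range n, (h : ℂ) ^ k / (k.factorial : ℂ) *
      (Complex.exp (Complex.I * (ξ : ℂ) * (z : ℂ)) * ((Complex.I * (ξ : ℂ)) ^ k * G ξ)) := by
    intro ξ
    unfold gvRem
    have : Complex.exp (Complex.I * (ξ : ℂ) * ((z + h : ℝ) : ℂ)) = Complex.exp (Complex.I * (ξ : ℂ) * (z : ℂ)) *
      Complex.exp (Complex.I * ((h * ξ : ℝ) : ℂ)) := by
      rw [← exp_add]; congr 1; push_cast; ring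
    rw [this, sub_mul, mul_sub, Finset.sum_mul, Finset.mul_sum]
    congr 1
    · ring
    · refine Finset.sum_congr rfl fun k _ => ?_
      push_cast; rw [mul_pow, mul_pow, mul_pow]; ring
  have hs := integrable_finsetSum (Finset.range n) (fun k hk' => hterm k (Finset.mem_range.1 hk'))
  have hi := (hint (z + h) G hG).sub hs
  refine ⟨hi.congr (ae_of_all _ fun ξ => (e ξ).symm), ?_⟩
  simp_rw [e]
  rw [integral_sub (hint (z + h) G hG) hs, integral_finsetSum _ (fun k hk' => hterm k (Finset.mem_range.1 hk'))]
  simp_rw [integral_const_mul]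
  have hpi : (Real.pi : ℂ) ≠ 0 := by exact_mod_cast pi_ne_zero
  unfold gvJ FTinv
  rw [add_sub_cancel, ← mul_assoc]
  rw [show (2 * (Real.pi : ℂ)) * (1 / (2 * Real.pi)) = 1 by field_simp, one_mul]

theorem gv_flat_bound {G : ℝ → ℂ} (n : ℕ) (hG : Integrable G)
    (hk : ∀ k < n + 1, Integrable (fun ξ : ℝ => (ξ : ℂ) ^ k * G ξ)) {β : ℝ} (h0 : (n : ℝ) ≤ β) (h1 : β ≤ n + 1)
    (hβ : Integrable (fun ξ : ℝ => |ξ| ^ β * ‖G ξ‖)) {z : ℝ} (hz : ∀ k < n + 1, gvJ G k z = 0) (x : ℝ) :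
    ‖FTinv G x‖ ≤ |x - z| ^ β / Gamma (β + 1) * ∫ ξ : ℝ, |ξ| ^ β * ‖G ξ‖ := by
  have hg : 0 < Gamma (β + 1) := Gamma_pos_of_pos (s := β + 1) (by have := n.cast_nonneg (α := ℝ); linarith)
  have e := (gv_expand (n + 1) hG hk z (x - z)).2
  rw [Finset.sum_eq_zero (fun k hk' => by rw [hz k (Finset.mem_range.1 hk'), mul_zero]), zero_add, add_sub_cancel] at e
  have hM0 : 0 ≤ ∫ ξ : ℝ, |ξ| ^ β * ‖G ξ‖ := integral_nonneg fun ξ => by positivity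
  have b1 : ‖∫ ξ : ℝ, Complex.exp (Complex.I * (ξ : ℂ) * (z : ℂ)) * (gvRem (n + 1) ((x - z) * ξ) * G ξ)‖ ≤
      2 * (|x - z| ^ β / Gamma (β + 1)) * ∫ ξ : ℝ, |ξ| ^ β * ‖G ξ‖ := by
    rw [← integral_const_mul]
    refine norm_integral_le_of_norm_le (hβ.const_mul _) (ae_of_all _ fun ξ => ?_)
    rw [norm_mul, gv_norm_exp, one_mul, norm_mul]
    have := gvRem_bound3 n ((x - z) * ξ) β h0 h1
    rw [abs_mul, mul_rpow (abs_nonneg _) (abs_nonneg _)] at this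
    calc _ ≤ 2 * (|x - z| ^ β * |ξ| ^ β / Gamma (β + 1)) * ‖G ξ‖ := by gcongr
      _ = _ := by ring
  rw [← e] at b1
  have b2 : ‖(2 * (Real.pi : ℂ)) * FTinv G x‖ = 2 * Real.pi * ‖FTinv G x‖ := by
    rw [norm_mul, norm_mul, norm_real, norm_of_nonneg pi_pos.le]; simp
  rw [b2] at b1
  have hp := pi_gt_three
  have := norm_nonneg (FTinv G x)
  nlinarith

theorem gv_taylor_o {G : ℝ → ℂ} (n : ℕ) (hG : Integrable G)
    (hk : ∀ k < n + 1, Integrable (fun ξ : ℝ => (ξ : ℂ) ^ k * G ξ)) (z : ℝ) :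
    Tendsto (fun h : ℝ => (∫ ξ : ℝ, Complex.exp (Complex.I * (ξ : ℂ) * (z : ℂ)) * (gvRem (n + 1) (h * ξ) * G ξ)) / (h : ℂ) ^ n)
      (nhdsWithin 0 {0}ᶜ) (nhds 0) := by
  have hne : ∀ᶠ h : ℝ in nhdsWithin 0 {0}ᶜ, h ≠ 0 := eventually_mem_nhdsWithin
  have key : Tendsto (fun h : ℝ => ∫ ξ : ℝ, (Complex.exp (Complex.I * (ξ : ℂ) * (z : ℂ)) * (gvRem (n + 1) (h * ξ) * G ξ)) / (h : ℂ) ^ n)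
      (nhdsWithin 0 {0}ᶜ) (nhds (∫ ξ : ℝ, (0 : ℂ))) := by
    refine tendsto_integral_filter_of_dominated_convergence (fun ξ => 2 / (n.factorial : ℝ) * ‖(ξ : ℂ) ^ n * G ξ‖) ?_ ?_ ?_ ?_
    · filter_upwards with h
      exact ((gv_expand (n + 1) hG hk z h).1.div_const _).aestronglyMeasurable
    · filter_upwards [hne] with h hh
      filter_upwards with ξ
      have hh' : 0 < |h| := abs_pos.2 hh
      rw [norm_div, norm_mul, gv_norm_exp, one_mul, norm_mul, norm_mul, norm_pow, norm_pow, norm_real, norm_real,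
        norm_eq_abs, norm_eq_abs]
      have := gvRem_bound2 n (h * ξ)
      rw [abs_mul, mul_pow] at this
      rw [div_le_iff₀ (by positivity)]
      calc _ ≤ 2 * (|h| ^ n * |ξ| ^ n / (n.factorial : ℝ)) * ‖G ξ‖ := by gcongr
        _ = _ := by ring
    · exact (hk n (by omega)).norm.const_mul _
    · filter_upwards with ξ
      rw [tendsto_zero_iff_norm_tendsto_zero]
      have t1 : Tendsto (fun h : ℝ => |h| * (|ξ| ^ (n + 1) / ((n + 1).factorial : ℝ) * ‖G ξ‖)) (nhdsWithin 0 {0}ᶜ) (nhds 0) := by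
        have : Tendsto (fun h : ℝ => |h| * (|ξ| ^ (n + 1) / ((n + 1).factorial : ℝ) * ‖G ξ‖)) (nhds 0)
            (nhds (|0| * (|ξ| ^ (n + 1) / ((n + 1).factorial : ℝ) * ‖G ξ‖))) := by
          apply Continuous.tendsto; fun_prop
        rw [abs_zero, zero_mul] at this
        exact this.mono_left nhdsWithin_le_nhds
      refine squeeze_zero' (Eventually.of_forall fun h => norm_nonneg _) ?_ t1
      filter_upwards [hne] with h hh
      have hh' : 0 < |h| := abs_pos.2 hh
      rw [norm_div, norm_mul, gv_norm_exp, one_mul, norm_mul, norm_pow, norm_real, norm_eq_abs]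
      have := gvRem_bound (n + 1) (h * ξ)
      rw [abs_mul, mul_pow] at this
      rw [div_le_iff₀ (by positivity)]
      calc _ ≤ (|h| ^ (n + 1) * |ξ| ^ (n + 1) / ((n + 1).factorial : ℝ)) * ‖G ξ‖ := by gcongr
        _ = _ := by ring
  rw [integral_zero] at key
  refine key.congr fun h => ?_
  rw [integral_div]

theorem gv_lead {G : ℝ → ℂ} (n : ℕ) (hG : Integrable G)
    (hk : ∀ k < n + 1, Integrable (fun ξ : ℝ => (ξ : ℂ) ^ k * G ξ)) {z : ℝ} (hz : ∀ k < n, gvJ G k z = 0) :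
    Tendsto (fun h : ℝ => 2 * Real.pi * FTinv G (z + h) / (h : ℂ) ^ n) (nhdsWithin 0 {0}ᶜ)
      (nhds (gvJ G n z / (n.factorial : ℂ))) := by
  have h1 := (gv_taylor_o n hG hk z).const_add (gvJ G n z / (n.factorial : ℂ))
  rw [add_zero] at h1
  refine h1.congr' ?_
  have hne : ∀ᶠ h : ℝ in nhdsWithin 0 {0}ᶜ, h ≠ 0 := eventually_mem_nhdsWithin
  filter_upwards [hne] with h hh
  have hh' : (h : ℂ) ≠ 0 := by exact_mod_cast hh
  rw [(gv_expand (n + 1) hG hk z h).2, Finset.sum_range_succ,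
    Finset.sum_eq_zero (fun k hk' => by rw [hz k (Finset.mem_range.1 hk'), mul_zero]), zero_add]
  generalize (∫ ξ : ℝ, Complex.exp (Complex.I * (ξ : ℂ) * (z : ℂ)) * (gvRem (n + 1) (h * ξ) * G ξ)) = X
  have : (n.factorial : ℂ) ≠ 0 := by exact_mod_cast Nat.factorial_ne_zero n
  field_simp

theorem gv_freq_zero {f : ℝ → ℂ} {F : Filter ℝ} {c : ℂ} (h : Tendsto f F (nhds c)) (h2 : ∃ᶠ x in F, f x = 0) : c = 0 := by
  by_contra hc
  exact h2 (h.eventually_ne hc)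

theorem gv_flat {G P : ℝ → ℂ} (n : ℕ) (hG : Integrable G) (hP : Integrable P)
    (hk : ∀ k < n + 1, Integrable (fun ξ : ℝ => (ξ : ℂ) ^ k * G ξ))
    (hkP : ∀ k < 2 * n + 1, Integrable (fun ξ : ℝ => (ξ : ℂ) ^ k * P ξ)) {z : ℝ}
    (f1 : ∃ᶠ h in nhdsWithin (0:ℝ) {0}ᶜ, FTinv P (z + h) = 0)
    (f2 : ∃ᶠ h in nhdsWithin (0:ℝ) {0}ᶜ, FTinv P (z + h) = FTinv G (z + h) ^ 2 / 2) :
    ∀ k < n + 1, gvJ G k z = 0 := by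
  have hPz : ∀ k < 2 * n + 1, gvJ P k z = 0 := by
    intro k
    induction k using Nat.strong_induction_on with
    | _ k ih =>
      intro hk'
      have t := gv_lead k hP (fun j hj => hkP j (by omega)) (z := z) (fun j hj => ih j hj (by omega))
      have := gv_freq_zero t (f1.mono fun h hh => by rw [hh]; simp)
      have hf : (k.factorial : ℂ) ≠ 0 := by exact_mod_cast Nat.factorial_ne_zero k
      simpa [hf] using this
  intro k
  induction k using Nat.strong_induction_on with
  | _ k ih =>
    intro hk'
    have t := gv_lead k hG (fun j hj => hk j (by omega)) (z := z) (fun j hj => ih j hj (by omega))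
    have tP := gv_lead (2 * k) hP (fun j hj => hkP j (by omega)) (z := z) (fun j hj => hPz j (by omega))
    rw [hPz (2 * k) (by omega), zero_div] at tP
    have t2 := (t.pow 2).sub (tP.const_mul (4 * Real.pi : ℂ))
    have hf : (k.factorial : ℂ) ≠ 0 := by exact_mod_cast Nat.factorial_ne_zero k
    have := gv_freq_zero t2 (f2.mono fun h hh => by rw [hh]; ring)
    simpa [hf] using this

theorem gv_open_punct (P : ℝ → Prop) : IsOpen {z : ℝ | ∀ᶠ w in nhdsWithin z {z}ᶜ, P w} := by
  rw [isOpen_iff_mem_nhds]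
  intro z hz
  have hz : ∀ᶠ w in nhdsWithin z {z}ᶜ, P w := hz
  rw [eventually_nhdsWithin_iff, eventually_nhds_iff] at hz
  obtain ⟨O, hO, hOo, hzO⟩ := hz
  filter_upwards [hOo.mem_nhds hzO] with z' hz'
  show ∀ᶠ w in nhdsWithin z' {z'}ᶜ, P w
  by_cases h : z' = z
  · subst h
    rw [eventually_nhdsWithin_iff]
    filter_upwards [hOo.mem_nhds hzO] with w hw
    exact hO w hw
  · apply Filter.Eventually.filter_mono nhdsWithin_le_nhds
    filter_upwards [hOo.mem_nhds hz', isOpen_ne.mem_nhds h] with w hw hw2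
    exact hO w hw hw2

theorem gv_cross {p q : ℝ → ℝ} (hp : Continuous p) (hq : Continuous q) (hpq : ∀ x, p x = 0 ∨ p x = q x) {x y : ℝ}
    (hx : p x ≠ 0) (hy : q y - p y ≠ 0) :
    ∃ z ∈ uIcc x y, (∃ᶠ h in nhdsWithin (0:ℝ) {0}ᶜ, p (z + h) = 0) ∧
      (∃ᶠ h in nhdsWithin (0:ℝ) {0}ᶜ, p (z + h) = q (z + h)) := by
  by_contra hcon
  push Not at hcon
  have tr : ∀ (P : ℝ → Prop) (z : ℝ), (∀ᶠ h in nhdsWithin (0:ℝ) {0}ᶜ, P (z + h)) → ∀ᶠ w in nhdsWithin z {z}ᶜ, P w := by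
    intro P z h
    rw [eventually_nhdsWithin_iff] at h ⊢
    have t : Tendsto (fun w : ℝ => w - z) (nhds z) (nhds 0) := by
      have : Tendsto (fun w : ℝ => w - z) (nhds z) (nhds (z - z)) := by apply Continuous.tendsto; fun_prop
      simpa using this
    filter_upwards [t.eventually h] with w hw hw2
    have := hw (by simpa [sub_eq_zero] using hw2)
    simpa using this
  have pre : IsPreconnected (uIcc x y) := isPreconnected_uIcc
  have := pre _ _ (gv_open_punct fun w => p w ≠ 0) (gv_open_punct fun w => p w ≠ q w) (fun z hz => by
      by_cases h : ∃ᶠ h in nhdsWithin (0:ℝ) {0}ᶜ, p (z + h) = 0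
      · right
        exact tr (fun w => p w ≠ q w) z (hcon z hz h)
      · left
        exact tr (fun w => p w ≠ 0) z (not_frequently.1 h))
    ⟨x, left_mem_uIcc, Filter.Eventually.filter_mono nhdsWithin_le_nhds (hp.continuousAt.eventually_ne hx)⟩
    ⟨y, right_mem_uIcc, Filter.Eventually.filter_mono nhdsWithin_le_nhds (by
      filter_upwards [(hq.sub hp).continuousAt.eventually_ne hy] with w hw
      intro h; apply hw; simp [h])⟩
  obtain ⟨z, -, h1, h2⟩ := this
  have h1 : ∀ᶠ w in nhdsWithin z {z}ᶜ, p w ≠ 0 := h1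
  have h2 : ∀ᶠ w in nhdsWithin z {z}ᶜ, p w ≠ q w := h2
  obtain ⟨w, hw1, hw2⟩ := (h1.and h2).exists
  rcases hpq w with h | h
  · exact hw1 h
  · exact hw2 h

theorem gv_cs {α : Type*} [MeasurableSpace α] {μ : Measure α} {f g : α → ENNReal} (hf : AEMeasurable f μ)
    (hg : AEMeasurable g μ) : (∫⁻ x, f x * g x ∂μ) ^ 2 ≤ (∫⁻ x, f x ^ 2 ∂μ) * ∫⁻ x, g x ^ 2 ∂μ := by
  have h := ENNReal.lintegral_mul_le_Lp_mul_Lq μ (p := 2) (q := 2) (Real.HolderConjugate.two_two) hf hg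
  have h2 := pow_le_pow_left₀ (by positivity) h 2
  refine h2.trans (le_of_eq ?_)
  rw [mul_pow, ← ENNReal.rpow_natCast, ← ENNReal.rpow_natCast, ← ENNReal.rpow_mul, ← ENNReal.rpow_mul]
  norm_num

/-- Gagliardo kernel -/
noncomputable def gvK (f : ℝ → ℂ) (ρ h s : ℝ) : ENNReal :=
  (‖f h - f s‖ₑ * ofReal (|h - s| ^ (-(1 / 2 + ρ)))) ^ 2

theorem gvK_meas {f : ℝ → ℂ} (hf : Continuous f) (ρ : ℝ) : Measurable (fun p : ℝ × ℝ => gvK f ρ p.1 p.2) := by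
  unfold gvK
  have : Measurable f := hf.measurable
  fun_prop

theorem gv_avg {φ : ℝ → ℂ} (hφ : Continuous φ) {l : ℝ} (hl : 0 < l) :
    ‖φ 0 - (l⁻¹ : ℝ) • ∫ s in (0:ℝ)..l, φ s‖ₑ ≤
      ∫⁻ h in Ioc 0 l, ∫⁻ s in Ioc 0 l, indicator {s | s ≤ h} (fun s => ofReal (h ^ (-2:ℝ)) * ‖φ h - φ s‖ₑ) s := by
  set A : ℝ → ℂ := fun h => (h⁻¹ : ℝ) • ∫ s in (0:ℝ)..h, φ s with hA
  set A' : ℝ → ℂ := fun h => (h⁻¹ : ℝ) • φ h + (-(h ^ 2)⁻¹ : ℝ) • ∫ s in (0:ℝ)..h, φ s with hA'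
  have hd : ∀ h, h ≠ 0 → HasDerivAt A (A' h) h := by
    intro h hh
    have h1 : HasDerivAt (fun h => ∫ s in (0:ℝ)..h, φ s) (φ h) h :=
      intervalIntegral.integral_hasDerivAt_right (hφ.intervalIntegrable _ _) (hφ.stronglyMeasurableAtFilter _ _) hφ.continuousAt
    exact (hasDerivAt_inv hh).smul h1
  have hbd : ∀ h ∈ Ioc 0 l, ‖A' h‖ₑ ≤ ∫⁻ s in Ioc 0 l, indicator {s | s ≤ h} (fun s => ofReal (h ^ (-2:ℝ)) * ‖φ h - φ s‖ₑ) s := by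
    intro h hh
    have h0 : 0 < h := hh.1
    have e : A' h = (h ^ 2)⁻¹ • ∫ s in (0:ℝ)..h, (φ h - φ s) := by
      rw [intervalIntegral.integral_sub (by simp) (hφ.intervalIntegrable _ _), intervalIntegral.integral_const, hA']
      simp only [sub_zero, smul_sub, smul_smul, neg_smul]
      rw [sub_eq_add_neg]
      congr 2
      field_simp
    rw [show {s | s ≤ h} = Iic h from rfl, lintegral_indicator measurableSet_Iic, Measure.restrict_restrict measurableSet_Iic,
      lintegral_const_mul' _ _ ofReal_ne_top]
    have e2 : Iic h ∩ Ioc 0 l = Ioc 0 h := by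
      ext s; simp only [Set.mem_inter_iff, Set.mem_Iic, Set.mem_Ioc]
      constructor
      · rintro ⟨a, b, c⟩; exact ⟨b, a⟩
      · rintro ⟨a, b⟩; exact ⟨b, a, b.trans hh.2⟩
    rw [e2, e, enorm_smul, intervalIntegral.integral_of_le h0.le]
    gcongr
    · rw [Real.enorm_eq_ofReal (by positivity), rpow_neg h0.le]; norm_cast
    · exact enorm_integral_le_lintegral_enorm _
  have hlim : Tendsto A (nhdsWithin 0 (Ioi 0)) (nhds (φ 0)) := by
    have h1 : HasDerivAt (fun h => ∫ s in (0:ℝ)..h, φ s) (φ 0) 0 :=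
      intervalIntegral.integral_hasDerivAt_right (hφ.intervalIntegrable _ _) (hφ.stronglyMeasurableAtFilter _ _) hφ.continuousAt
    have h2 := h1.tendsto_slope_zero
    simp only [zero_add, intervalIntegral.integral_same, sub_zero] at h2
    exact h2.mono_left (nhdsWithin_mono _ (fun x hx => ne_of_gt hx))
  have hlim2 : Tendsto (fun ε => ‖A ε - A l‖ₑ) (nhdsWithin 0 (Ioi 0)) (nhds ‖φ 0 - A l‖ₑ) :=
    (hlim.sub_const _).enorm
  refine le_of_tendsto hlim2 ?_
  have hev : ∀ᶠ ε : ℝ in nhdsWithin 0 (Ioi 0), ε ∈ Set.Ioo 0 l := Ioo_mem_nhdsGT hl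
  filter_upwards [hev] with ε hε
  have hcont : ContinuousOn A' (uIcc ε l) := by
    rw [uIcc_of_le hε.2.le]
    have hne : ∀ x ∈ Icc ε l, x ≠ 0 := fun x hx => by linarith [hx.1, hε.1]
    have c2 : Continuous (fun h => ∫ s in (0:ℝ)..h, φ s) := intervalIntegral.continuous_primitive (fun a b => hφ.intervalIntegrable a b) 0
    apply ContinuousOn.add
    · exact (continuousOn_id.inv₀ hne).smul hφ.continuousOn
    · exact (((continuousOn_id.pow 2).inv₀ (fun x hx => pow_ne_zero 2 (hne x hx))).neg).smul c2.continuousOn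
  have ftc : ∫ h in ε..l, A' h = A l - A ε :=
    intervalIntegral.integral_eq_sub_of_hasDerivAt (fun x hx => hd x (by
      rw [uIcc_of_le hε.2.le] at hx; linarith [hx.1, hε.1])) hcont.intervalIntegrable
  rw [← enorm_neg, neg_sub, ← ftc, intervalIntegral.integral_of_le hε.2.le]
  refine (enorm_integral_le_lintegral_enorm _).trans ?_
  refine (lintegral_mono_set (Set.Ioc_subset_Ioc_left hε.1.le)).trans ?_
  exact setLIntegral_mono' measurableSet_Ioc hbd

theorem gv_avg2 {φ : ℝ → ℂ} (hφ : Continuous φ) {l : ℝ} (hl : 0 < l) {ρ : ℝ} (hρ : 1 / 2 < ρ) :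
    ‖φ 0 - (l⁻¹ : ℝ) • ∫ s in (0:ℝ)..l, φ s‖ₑ ^ 2 ≤
      (∫⁻ h in Ioc 0 l, ∫⁻ s in Ioc 0 l, gvK φ ρ h s) * ofReal (l ^ (2 * ρ - 1) / (2 * ρ - 1)) := by
  set ν := volume.restrict (Ioc 0 l) with hν
  set k : ℝ × ℝ → ENNReal := fun p => ‖φ p.1 - φ p.2‖ₑ * ofReal (|p.1 - p.2| ^ (-(1 / 2 + ρ))) with hk
  set w : ℝ × ℝ → ENNReal := indicator {p | p.2 ≤ p.1} (fun p => ofReal (p.1 ^ (ρ - 3 / 2))) with hw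
  have hφm : Measurable φ := hφ.measurable
  have km : Measurable k := by rw [hk]; fun_prop
  have hms : MeasurableSet {p : ℝ × ℝ | p.2 ≤ p.1} := measurableSet_le measurable_snd measurable_fst
  have wm : Measurable w := by
    apply Measurable.indicator _ hms
    fun_prop
  have h1 : ‖φ 0 - (l⁻¹ : ℝ) • ∫ s in (0:ℝ)..l, φ s‖ₑ ≤ ∫⁻ p, k p * w p ∂(ν.prod ν) := by
    rw [lintegral_prod (fun p => k p * w p) (by exact (km.mul wm).aemeasurable)]
    refine (gv_avg hφ hl).trans ?_
    refine setLIntegral_mono' measurableSet_Ioc fun h hh => setLIntegral_mono' measurableSet_Ioc fun s hs => ?_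
    by_cases hsh : s ≤ h
    · rw [indicator_of_mem (show s ∈ {s | s ≤ h} from hsh), hw, indicator_of_mem (show (h, s) ∈ {p : ℝ × ℝ | p.2 ≤ p.1} from hsh), hk]
      simp only
      rcases hsh.eq_or_lt with e | hlt
      · simp [e]
      have h0 : 0 < h := hh.1
      rw [mul_comm, mul_assoc, ← ofReal_mul (by positivity)]
      gcongr
      rw [abs_of_pos (by linarith)]
      calc h ^ (-2:ℝ) = h ^ (-(1 / 2 + ρ)) * h ^ (ρ - 3 / 2) := by rw [← rpow_add h0]; congr 1; ring
        _ ≤ _ := by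
          gcongr ?_ * _
          apply Real.rpow_le_rpow_of_nonpos (by linarith) (by linarith [hs.1]) (by linarith)
    · rw [indicator_of_notMem (show s ∉ {s | s ≤ h} from hsh)]; exact zero_le
  have h2 := gv_cs (μ := ν.prod ν) km.aemeasurable wm.aemeasurable
  refine (pow_le_pow_left₀ (by positivity) h1 2).trans (h2.trans ?_)
  gcongr
  · rw [lintegral_prod _ (by fun_prop)]; rfl
  · rw [lintegral_prod _ (by fun_prop)]
    have e1 : ∀ h ∈ Ioc 0 l, ∫⁻ s, w (h, s) ^ 2 ∂ν ≤ ofReal (h ^ (2 * ρ - 2)) := by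
      intro h hh
      have h0 : 0 < h := hh.1
      have : ∀ s ∈ Ioc 0 l, w (h, s) ^ 2 = indicator (Ioc 0 h) (fun _ => ofReal (h ^ (2 * ρ - 3))) s := by
        intro s hs
        by_cases hsh : s ≤ h
        · rw [hw, indicator_of_mem (show (h, s) ∈ {p : ℝ × ℝ | p.2 ≤ p.1} from hsh), indicator_of_mem (show s ∈ Ioc 0 h from ⟨hs.1, hsh⟩),
            ← ofReal_pow (by positivity), ← rpow_natCast, ← rpow_mul h0.le]
          congr 2; push_cast; ring
        · rw [hw, indicator_of_notMem (show (h, s) ∉ {p : ℝ × ℝ | p.2 ≤ p.1} from hsh), indicator_of_notMem (fun hc => hsh hc.2)]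
          simp
      rw [hν, setLIntegral_congr_fun measurableSet_Ioc this]
      refine (lintegral_mono' Measure.restrict_le_self le_rfl).trans ?_
      rw [lintegral_indicator measurableSet_Ioc, setLIntegral_const, Real.volume_Ioc, ← ofReal_mul (by positivity)]
      apply ofReal_le_ofReal
      rw [sub_zero, ← rpow_add_one h0.ne']
      apply le_of_eq; congr 1; ring
    refine (setLIntegral_mono' measurableSet_Ioc e1).trans ?_
    have hint : IntervalIntegrable (fun h : ℝ => h ^ (2 * ρ - 2)) volume 0 l :=
      intervalIntegral.intervalIntegrable_rpow' (by linarith)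
    rw [← ofReal_integral_eq_lintegral_ofReal, ← intervalIntegral.integral_of_le hl.le, integral_rpow (Or.inl (by linarith))]
    · apply ofReal_le_ofReal
      rw [zero_rpow (by linarith), sub_zero]
      apply le_of_eq
      congr 1
      · congr 1; ring
      · ring
    · exact (intervalIntegrable_iff_integrableOn_Ioc_of_le hl.le).1 hint
    · refine (ae_restrict_iff' measurableSet_Ioc).2 (ae_of_all _ fun h hh => ?_)
      have : 0 < h := hh.1
      simp only [Pi.zero_apply]; positivity

theorem gv_shift1 (F : ℝ → ENNReal) (w l : ℝ) :
    ∫⁻ h in Ioc 0 l, F (w + h) ≤ ∫⁻ x in Icc w (w + l), F x := by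
  rw [← lintegral_indicator measurableSet_Ioc, ← lintegral_indicator measurableSet_Icc,
    ← lintegral_add_left_eq_self ((Icc w (w + l)).indicator F) w]
  refine lintegral_mono fun h => ?_
  by_cases hh : h ∈ Ioc 0 l
  · rw [indicator_of_mem hh, indicator_of_mem (show w + h ∈ Icc w (w + l) from
      ⟨by linarith [hh.1], by linarith [hh.2]⟩)]
  · rw [indicator_of_notMem hh]; exact zero_le

theorem gv_shift2 (F : ℝ → ENNReal) (z l : ℝ) :
    ∫⁻ h in Ioc 0 l, F (z - h) ≤ ∫⁻ x in Icc (z - l) z, F x := by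
  rw [← lintegral_indicator measurableSet_Ioc, ← lintegral_indicator measurableSet_Icc,
    ← lintegral_sub_left_eq_self ((Icc (z - l) z).indicator F) z]
  refine lintegral_mono fun h => ?_
  by_cases hh : h ∈ Ioc 0 l
  · rw [indicator_of_mem hh, indicator_of_mem (show z - h ∈ Icc (z - l) z from
      ⟨by linarith [hh.2], by linarith [hh.1]⟩)]
  · rw [indicator_of_notMem hh]; exact zero_le

theorem gv_sq_add (a b : ENNReal) : (a + b) ^ 2 ≤ 2 * (a ^ 2 + b ^ 2) := by
  have := ENNReal.rpow_add_le_mul_rpow_add_rpow a b (p := 2) (by norm_num)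
  norm_num at this
  exact_mod_cast this

theorem gv_morrey_aux {f : ℝ → ℂ} (hf : Continuous f) {ρ : ℝ} (hρ : 1 / 2 < ρ) {w z : ℝ} (hwz : w < z) :
    ‖f w - f z‖ₑ ^ 2 ≤ ofReal (4 * (z - w) ^ (2 * ρ - 1) / (2 * ρ - 1)) *
      ∫⁻ h in Icc w z, ∫⁻ s in Icc w z, gvK f ρ h s := by
  have hl : 0 < z - w := by linarith
  set l := z - w with hldef
  set K := ∫⁻ h in Icc w z, ∫⁻ s in Icc w z, gvK f ρ h s with hK
  have h1 := gv_avg2 (φ := fun s => f (w + s)) (by fun_prop) hl hρ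
  have h2 := gv_avg2 (φ := fun s => f (z - s)) (by fun_prop) hl hρ
  have k1 : ∫⁻ h in Ioc 0 l, ∫⁻ s in Ioc 0 l, gvK (fun s => f (w + s)) ρ h s ≤ K := by
    have e : ∀ h s, gvK (fun s => f (w + s)) ρ h s = gvK f ρ (w + h) (w + s) := by
      intro h s; unfold gvK; rw [add_sub_add_left_eq_sub]
    simp_rw [e]
    refine (lintegral_mono fun h => gv_shift1 (fun s => gvK f ρ (w + h) s) w l).trans ?_
    refine (gv_shift1 (fun h => ∫⁻ x in Icc w (w + l), gvK f ρ h x) w l).trans ?_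
    rw [hldef, add_sub_cancel]
  have k2 : ∫⁻ h in Ioc 0 l, ∫⁻ s in Ioc 0 l, gvK (fun s => f (z - s)) ρ h s ≤ K := by
    have e : ∀ h s, gvK (fun s => f (z - s)) ρ h s = gvK f ρ (z - h) (z - s) := by
      intro h s; unfold gvK; rw [show z - h - (z - s) = -(h - s) by ring, abs_neg]
    simp_rw [e]
    refine (lintegral_mono fun h => gv_shift2 (fun s => gvK f ρ (z - h) s) z l).trans ?_
    refine (gv_shift2 (fun h => ∫⁻ x in Icc (z - l) z, gvK f ρ h x) z l).trans ?_
    rw [hldef, sub_sub_cancel]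
  have ea : ∫ s in (0:ℝ)..l, f (z - s) = ∫ s in (0:ℝ)..l, f (w + s) := by
    rw [intervalIntegral.integral_comp_sub_left (fun s => f s) z, intervalIntegral.integral_comp_add_left (fun s => f s) w]
    rw [hldef]; simp
  simp only [add_zero, sub_zero, ea] at h1 h2
  set a := (l⁻¹ : ℝ) • ∫ s in (0:ℝ)..l, f (w + s)
  have h1' := h1.trans (mul_le_mul_left k1 _)
  have h2' := h2.trans (mul_le_mul_left k2 _)
  have t : ‖f w - f z‖ₑ ≤ ‖f w - a‖ₑ + ‖f z - a‖ₑ := by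
    have : f w - f z = (f w - a) - (f z - a) := by ring
    rw [this]; exact enorm_sub_le
  calc _ ≤ (‖f w - a‖ₑ + ‖f z - a‖ₑ) ^ 2 := by gcongr
    _ ≤ 2 * (‖f w - a‖ₑ ^ 2 + ‖f z - a‖ₑ ^ 2) := gv_sq_add _ _
    _ ≤ 2 * (K * ofReal (l ^ (2 * ρ - 1) / (2 * ρ - 1)) + K * ofReal (l ^ (2 * ρ - 1) / (2 * ρ - 1))) := by
      gcongr
    _ = _ := by
      rw [← two_mul, mul_div_assoc, ofReal_mul (by norm_num : (0:ℝ) ≤ 4)]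
      rw [← mul_assoc, mul_comm K, ← mul_assoc]; congr 2; norm_num

theorem gv_morrey {f : ℝ → ℂ} (hf : Continuous f) {ρ : ℝ} (hρ : 1 / 2 < ρ) {A B w z : ℝ}
    (hw : w ∈ Icc A B) (hz : z ∈ Icc A B) :
    ‖f w - f z‖ₑ ^ 2 ≤ ofReal (4 * (B - A) ^ (2 * ρ - 1) / (2 * ρ - 1)) *
      ∫⁻ h in Icc A B, ∫⁻ s in Icc A B, gvK f ρ h s := by
  have main : ∀ w z, w ∈ Icc A B → z ∈ Icc A B → w < z → ‖f w - f z‖ₑ ^ 2 ≤ ofReal (4 * (B - A) ^ (2 * ρ - 1) / (2 * ρ - 1)) *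
      ∫⁻ h in Icc A B, ∫⁻ s in Icc A B, gvK f ρ h s := by
    intro w z hw hz h
    refine (gv_morrey_aux hf hρ h).trans ?_
    have hs : Icc w z ⊆ Icc A B := Set.Icc_subset_Icc hw.1 hz.2
    gcongr
    · linarith
    · linarith
    · exact hz.2
    · exact hw.1
  rcases lt_trichotomy w z with h | h | h
  · exact main w z hw hz h
  · simp [h]
  · rw [← enorm_neg, neg_sub]; exact main z w hz hw h

/-- local energy -/
noncomputable def gvB (f : ℝ → ℂ) (ρ t x : ℝ) : ENNReal :=
  ∫⁻ h in Icc (x - t) (x + t), ∫⁻ s in Icc (x - t) (x + t), gvK f ρ h s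

noncomputable def gvE (f : ℝ → ℂ) (ρ : ℝ) : ENNReal := ∫⁻ h, ∫⁻ s, gvK f ρ h s

theorem gvB_int {f : ℝ → ℂ} (hf : Continuous f) (ρ t : ℝ) :
    ∫⁻ x, gvB f ρ t x ≤ ofReal (2 * t) * gvE f ρ := by
  have hm := gvK_meas hf ρ
  have m1 : Measurable (fun h => ∫⁻ s, gvK f ρ h s) := hm.lintegral_prod_right'
  calc ∫⁻ x, gvB f ρ t x ≤ ∫⁻ x, ∫⁻ h, indicator {p : ℝ × ℝ | |p.1 - p.2| ≤ t} (fun p => ∫⁻ s, gvK f ρ p.2 s) (x, h) := by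
        refine lintegral_mono fun x => ?_
        unfold gvB
        rw [← lintegral_indicator measurableSet_Icc]
        refine lintegral_mono fun h => ?_
        by_cases hh : h ∈ Icc (x - t) (x + t)
        · rw [indicator_of_mem hh, indicator_of_mem (show (x, h) ∈ {p : ℝ × ℝ | |p.1 - p.2| ≤ t} from
            (abs_le.2 ⟨by linarith [hh.2], by linarith [hh.1]⟩ : |x - h| ≤ t))]
          exact setLIntegral_le_lintegral _ _
        · rw [indicator_of_notMem hh]; exact zero_le
    _ = ∫⁻ h, ∫⁻ x, indicator {p : ℝ × ℝ | |p.1 - p.2| ≤ t} (fun p => ∫⁻ s, gvK f ρ p.2 s) (x, h) := by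
        rw [lintegral_lintegral_swap]
        apply Measurable.aemeasurable
        exact (m1.comp measurable_snd).indicator (measurableSet_le (by fun_prop) measurable_const)
    _ ≤ ∫⁻ h, ofReal (2 * t) * ∫⁻ s, gvK f ρ h s := by
        refine lintegral_mono fun h => ?_
        have : ∀ x, indicator {p : ℝ × ℝ | |p.1 - p.2| ≤ t} (fun p => ∫⁻ s, gvK f ρ p.2 s) (x, h) =
          indicator (Icc (h - t) (h + t)) (fun _ => ∫⁻ s, gvK f ρ h s) x := by
          intro x
          unfold indicator
          have : (x, h) ∈ {p : ℝ × ℝ | |p.1 - p.2| ≤ t} ↔ x ∈ Icc (h - t) (h + t) := by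
            simp only [Set.mem_ofPred_eq, abs_le, Set.mem_Icc]
            constructor
            · rintro ⟨a, b⟩; constructor <;> linarith
            · rintro ⟨a, b⟩; constructor <;> linarith
          simp only [this]
        simp_rw [this]
        rw [lintegral_indicator measurableSet_Icc, setLIntegral_const, Real.volume_Icc, mul_comm]
        apply le_of_eq; congr 2; ring
    _ = _ := by rw [lintegral_const_mul _ m1]; rfl

theorem gv_lint_abs {φ : ℝ → ENNReal} : ∫⁻ τ, φ |τ| = 2 * ∫⁻ τ in Ioi 0, φ τ := by
  have h1 : ∫⁻ τ in Ioi (0:ℝ), φ |τ| = ∫⁻ τ in Ioi 0, φ τ :=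
    setLIntegral_congr_fun measurableSet_Ioi fun x hx => by simp only [abs_of_pos (show 0 < x from hx)]
  have h2 : ∫⁻ τ in (Ioi (0:ℝ))ᶜ, φ |τ| = ∫⁻ τ in Ioi (0:ℝ), φ |τ| := by
    rw [Set.compl_Ioi, setLIntegral_congr Iio_ae_eq_Iic.symm, ← lintegral_indicator measurableSet_Iio,
      ← lintegral_indicator measurableSet_Ioi, ← lintegral_neg_eq_self]
    congr 1; ext x
    unfold indicator
    simp
  rw [← lintegral_add_compl _ (measurableSet_Ioi (a := (0:ℝ))), h2, h1, two_mul]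

theorem gv_lint_Ioc {k c : ℝ} (hk : -1 < k) (hc : 0 ≤ c) :
    ∫⁻ τ in Ioc 0 c, ofReal (τ ^ k) = ofReal (c ^ (k + 1) / (k + 1)) := by
  have hint : IntervalIntegrable (fun h : ℝ => h ^ k) volume 0 c :=
      intervalIntegral.intervalIntegrable_rpow' hk
  rw [← ofReal_integral_eq_lintegral_ofReal, ← intervalIntegral.integral_of_le hc, integral_rpow (Or.inl hk)]
  · rw [zero_rpow (by linarith), sub_zero]
  · exact (intervalIntegrable_iff_integrableOn_Ioc_of_le hc).1 hint
  · refine (ae_restrict_iff' measurableSet_Ioc).2 (ae_of_all _ fun h hh => ?_)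
    have : 0 < h := hh.1
    simp only [Pi.zero_apply]; positivity

theorem gv_lint_Ioi {k c : ℝ} (hk : k < -1) (hc : 0 < c) :
    ∫⁻ τ in Ioi c, ofReal (τ ^ k) = ofReal (-c ^ (k + 1) / (k + 1)) := by
  rw [← ofReal_integral_eq_lintegral_ofReal, integral_Ioi_rpow_of_lt hk hc]
  · exact integrableOn_Ioi_rpow_of_lt hk hc
  · refine (ae_restrict_iff' measurableSet_Ioi).2 (ae_of_all _ fun h hh => ?_)
    have : 0 < h := hc.trans hh
    simp only [Pi.zero_apply]; positivity

theorem gv_min_int {ρ b : ℝ} (h1 : 1 / 2 < ρ) (h2 : ρ < 1) (hb : 0 < b) :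
    ∫⁻ τ : ℝ, ofReal (|τ| ^ (-1 - 2 * ρ) * min 4 (b * τ ^ 2)) ≤
      ofReal ((2 / (2 - 2 * ρ) + 4 / ρ) * b ^ ρ) := by
  have e : ∀ τ : ℝ, |τ| ^ (-1 - 2 * ρ) * min 4 (b * τ ^ 2) = (fun t : ℝ => t ^ (-1 - 2 * ρ) * min 4 (b * t ^ 2)) |τ| := by
    intro τ; simp
  simp_rw [e]
  rw [gv_lint_abs (φ := fun t => ofReal (t ^ (-1 - 2 * ρ) * min 4 (b * t ^ 2)))]
  set c := b ^ (-(1 / 2) : ℝ) with hc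
  have hc0 : 0 < c := by positivity
  rw [← Ioc_union_Ioi_eq_Ioi hc0.le, lintegral_union measurableSet_Ioi (Ioc_disjoint_Ioi le_rfl)]
  have i1 : ∫⁻ t in Ioc 0 c, ofReal (t ^ (-1 - 2 * ρ) * min 4 (b * t ^ 2)) ≤ ofReal (b ^ ρ / (2 - 2 * ρ)) := by
    calc _ ≤ ∫⁻ t in Ioc 0 c, ofReal b * ofReal (t ^ (1 - 2 * ρ)) := by
          refine setLIntegral_mono' measurableSet_Ioc fun t ht => ?_
          have ht0 : 0 < t := ht.1
          rw [← ofReal_mul hb.le]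
          apply ofReal_le_ofReal
          calc _ ≤ t ^ (-1 - 2 * ρ) * (b * t ^ 2) := by gcongr; exact min_le_right _ _
            _ = b * (t ^ (-1 - 2 * ρ) * t ^ (2:ℝ)) := by rw [Real.rpow_two]; ring
            _ = _ := by rw [← rpow_add ht0]; congr 2; ring
      _ = _ := by
          rw [lintegral_const_mul' _ _ ofReal_ne_top, gv_lint_Ioc (by linarith) hc0.le, ← ofReal_mul hb.le, hc,
            ← rpow_mul hb.le]
          congr 1
          rw [← mul_div_assoc, ← Real.rpow_one_add' hb.le (by linarith)]
          congr 1
          · congr 1; ring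
          · ring
  have i2 : ∫⁻ t in Ioi c, ofReal (t ^ (-1 - 2 * ρ) * min 4 (b * t ^ 2)) ≤ ofReal (2 * b ^ ρ / ρ) := by
    calc _ ≤ ∫⁻ t in Ioi c, ofReal 4 * ofReal (t ^ (-1 - 2 * ρ)) := by
          refine setLIntegral_mono' measurableSet_Ioi fun t ht => ?_
          have ht0 : 0 < t := hc0.trans ht
          rw [← ofReal_mul (by norm_num), mul_comm]
          apply ofReal_le_ofReal
          gcongr; exact min_le_left _ _
      _ = _ := by
          rw [lintegral_const_mul' _ _ ofReal_ne_top, gv_lint_Ioi (by linarith) hc0, ← ofReal_mul (by norm_num), hc,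
            ← rpow_mul hb.le]
          congr 1
          rw [show -(1 / 2) * (-1 - 2 * ρ + 1) = ρ by ring, show -1 - 2 * ρ + 1 = -(2 * ρ) by ring]
          rw [neg_div_neg_eq]
          have : ρ ≠ 0 := by linarith
          field_simp; norm_num
  have h22 : 0 < 2 - 2 * ρ := by linarith
  calc _ ≤ 2 * (ofReal (b ^ ρ / (2 - 2 * ρ)) + ofReal (2 * b ^ ρ / ρ)) := by gcongr
    _ = _ := by
      rw [← ofReal_add (by positivity) (by positivity), ← ENNReal.ofReal_ofNat 2, ← ofReal_mul (by norm_num)]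
      congr 1; ring

theorem gv_exp_sub_one (y : ℝ) : ‖1 - Complex.exp (Complex.I * y)‖ ≤ min 2 |y| := by
  apply le_min
  · refine (norm_sub_le _ _).trans ?_
    rw [mul_comm, norm_exp_ofReal_mul_I]; norm_num
  · rw [norm_sub_rev]
    have := Real.norm_exp_I_mul_ofReal_sub_one_le (x := y)
    simpa using this

set_option maxHeartbeats 1000000 in
theorem gv_gag {F : ℝ → ℂ} (hF : Integrable F) {ρ : ℝ} (h1 : 1 / 2 < ρ) (h2 : ρ < 1) :
    gvE (FTinv F) ρ ≤ ofReal (2 / (2 - 2 * ρ) + 4 / ρ) * ∫⁻ ξ : ℝ, ofReal ((1 + ξ ^ 2) ^ ρ) * ‖F ξ‖ₑ ^ 2 := by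
  set f := FTinv F with hf
  have fc : Continuous f := gv_FTinv_cont hF
  have km := gvK_meas fc ρ
  have FaM : AEMeasurable (fun ξ => ‖F ξ‖ₑ ^ 2) := hF.aestronglyMeasurable.enorm.pow_const 2
  have s1 : gvE f ρ = ∫⁻ τ, ∫⁻ h, gvK f ρ h (h + τ) := by
    unfold gvE
    rw [lintegral_lintegral_swap (f := fun τ h => gvK f ρ h (h + τ))]
    · congr 1; ext h
      rw [lintegral_add_left_eq_self (fun s => gvK f ρ h s) h]
    · apply Measurable.aemeasurable
      have e : (Function.uncurry fun τ h => gvK f ρ h (h + τ)) = (fun p : ℝ × ℝ => gvK f ρ p.1 p.2) ∘ (fun p : ℝ × ℝ => (p.2, p.2 + p.1)) := by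
        ext p; rfl
      rw [e]
      exact Measurable.comp km (measurable_snd.prodMk (measurable_snd.add measurable_fst))
  rw [s1]
  have s2 : ∀ τ, ∫⁻ h, gvK f ρ h (h + τ) ≤ ∫⁻ ξ, ofReal (|τ| ^ (-1 - 2 * ρ) * min 4 ((1 + ξ ^ 2) * τ ^ 2)) * ‖F ξ‖ₑ ^ 2 := by
    intro τ
    have hFt : Integrable (fun ξ : ℝ => (1 - Complex.exp (Complex.I * (ξ : ℂ) * (τ : ℂ))) * F ξ) := by
      refine hF.bdd_mul (c := 2) (by fun_prop) (ae_of_all _ fun ξ => ?_)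
      have := (gv_exp_sub_one (ξ * τ)).trans (min_le_left _ _)
      push_cast at this
      rwa [← mul_assoc] at this
    have ef : ∀ h, f h - f (h + τ) = FTinv (fun ξ : ℝ => (1 - Complex.exp (Complex.I * (ξ : ℂ) * (τ : ℂ))) * F ξ) h := by
      intro h
      rw [hf]; unfold FTinv
      rw [← mul_sub, ← integral_sub]
      · congr 2; ext ξ
        push_cast
        rw [mul_add, exp_add]; ring
      · exact hF.bdd_mul (c := 1) (by fun_prop) (ae_of_all _ fun ξ => (gv_norm_exp _ _).le)
      · exact hF.bdd_mul (c := 1) (by fun_prop) (ae_of_all _ fun ξ => (gv_norm_exp _ _).le)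
    have ek : ∀ h, gvK f ρ h (h + τ) = ofReal (|τ| ^ (-1 - 2 * ρ)) * ‖FTinv (fun ξ : ℝ => (1 - Complex.exp (Complex.I * (ξ : ℂ) * (τ : ℂ))) * F ξ) h‖ₑ ^ 2 := by
      intro h
      unfold gvK
      rw [ef, mul_pow, mul_comm, ← ofReal_pow (by positivity), ← rpow_natCast, ← rpow_mul (abs_nonneg _)]
      congr 3
      · rw [show h - (h + τ) = -τ by ring, abs_neg]
      · push_cast; ring
    simp_rw [ek]
    rw [lintegral_const_mul' _ _ ofReal_ne_top]
    refine (mul_le_mul_right (gv_bessel' hFt) _).trans ?_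
    have hpi : ofReal (1 / (2 * Real.pi)) ≤ 1 := by
      rw [ofReal_le_one, div_le_one (by positivity)]; linarith [pi_gt_three]
    refine (mul_le_mul_right (mul_le_of_le_one_left (zero_le) hpi) _).trans ?_
    rw [← lintegral_const_mul' _ _ ofReal_ne_top]
    refine lintegral_mono fun ξ => ?_
    simp only
    rw [enorm_mul, mul_pow, ← mul_assoc, ofReal_mul (by positivity)]
    gcongr
    rw [← ofReal_norm, ← ofReal_pow (norm_nonneg _)]
    apply ofReal_le_ofReal
    have := gv_exp_sub_one (ξ * τ)
    push_cast at this
    rw [← mul_assoc] at this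
    have a1 := this.trans (min_le_left _ _)
    have a2 := this.trans (min_le_right _ _)
    have n0 := norm_nonneg (1 - Complex.exp (Complex.I * (ξ : ℂ) * (τ : ℂ)))
    apply le_min
    · nlinarith
    · have := pow_le_pow_left₀ n0 a2 2
      rw [sq_abs] at this
      nlinarith [sq_nonneg τ]
  refine (lintegral_mono s2).trans ?_
  rw [lintegral_lintegral_swap]
  · rw [← lintegral_const_mul' _ _ ofReal_ne_top]
    refine lintegral_mono fun ξ => ?_
    simp only
    rw [lintegral_mul_const']
    · refine (mul_le_mul_left (gv_min_int h1 h2 (by positivity)) _).trans ?_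
      have h22 : 0 < 2 - 2 * ρ := by linarith
      rw [ofReal_mul (by positivity), mul_assoc]
    · simp
  · have q1 : AEMeasurable (fun p : ℝ × ℝ => ofReal (|p.1| ^ (-1 - 2 * ρ) * min 4 ((1 + p.2 ^ 2) * p.1 ^ 2))) (volume.prod volume) := by
      apply Measurable.aemeasurable; fun_prop
    have q2 : AEMeasurable (fun p : ℝ × ℝ => ‖F p.2‖ₑ ^ 2) (volume.prod volume) := FaM.comp_snd
    exact q1.mul q2

theorem gvJ_int {G : ℝ → ℂ} {k : ℕ} (h : Integrable (fun ξ : ℝ => (ξ : ℂ) ^ k * G ξ)) :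
    Integrable (fun ξ : ℝ => (Complex.I * (ξ : ℂ)) ^ k * G ξ) := by
  refine (h.const_mul (Complex.I ^ k)).congr (ae_of_all _ fun ξ => ?_)
  simp only; ring

theorem gvJ_eq (G : ℝ → ℂ) (k : ℕ) (z : ℝ) :
    gvJ G k z = (2 * Real.pi : ℂ) * FTinv (fun ξ : ℝ => (Complex.I * (ξ : ℂ)) ^ k * G ξ) z := by
  unfold gvJ FTinv
  have : (2 * Real.pi : ℂ) ≠ 0 := by
    have := pi_ne_zero
    simp [this]
  rw [← mul_assoc, mul_one_div_cancel this, one_mul]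

theorem gvJ_deriv {G : ℝ → ℂ} {k : ℕ} (h0 : Integrable (fun ξ : ℝ => (ξ : ℂ) ^ k * G ξ))
    (h1 : Integrable (fun ξ : ℝ => (ξ : ℂ) ^ (k + 1) * G ξ)) (z : ℝ) :
    HasDerivAt (gvJ G k) (gvJ G (k + 1) z) z := by
  have i0 := gvJ_int h0
  have i1 := gvJ_int h1
  have := hasDerivAt_integral_of_dominated_loc_of_deriv_le (μ := volume)
    (F := fun (z : ℝ) (ξ : ℝ) => Complex.exp (Complex.I * (ξ : ℂ) * (z : ℂ)) * ((Complex.I * (ξ : ℂ)) ^ k * G ξ))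
    (F' := fun (z : ℝ) (ξ : ℝ) => Complex.exp (Complex.I * (ξ : ℂ) * (z : ℂ)) * ((Complex.I * (ξ : ℂ)) ^ (k + 1) * G ξ))
    (x₀ := z) (s := Set.univ) (bound := fun ξ : ℝ => ‖(Complex.I * (ξ : ℂ)) ^ (k + 1) * G ξ‖) Filter.univ_mem
    (Eventually.of_forall fun x => (by fun_prop : AEStronglyMeasurable (fun ξ : ℝ => Complex.exp (Complex.I * (ξ : ℂ) * (x : ℂ))) volume).mul i0.aestronglyMeasurable)
    (i0.bdd_mul (c := 1) (by fun_prop) (ae_of_all _ fun ξ => (gv_norm_exp _ _).le))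
    ((by fun_prop : AEStronglyMeasurable (fun ξ : ℝ => Complex.exp (Complex.I * (ξ : ℂ) * (z : ℂ))) volume).mul i1.aestronglyMeasurable)
    (ae_of_all _ fun ξ x _ => by rw [norm_mul, gv_norm_exp, one_mul])
    i1.norm
    (ae_of_all _ fun (ξ : ℝ) (x : ℝ) _ => by
      have e1 : HasDerivAt (fun x : ℝ => Complex.I * (ξ : ℂ) * (x : ℂ)) (Complex.I * ξ) x := by
        simpa using (ofRealCLM.hasDerivAt (x := x)).const_mul (Complex.I * (ξ : ℂ))
      refine (e1.cexp.mul_const ((Complex.I * (ξ : ℂ)) ^ k * G ξ)).congr_deriv ?_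
      ring)
  exact this.2

theorem gv_jet {G : ℝ → ℂ} {n : ℕ} (hk : ∀ k < n + 1, Integrable (fun ξ : ℝ => (ξ : ℂ) ^ k * G ξ)) {x z S : ℝ}
    (hz : ∀ k < n + 1, gvJ G k z = 0) (hS : ∀ w ∈ uIcc x z, ‖gvJ G n w‖ ≤ S) :
    ‖gvJ G 0 x‖ ≤ |x - z| ^ n * S := by
  have main : ∀ i ≤ n, ∀ w ∈ uIcc x z, ‖gvJ G (n - i) w‖ ≤ |x - z| ^ i * S := by
    intro i
    induction i with
    | zero => intro _ w hw; simpa using hS w hw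
    | succ i ih =>
      intro hi w hw
      have ih' := ih (by omega)
      have e : n - i = n - (i + 1) + 1 := by omega
      rw [e] at ih'
      have h1 := (convex_uIcc x z).norm_image_sub_le_of_norm_hasDerivWithin_le (f := gvJ G (n - (i + 1)))
        (fun v hv => (gvJ_deriv (hk (n - (i + 1)) (by omega)) (hk (n - (i + 1) + 1) (by omega)) v).hasDerivWithinAt) ih'
        right_mem_uIcc hw
      rw [hz _ (by omega), sub_zero] at h1
      refine h1.trans ?_
      have hwz : ‖w - z‖ ≤ |x - z| := by
        have := abs_sub_right_of_mem_uIcc hw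
        rw [norm_eq_abs, abs_sub_comm, abs_sub_comm x z]
        rwa [abs_sub_comm z x, abs_sub_comm x z] at this
      have S0 : 0 ≤ S := (norm_nonneg _).trans (hS x left_mem_uIcc)
      calc |x - z| ^ i * S * ‖w - z‖ ≤ |x - z| ^ i * S * |x - z| := by gcongr
        _ = _ := by ring
  have := main n le_rfl x left_mem_uIcc
  simpa using this

theorem gvB_meas {f : ℝ → ℂ} (hf : Continuous f) (ρ : ℝ) : Measurable (fun p : ℝ × ℝ => gvB f ρ p.1 p.2) := by
  have e : (fun p : ℝ × ℝ => gvB f ρ p.1 p.2) = fun p : ℝ × ℝ => ∫⁻ h, ∫⁻ s,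
      indicator {q : (ℝ × ℝ) × (ℝ × ℝ) | (q.1.2 - q.1.1 ≤ q.2.1 ∧ q.2.1 ≤ q.1.2 + q.1.1) ∧ (q.1.2 - q.1.1 ≤ q.2.2 ∧ q.2.2 ≤ q.1.2 + q.1.1)}
        (fun q => gvK f ρ q.2.1 q.2.2) (p, (h, s)) := by
    ext p
    unfold gvB
    rw [← lintegral_indicator measurableSet_Icc]
    congr 1; ext h
    by_cases hh : h ∈ Icc (p.2 - p.1) (p.2 + p.1)
    · rw [indicator_of_mem hh, ← lintegral_indicator measurableSet_Icc]
      congr 1; ext s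
      unfold indicator
      have h1 := hh.1
      have h2 := hh.2
      have h1' : p.2 ≤ h + p.1 := by linarith
      simp [h1', h2]
    · rw [indicator_of_notMem hh]
      symm
      have : (fun s => indicator {q : (ℝ × ℝ) × (ℝ × ℝ) | (q.1.2 - q.1.1 ≤ q.2.1 ∧ q.2.1 ≤ q.1.2 + q.1.1) ∧ (q.1.2 - q.1.1 ≤ q.2.2 ∧ q.2.2 ≤ q.1.2 + q.1.1)}
          (fun q => gvK f ρ q.2.1 q.2.2) (p, (h, s))) = fun _ => 0 := by
          ext s
          exact indicator_of_notMem (fun hc => hh hc.1) _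
      rw [this, lintegral_zero]
  rw [e]
  have hm : Measurable (indicator {q : (ℝ × ℝ) × (ℝ × ℝ) | (q.1.2 - q.1.1 ≤ q.2.1 ∧ q.2.1 ≤ q.1.2 + q.1.1) ∧ (q.1.2 - q.1.1 ≤ q.2.2 ∧ q.2.2 ≤ q.1.2 + q.1.1)}
        (fun q => gvK f ρ q.2.1 q.2.2)) := by
    apply Measurable.indicator
    · exact (gvK_meas hf ρ).comp measurable_snd
    · have m1 : MeasurableSet {q : (ℝ × ℝ) × (ℝ × ℝ) | q.1.2 - q.1.1 ≤ q.2.1} := measurableSet_le (by fun_prop) (by fun_prop)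
      have m2 : MeasurableSet {q : (ℝ × ℝ) × (ℝ × ℝ) | q.2.1 ≤ q.1.2 + q.1.1} := measurableSet_le (by fun_prop) (by fun_prop)
      have m3 : MeasurableSet {q : (ℝ × ℝ) × (ℝ × ℝ) | q.1.2 - q.1.1 ≤ q.2.2} := measurableSet_le (by fun_prop) (by fun_prop)
      have m4 : MeasurableSet {q : (ℝ × ℝ) × (ℝ × ℝ) | q.2.2 ≤ q.1.2 + q.1.1} := measurableSet_le (by fun_prop) (by fun_prop)
      exact (m1.inter m2).inter (m3.inter m4)
  have h3 : Measurable (fun r : (ℝ × ℝ) × ℝ => ∫⁻ s, indicator {q : (ℝ × ℝ) × (ℝ × ℝ) | (q.1.2 - q.1.1 ≤ q.2.1 ∧ q.2.1 ≤ q.1.2 + q.1.1) ∧ (q.1.2 - q.1.1 ≤ q.2.2 ∧ q.2.2 ≤ q.1.2 + q.1.1)}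
        (fun q => gvK f ρ q.2.1 q.2.2) (r.1, (r.2, s))) := by
    exact Measurable.lintegral_prod_right' (f := fun r : ((ℝ × ℝ) × ℝ) × ℝ => indicator _ _ (r.1.1, (r.1.2, r.2)))
      (hm.comp (by fun_prop))
  exact h3.lintegral_prod_right'

theorem gv_X_small {G : ℝ → ℂ} {n : ℕ} (hk : ∀ k < n + 1, Integrable (fun ξ : ℝ => (ξ : ℂ) ^ k * G ξ)) {ρ : ℝ}
    (h1 : 1 / 2 < ρ) {x z t : ℝ} (hz : ∀ k < n + 1, gvJ G k z = 0) (ht : |x - z| ≤ t) :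
    ‖FTinv G x‖ₑ ^ 2 ≤ ofReal (t ^ (2 * n) * (4 * (2 * t) ^ (2 * ρ - 1) / (2 * ρ - 1))) *
      gvB (FTinv (fun ξ : ℝ => (Complex.I * (ξ : ℂ)) ^ n * G ξ)) ρ t x := by
  set f := FTinv (fun ξ : ℝ => (Complex.I * (ξ : ℂ)) ^ n * G ξ) with hf
  have fc : Continuous f := gv_FTinv_cont (gvJ_int (hk n (by omega)))
  have t0 : 0 ≤ t := (abs_nonneg _).trans ht
  set Y := ofReal (4 * (2 * t) ^ (2 * ρ - 1) / (2 * ρ - 1)) * gvB f ρ t x with hY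
  have hr : 0 < 2 * ρ - 1 := by linarith
  have e0 : ofReal (t ^ (2 * n) * (4 * (2 * t) ^ (2 * ρ - 1) / (2 * ρ - 1))) * gvB f ρ t x = ofReal (t ^ n) ^ 2 * Y := by
    rw [ofReal_mul (by positivity), hY, mul_assoc, ← ofReal_pow (by positivity), ← pow_mul, mul_comm n 2]
  rw [e0]
  have fz : f z = 0 := by
    have := hz n (by omega)
    rw [gvJ_eq] at this
    have hp := pi_ne_zero
    simpa [hp] using this
  have hM : ∀ w ∈ uIcc x z, ‖f w‖ₑ ^ 2 ≤ Y := by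
    intro w hw
    have := abs_le.1 ht
    have hz' : z ∈ Icc (x - t) (x + t) := ⟨by linarith, by linarith⟩
    have hw' : w ∈ Icc (x - t) (x + t) :=
      (Set.uIcc_subset_Icc ⟨by linarith, by linarith⟩ hz') hw
    have := gv_morrey fc h1 hw' hz'
    rw [fz, sub_zero, show x + t - (x - t) = 2 * t by ring] at this
    exact this
  by_cases hYt : Y = ⊤
  · rw [hYt]
    rcases eq_or_ne (ofReal (t ^ n)) 0 with h | h
    · rw [ofReal_eq_zero] at h
      have tn : t ^ n = 0 := le_antisymm h (by positivity)
      have t00 : t = 0 := eq_zero_of_pow_eq_zero tn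
      have hY0 : Y = 0 := by
        rw [hY, t00, mul_zero, zero_rpow (by linarith)]; simp
      rw [hY0] at hYt; simp at hYt
    · rw [mul_top (by positivity)]; exact le_top
  · set S := sqrt Y.toReal with hS
    have hM' : ∀ w ∈ uIcc x z, ‖f w‖ ≤ S := by
      intro w hw
      apply le_sqrt_of_sq_le
      have := ENNReal.toReal_mono hYt (hM w hw)
      simpa using this
    have hj := gv_jet hk (x := x) (z := z) (S := 2 * Real.pi * S) hz (fun w hw => by
      rw [gvJ_eq, norm_mul]
      have : ‖(2 * Real.pi : ℂ)‖ = 2 * Real.pi := by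
        rw [show (2 * Real.pi : ℂ) = ((2 * Real.pi : ℝ) : ℂ) by push_cast; ring, norm_real, norm_of_nonneg (by positivity)]
      rw [this]
      have := hM' w hw
      gcongr)
    rw [gvJ_eq, norm_mul] at hj
    have : ‖(2 * Real.pi : ℂ)‖ = 2 * Real.pi := by
        rw [show (2 * Real.pi : ℂ) = ((2 * Real.pi : ℝ) : ℂ) by push_cast; ring, norm_real, norm_of_nonneg (by positivity)]
    rw [this] at hj
    simp only [pow_zero, one_mul] at hj
    have hp := pi_pos
    have hj2 : ‖FTinv G x‖ ≤ t ^ n * S := by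
      have : |x - z| ^ n * (2 * Real.pi * S) ≤ t ^ n * (2 * Real.pi * S) := by gcongr
      have h3 : 2 * Real.pi * ‖FTinv G x‖ ≤ 2 * Real.pi * (t ^ n * S) := by
        calc _ ≤ _ := hj
          _ ≤ _ := this
          _ = _ := by ring
      exact le_of_mul_le_mul_left h3 (by positivity)
    have hj3 : ‖FTinv G x‖ ^ 2 ≤ (t ^ n) ^ 2 * Y.toReal := by
      calc _ ≤ (t ^ n * S) ^ 2 := by gcongr
        _ = _ := by rw [mul_pow, hS, sq_sqrt ENNReal.toReal_nonneg]
    rw [← ofReal_norm, ← ofReal_pow (norm_nonneg _), ← ofReal_pow (by positivity)]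
    rw [← ENNReal.ofReal_toReal hYt, ← ofReal_mul (by positivity)]
    exact ofReal_le_ofReal hj3

noncomputable def gvPhi (G : ℝ → ℂ) (n : ℕ) (ρ lam : ℝ) (p : ℝ × ℝ) : ENNReal :=
  if p.1 ≤ 1 then ofReal (p.1 ^ (-1 - lam)) * (ofReal (p.1 ^ (2 * n) * (4 * (2 * p.1) ^ (2 * ρ - 1) / (2 * ρ - 1))) *
      gvB (FTinv (fun ξ : ℝ => (Complex.I * (ξ : ℂ)) ^ n * G ξ)) ρ p.1 p.2)
  else ofReal (p.1 ^ (-1 - lam)) * ‖FTinv G p.2‖ₑ ^ 2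

theorem gvPhi_meas {G : ℝ → ℂ} {n : ℕ} (hk : ∀ k < n + 1, Integrable (fun ξ : ℝ => (ξ : ℂ) ^ k * G ξ)) (ρ lam : ℝ) :
    Measurable (gvPhi G n ρ lam) := by
  unfold gvPhi
  have hG : Integrable G := by simpa using hk 0 (by omega)
  have gm : Measurable (FTinv G) := (gv_FTinv_cont hG).measurable
  have fc := gv_FTinv_cont (gvJ_int (hk n (by omega)))
  apply Measurable.ite (measurableSet_le measurable_fst measurable_const)
  · exact (by fun_prop : Measurable (fun p : ℝ × ℝ => ofReal (p.1 ^ (-1 - lam)))).mul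
      ((by fun_prop : Measurable (fun p : ℝ × ℝ => ofReal (p.1 ^ (2 * n) * (4 * (2 * p.1) ^ (2 * ρ - 1) / (2 * ρ - 1))))).mul (gvB_meas fc ρ))
  · fun_prop

theorem gvPhi_int {G : ℝ → ℂ} {n : ℕ} (hk : ∀ k < n + 1, Integrable (fun ξ : ℝ => (ξ : ℂ) ^ k * G ξ)) {ρ lam : ℝ}
    (h1 : 1 / 2 < ρ) (h2 : ρ < 1) (hl : 0 < lam) (hl2 : lam < 2 * (n + ρ)) :
    ∫⁻ t in Ioi 0, ∫⁻ x, gvPhi G n ρ lam (t, x) ≤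
      ofReal (16 / (2 * ρ - 1) / (2 * (n + ρ) - lam)) * gvE (FTinv (fun ξ : ℝ => (Complex.I * (ξ : ℂ)) ^ n * G ξ)) ρ +
      ofReal (1 / lam) * ∫⁻ x, ‖FTinv G x‖ₑ ^ 2 := by
  have fc := gv_FTinv_cont (gvJ_int (hk n (by omega)))
  set f := FTinv (fun ξ : ℝ => (Complex.I * (ξ : ℂ)) ^ n * G ξ) with hf
  have hr : 0 < 2 * ρ - 1 := by linarith
  rw [← Ioc_union_Ioi_eq_Ioi (zero_le_one), lintegral_union measurableSet_Ioi (Ioc_disjoint_Ioi le_rfl)]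
  gcongr
  · calc _ ≤ ∫⁻ t in Ioc (0:ℝ) 1, ofReal (16 / (2 * ρ - 1)) * gvE f ρ * ofReal (t ^ (2 * (n + ρ) - lam - 1)) := by
          refine setLIntegral_mono' measurableSet_Ioc fun t ht => ?_
          have t0 : 0 < t := ht.1
          simp only [gvPhi, if_pos ht.2]
          rw [lintegral_const_mul' _ _ ofReal_ne_top, lintegral_const_mul' _ _ ofReal_ne_top]
          refine (mul_le_mul_right (mul_le_mul_right (gvB_int fc ρ t) _) _).trans ?_
          rw [← mul_assoc, ← mul_assoc, ← ofReal_mul (by positivity), ← ofReal_mul (by positivity),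
            mul_right_comm (ofReal (16 / (2 * ρ - 1))), ← ofReal_mul (by positivity)]
          gcongr ofReal ?_ * _
          have e1 : (2 * t) ^ (2 * ρ - 1) ≤ 2 * t ^ (2 * ρ - 1) := by
            rw [mul_rpow (by norm_num) t0.le]
            gcongr
            calc (2:ℝ) ^ (2 * ρ - 1) ≤ 2 ^ (1:ℝ) := rpow_le_rpow_of_exponent_le (by norm_num) (by linarith)
              _ = 2 := by simp
          calc _ ≤ t ^ (-1 - lam) * (t ^ (2 * n) * (4 * (2 * t ^ (2 * ρ - 1)) / (2 * ρ - 1))) * (2 * t) := by gcongr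
            _ = 16 / (2 * ρ - 1) * (t ^ (-1 - lam) * t ^ ((2 * n : ℕ) : ℝ) * t ^ (2 * ρ - 1) * t ^ (1:ℝ)) := by
              rw [rpow_natCast, rpow_one]; ring
            _ = _ := by
              rw [← rpow_add t0, ← rpow_add t0, ← rpow_add t0]
              congr 2; push_cast; ring
      _ = _ := by
          rw [lintegral_const_mul _ (by fun_prop), gv_lint_Ioc (by linarith) zero_le_one, mul_right_comm,
            ← ofReal_mul (by positivity)]
          congr 2
          rw [one_rpow]; ring
  · calc _ ≤ ∫⁻ t in Ioi (1:ℝ), (∫⁻ x, ‖FTinv G x‖ₑ ^ 2) * ofReal (t ^ (-1 - lam)) := by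
          refine setLIntegral_mono' measurableSet_Ioi fun t ht => ?_
          have t1 : ¬ t ≤ 1 := not_le.2 ht
          simp only [gvPhi, if_neg t1]
          rw [lintegral_const_mul' _ _ ofReal_ne_top, mul_comm]
      _ = _ := by
          rw [lintegral_const_mul _ (by fun_prop), gv_lint_Ioi (by linarith) zero_lt_one, mul_comm]
          congr 2
          rw [one_rpow, show -1 - lam + 1 = -lam by ring, neg_div_neg_eq]

theorem gv_X_pt {G : ℝ → ℂ} {n : ℕ} (hk : ∀ k < n + 1, Integrable (fun ξ : ℝ => (ξ : ℂ) ^ k * G ξ)) {ρ lam : ℝ}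
    (h1 : 1 / 2 < ρ) {x y : ℝ} (hz : ∃ z ∈ uIcc x y, ∀ k < n + 1, gvJ G k z = 0) :
    ofReal (|x - y| ^ (-1 - lam)) * (‖FTinv G x‖ₑ * ‖FTinv G y‖ₑ) ≤
      gvPhi G n ρ lam (|x - y|, x) + gvPhi G n ρ lam (|x - y|, y) := by
  have hab : ‖FTinv G x‖ₑ * ‖FTinv G y‖ₑ ≤ ‖FTinv G x‖ₑ ^ 2 + ‖FTinv G y‖ₑ ^ 2 := by
    rcases le_total ‖FTinv G x‖ₑ ‖FTinv G y‖ₑ with h | h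
    · calc _ ≤ ‖FTinv G y‖ₑ * ‖FTinv G y‖ₑ := by gcongr
        _ ≤ _ := by rw [← sq]; exact le_add_self
    · calc _ ≤ ‖FTinv G x‖ₑ * ‖FTinv G x‖ₑ := by gcongr
        _ ≤ _ := by rw [← sq]; exact le_self_add
  refine (mul_le_mul_right hab _).trans ?_
  rw [mul_add]
  obtain ⟨z, hz, hz0⟩ := hz
  unfold gvPhi
  split_ifs with h
  · simp only
    gcongr
    · apply gv_X_small hk h1 hz0
      have := Set.abs_sub_left_of_mem_uIcc hz
      rwa [abs_sub_comm z x, abs_sub_comm y x] at this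
    · apply gv_X_small hk h1 hz0
      have := abs_sub_right_of_mem_uIcc hz
      rwa [abs_sub_comm y x] at this
  · rfl

theorem gv_X (n : ℕ) {ρ lam : ℝ} (h1 : 1 / 2 < ρ) (h2 : ρ < 1) (hl : 0 < lam) (hl2 : lam < 2 * (n + ρ)) :
    ∃ C > (0:ℝ), ∀ G : ℝ → ℂ, (∀ k < n + 1, Integrable (fun ξ : ℝ => (ξ : ℂ) ^ k * G ξ)) → ∀ S : Set (ℝ × ℝ),
      (∀ x y, (x, y) ∈ S → ∃ z ∈ uIcc x y, ∀ k < n + 1, gvJ G k z = 0) →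
      ∫⁻ x, ∫⁻ y, S.indicator (fun q => ofReal (|q.1 - q.2| ^ (-1 - lam)) * (‖FTinv G q.1‖ₑ * ‖FTinv G q.2‖ₑ)) (x, y) ≤
        ofReal C * ∫⁻ ξ : ℝ, ofReal ((1 + ξ ^ 2) ^ (n + ρ)) * ‖G ξ‖ₑ ^ 2 := by
  set c1 := 16 / (2 * ρ - 1) / (2 * (n + ρ) - lam) with hc1
  set c2 := 2 / (2 - 2 * ρ) + 4 / ρ with hc2
  have p1 : 0 < 2 * ρ - 1 := by linarith
  have p2 : 0 < 2 * (n + ρ) - lam := by linarith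
  have p3 : 0 < 2 - 2 * ρ := by linarith
  have c1p : 0 < c1 := by positivity
  have c2p : 0 < c2 := by positivity
  refine ⟨4 * (c1 * c2 + 1 / lam), by positivity, fun G hk S hS => ?_⟩
  have hG : Integrable G := by simpa using hk 0 (by omega)
  have pm := gvPhi_meas hk ρ lam
  set Z := ∫⁻ ξ : ℝ, ofReal ((1 + ξ ^ 2) ^ (n + ρ)) * ‖G ξ‖ₑ ^ 2 with hZ
  have b1 : gvE (FTinv (fun ξ : ℝ => (Complex.I * (ξ : ℂ)) ^ n * G ξ)) ρ ≤ ofReal c2 * Z := by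
    refine (gv_gag (gvJ_int (hk n (by omega))) h1 h2).trans ?_
    gcongr
    refine lintegral_mono fun ξ => ?_
    simp only
    rw [enorm_mul, mul_pow, ← mul_assoc]
    gcongr
    rw [← ofReal_norm, ← ofReal_pow (norm_nonneg _), ← ofReal_mul (by positivity)]
    apply ofReal_le_ofReal
    rw [add_comm (n:ℝ), rpow_add (by positivity), rpow_natCast]
    gcongr
    rw [norm_pow, norm_mul, norm_I, one_mul, norm_real, ← pow_mul, mul_comm n 2, pow_mul, norm_eq_abs, sq_abs]
    gcongr; linarith
  have b2 : ∫⁻ x, ‖FTinv G x‖ₑ ^ 2 ≤ Z := by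
    refine (gv_bessel' hG).trans ?_
    have hpi : ofReal (1 / (2 * Real.pi)) ≤ 1 := by
      rw [ofReal_le_one, div_le_one (by positivity)]; linarith [pi_gt_three]
    refine (mul_le_of_le_one_left (zero_le) hpi).trans ?_
    refine lintegral_mono fun ξ => ?_
    simp only
    refine le_mul_of_one_le_left zero_le ?_
    rw [one_le_ofReal]
    exact one_le_rpow (by nlinarith [sq_nonneg ξ]) (by positivity)
  have b3 : ∫⁻ x, ∫⁻ y, gvPhi G n ρ lam (|x - y|, x) = 2 * ∫⁻ t in Ioi 0, ∫⁻ x, gvPhi G n ρ lam (t, x) := by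
    have : ∀ x, ∫⁻ y, gvPhi G n ρ lam (|x - y|, x) = ∫⁻ τ, gvPhi G n ρ lam (|τ|, x) := fun x =>
      lintegral_sub_left_eq_self (fun τ => gvPhi G n ρ lam (|τ|, x)) x
    simp_rw [this]
    rw [lintegral_lintegral_swap]
    · exact gv_lint_abs (φ := fun t => ∫⁻ x, gvPhi G n ρ lam (t, x))
    · apply Measurable.aemeasurable
      exact pm.comp (show Measurable (fun p : ℝ × ℝ => (|p.2|, p.1)) by fun_prop)
  have b4 : ∫⁻ x, ∫⁻ y, gvPhi G n ρ lam (|x - y|, y) = ∫⁻ x, ∫⁻ y, gvPhi G n ρ lam (|x - y|, x) := by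
    rw [lintegral_lintegral_swap]
    · simp_rw [fun x y : ℝ => abs_sub_comm x y]
    · apply Measurable.aemeasurable
      exact pm.comp (show Measurable (fun p : ℝ × ℝ => (|p.1 - p.2|, p.2)) by fun_prop)
  calc _ ≤ ∫⁻ x, ∫⁻ y, (gvPhi G n ρ lam (|x - y|, x) + gvPhi G n ρ lam (|x - y|, y)) := by
        refine lintegral_mono fun x => lintegral_mono fun y => ?_
        by_cases h : (x, y) ∈ S
        · rw [indicator_of_mem h]
          exact gv_X_pt hk h1 (hS x y h)
        · rw [indicator_of_notMem h]; exact zero_le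
    _ = (∫⁻ x, ∫⁻ y, gvPhi G n ρ lam (|x - y|, x)) + ∫⁻ x, ∫⁻ y, gvPhi G n ρ lam (|x - y|, y) := by
        have m1 : Measurable (fun p : ℝ × ℝ => gvPhi G n ρ lam (|p.1 - p.2|, p.1)) :=
          pm.comp (show Measurable (fun p : ℝ × ℝ => (|p.1 - p.2|, p.1)) by fun_prop)
        rw [← lintegral_add_left]
        · congr 1; ext x
          rw [lintegral_add_left]
          exact m1.comp (show Measurable (fun y : ℝ => (x, y)) by fun_prop)
        · exact m1.lintegral_prod_right'
    _ = 4 * ∫⁻ t in Ioi 0, ∫⁻ x, gvPhi G n ρ lam (t, x) := by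
        rw [b4, b3, ← two_mul, ← mul_assoc]; norm_num
    _ ≤ 4 * (ofReal c1 * (ofReal c2 * Z) + ofReal (1 / lam) * Z) := by
        gcongr
        refine (gvPhi_int hk h1 h2 hl hl2).trans ?_
        gcongr
    _ = _ := by
        rw [← mul_assoc, ← ofReal_mul c1p.le, ← add_mul, ← ofReal_add (by positivity) (by positivity), ← mul_assoc,
          ofReal_mul (by norm_num)]
        norm_num

/-- resolvent kernel form -/
noncomputable def gvR (p q : ℝ → ℝ) (v : ℝ) : ℝ :=
  ∫ z : ℝ × ℝ, (Real.pi / √(1 + v) * exp (-√(1 + v) * |z.1 - z.2|)) * (p z.1 * q z.2)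

theorem gvR_int {p q : ℝ → ℝ} (hp : Integrable p) (hq : Integrable q) {v : ℝ} (hv : 0 < v) :
    Integrable (fun z : ℝ × ℝ => (Real.pi / √(1 + v) * exp (-√(1 + v) * |z.1 - z.2|)) * (p z.1 * q z.2)) (volume.prod volume) := by
  refine (hp.mul_prod hq).bdd_mul (c := Real.pi / √(1 + v)) (by fun_prop) (ae_of_all _ fun z => ?_)
  rw [norm_of_nonneg (by positivity)]
  refine mul_le_of_le_one_right (by positivity) ?_
  rw [exp_le_one_iff]
  have : 0 ≤ √(1 + v) * |z.1 - z.2| := by positivity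
  linarith

theorem gvR_nonneg {p q : ℝ → ℝ} (p0 : ∀ x, 0 ≤ p x) (q0 : ∀ x, 0 ≤ q x) (v : ℝ) : 0 ≤ gvR p q v := by
  unfold gvR
  refine integral_nonneg fun z => ?_
  have := mul_nonneg (p0 z.1) (q0 z.2)
  have := pi_pos
  simp only [Pi.zero_apply]; positivity

theorem gvR_anti {p q : ℝ → ℝ} (hp : Integrable p) (hq : Integrable q) (p0 : ∀ x, 0 ≤ p x) (q0 : ∀ x, 0 ≤ q x) (v w : ℝ)
    (hv : 0 < v) (hvw : v ≤ w) : gvR p q w ≤ gvR p q v := by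
  unfold gvR
  refine integral_mono (gvR_int hp hq (hv.trans_le hvw)) (gvR_int hp hq hv) fun z => ?_
  have h := mul_nonneg (p0 z.1) (q0 z.2)
  have hpi := pi_pos
  have h1 : √(1 + v) ≤ √(1 + w) := sqrt_le_sqrt (by linarith)
  have h2 : 0 < √(1 + v) := sqrt_pos.2 (by linarith)
  simp only
  have h3 : -√(1 + w) * |z.1 - z.2| ≤ -√(1 + v) * |z.1 - z.2| := by
    have := mul_le_mul_of_nonneg_right h1 (abs_nonneg (z.1 - z.2))
    linarith
  gcongr

theorem gvR_FT {p q : ℝ → ℝ} (hp : Integrable p) (hq : Integrable q) {v : ℝ} (hv : 0 < v) :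
    gvR p q v = ∫ ξ : ℝ, (FT (fun x => (p x : ℂ)) ξ * (starRingEnd ℂ) (FT (fun x => (q x : ℂ)) ξ)).re / (v + (1 + ξ ^ 2)) := by
  have hη : 0 < √(1 + v) := sqrt_pos.2 (by linarith)
  set η := √(1 + v) with hηd
  have hη2 : η ^ 2 = 1 + v := sq_sqrt (by linarith)
  have hci : Integrable (fun ξ : ℝ => ((1 / (η ^ 2 + ξ ^ 2) : ℝ) : ℂ)) := (gv_cauchy_int hη).ofReal
  have hpq : Integrable (fun z : ℝ × ℝ => ((p z.1 : ℝ) : ℂ) * ((q z.2 : ℝ) : ℂ)) (volume.prod volume) := hp.ofReal.mul_prod hq.ofReal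
  have e1 : ∀ ξ : ℝ, FT (fun x => (p x : ℂ)) ξ * (starRingEnd ℂ) (FT (fun x => (q x : ℂ)) ξ) =
      ∫ z : ℝ × ℝ, Complex.exp (-Complex.I * (ξ : ℂ) * ((z.1 - z.2 : ℝ) : ℂ)) * (((p z.1 : ℝ) : ℂ) * ((q z.2 : ℝ) : ℂ)) := by
    intro ξ
    unfold FT
    rw [← integral_conj, Measure.volume_eq_prod, ← integral_prod_mul]
    congr 1; ext z
    rw [map_mul, ← exp_conj, conj_ofReal]
    simp only [map_mul, map_neg, Complex.conj_I, conj_ofReal, neg_neg]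
    push_cast
    rw [mul_sub, sub_eq_add_neg, exp_add]
    rw [show -(-Complex.I * (ξ : ℂ) * (z.2 : ℂ)) = Complex.I * ξ * z.2 by ring]
    ring
  have e2 : ∫ ξ : ℝ, ((1 / (η ^ 2 + ξ ^ 2) : ℝ) : ℂ) * (FT (fun x => (p x : ℂ)) ξ * (starRingEnd ℂ) (FT (fun x => (q x : ℂ)) ξ)) =
      ((gvR p q v : ℝ) : ℂ) := by
    simp_rw [e1]
    have : ∀ ξ : ℝ, ((1 / (η ^ 2 + ξ ^ 2) : ℝ) : ℂ) * ∫ z : ℝ × ℝ, Complex.exp (-Complex.I * (ξ : ℂ) * ((z.1 - z.2 : ℝ) : ℂ)) * (((p z.1 : ℝ) : ℂ) * ((q z.2 : ℝ) : ℂ)) =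
        ∫ z : ℝ × ℝ, Complex.exp (-Complex.I * (ξ : ℂ) * ((z.1 - z.2 : ℝ) : ℂ)) * (((1 / (η ^ 2 + ξ ^ 2) : ℝ) : ℂ) * (((p z.1 : ℝ) : ℂ) * ((q z.2 : ℝ) : ℂ))) := by
      intro ξ
      rw [← integral_const_mul]
      congr 1; ext z; ring
    simp_rw [this]
    rw [integral_integral_swap]
    · unfold gvR
      rw [← integral_complex_ofReal]
      congr 1; ext z
      have h := gv_FT_cauchy hη (z.1 - z.2)
      unfold FT at h
      have h' : ∫ ξ : ℝ, Complex.exp (-Complex.I * (ξ : ℂ) * ((z.1 - z.2 : ℝ) : ℂ)) * (((1 / (η ^ 2 + ξ ^ 2) : ℝ) : ℂ) * (((p z.1 : ℝ) : ℂ) * ((q z.2 : ℝ) : ℂ))) =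
          (∫ ξ : ℝ, Complex.exp (-Complex.I * ((z.1 - z.2 : ℝ) : ℂ) * (ξ : ℂ)) * ((1 / (η ^ 2 + ξ ^ 2) : ℝ) : ℂ)) * (((p z.1 : ℝ) : ℂ) * ((q z.2 : ℝ) : ℂ)) := by
        rw [← integral_mul_const]
        congr 1; ext ξ
        rw [mul_right_comm (-Complex.I) (ξ : ℂ)]; ring
      rw [h', h]
      push_cast; ring
    · refine (hci.mul_prod hpq).bdd_mul (c := 1) ?_ (ae_of_all _ fun z => ?_)
      · apply Continuous.aestronglyMeasurable; fun_prop
      · exact (gv_norm_exp' _ _).le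
  have e3 : Integrable (fun ξ : ℝ => ((1 / (η ^ 2 + ξ ^ 2) : ℝ) : ℂ) * (FT (fun x => (p x : ℂ)) ξ * (starRingEnd ℂ) (FT (fun x => (q x : ℂ)) ξ))) := by
    have c1 := gv_FT_cont (f := fun x => (p x : ℂ)) hp.ofReal
    have c2 := gv_FT_cont (f := fun x => (q x : ℂ)) hq.ofReal
    refine hci.mul_bdd (c := (∫ x, ‖(p x : ℂ)‖) * ∫ x, ‖(q x : ℂ)‖) ?_ (ae_of_all _ fun ξ => ?_)
    · exact (c1.mul (continuous_conj.comp c2)).aestronglyMeasurable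
    · rw [norm_mul, RCLike.norm_conj]
      gcongr
      · exact gv_FT_norm _ _
      · exact gv_FT_norm _ _
  have e4 := congrArg re e2
  rw [ofReal_re] at e4
  rw [← e4, ← RCLike.re_eq_complex_re, ← integral_re e3]
  congr 1; ext ξ
  rw [RCLike.re_eq_complex_re, re_ofReal_mul, hη2]
  rw [show 1 + v + ξ ^ 2 = v + (1 + ξ ^ 2) by ring]; ring

theorem gv_lint_sqrt {τ t : ℝ} (hτ : 0 ≤ τ) (ht : 0 < t) :
    ∫⁻ v in Ioi (0:ℝ), ofReal (v ^ τ * (Real.pi / √(1 + v) * exp (-√(1 + v) * t))) ≤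
      ofReal (2 * Real.pi * Gamma (2 * τ + 1) * t ^ (-2 * τ - 1)) := by
  have h := integral_rpow_mul_exp_neg_mul_rpow (p := 1 / 2) (q := τ - 1 / 2) (b := t) (by norm_num) (by linarith) ht
  have e1 : (τ - 1 / 2 + 1) / (1 / 2) = 2 * τ + 1 := by ring
  have e2 : -(τ - 1 / 2 + 1) / (1 / 2) = -2 * τ - 1 := by ring
  rw [e1, e2] at h
  have hG : 0 < Gamma (2 * τ + 1) := Gamma_pos_of_pos (by linarith)
  have hne : ∫ x in Ioi (0:ℝ), x ^ (τ - 1 / 2) * exp (-t * x ^ (1 / 2 : ℝ)) ≠ 0 := by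
    rw [h]; positivity
  have hi : IntegrableOn (fun x : ℝ => x ^ (τ - 1 / 2) * exp (-t * x ^ (1 / 2 : ℝ))) (Ioi 0) :=
    not_imp_comm.1 integral_undef hne
  have hl := ofReal_integral_eq_lintegral_ofReal hi ((ae_restrict_iff' measurableSet_Ioi).2 (ae_of_all _ fun x hx => by
    have : 0 < x := hx
    simp only [Pi.zero_apply]; positivity))
  calc _ ≤ ∫⁻ v in Ioi (0:ℝ), ofReal Real.pi * ofReal (v ^ (τ - 1 / 2) * exp (-t * v ^ (1 / 2 : ℝ))) := by
        refine setLIntegral_mono' measurableSet_Ioi fun v hv => ?_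
        have hv : 0 < v := hv
        have hpi := pi_pos
        rw [← ofReal_mul hpi.le]
        apply ofReal_le_ofReal
        have h1 : √v ≤ √(1 + v) := sqrt_le_sqrt (by linarith)
        have h2 : 0 < √v := sqrt_pos.2 hv
        have h3 : -√(1 + v) * t ≤ -√v * t := by
          have := mul_le_mul_of_nonneg_right h1 ht.le
          linarith
        calc _ ≤ v ^ τ * (Real.pi / √v * exp (-√v * t)) := by gcongr
          _ = _ := by
            rw [rpow_sub hv, ← sqrt_eq_rpow, mul_comm (-√v) t, mul_neg, neg_mul]; ring
    _ = _ := by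
        rw [lintegral_const_mul' _ _ ofReal_ne_top, ← hl, h, ← ofReal_mul pi_pos.le]
        congr 1; ring

theorem gv_I {p q : ℝ → ℝ} (hp : Integrable p) (hq : Integrable q) (p0 : ∀ x, 0 ≤ p x) (q0 : ∀ x, 0 ≤ q x)
    (pc : Measurable p) (qc : Measurable q)
    (hpq : ∀ x, p x * q x = 0) {τ : ℝ} (hτ : 0 ≤ τ) :
    ∫⁻ v in Ioi 0, ofReal (v ^ τ * gvR p q v) ≤ ofReal (2 * Real.pi * Gamma (2 * τ + 1)) *
      ∫⁻ x, ∫⁻ y, ofReal (p x * q y * |x - y| ^ (-2 * τ - 1)) := by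
  have hpi := pi_pos
  have hG : 0 < Gamma (2 * τ + 1) := Gamma_pos_of_pos (by linarith)
  calc _ = ∫⁻ v in Ioi 0, ∫⁻ z : ℝ × ℝ, ofReal (v ^ τ * (Real.pi / √(1 + v) * exp (-√(1 + v) * |z.1 - z.2|))) * ofReal (p z.1 * q z.2) := by
        refine setLIntegral_congr_fun measurableSet_Ioi fun v hv => ?_
        have hv : 0 < v := hv
        unfold gvR
        have hgi : Integrable (fun z : ℝ × ℝ => (Real.pi / √(1 + v) * exp (-√(1 + v) * |z.1 - z.2|)) * (p z.1 * q z.2)) volume := gvR_int hp hq hv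
        rw [ofReal_mul (by positivity), ofReal_integral_eq_lintegral_ofReal hgi, ← lintegral_const_mul' _ _ ofReal_ne_top]
        · congr 1; ext z
          rw [← ofReal_mul (by positivity), ← ofReal_mul (by positivity)]
          congr 1; ring
        · refine ae_of_all _ fun z => ?_
          have := mul_nonneg (p0 z.1) (q0 z.2)
          simp only [Pi.zero_apply]; positivity
    _ = ∫⁻ z : ℝ × ℝ, ∫⁻ v in Ioi 0, ofReal (v ^ τ * (Real.pi / √(1 + v) * exp (-√(1 + v) * |z.1 - z.2|))) * ofReal (p z.1 * q z.2) := by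
        rw [lintegral_lintegral_swap]
        apply Measurable.aemeasurable
        fun_prop
    _ ≤ ∫⁻ z : ℝ × ℝ, ofReal (2 * Real.pi * Gamma (2 * τ + 1)) * ofReal (p z.1 * q z.2 * |z.1 - z.2| ^ (-2 * τ - 1)) := by
        refine lintegral_mono fun z => ?_
        simp only
        rw [lintegral_mul_const' _ _ ofReal_ne_top]
        by_cases hz : z.1 = z.2
        · rw [hz, hpq]; simp
        · have ht : 0 < |z.1 - z.2| := abs_pos.2 (sub_ne_zero.2 hz)
          refine (mul_le_mul_left (gv_lint_sqrt hτ ht) _).trans (le_of_eq ?_)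
          rw [← ofReal_mul (by positivity), ← ofReal_mul (by positivity)]
          congr 1; ring
    _ = _ := by
        rw [lintegral_const_mul' _ _ ofReal_ne_top, Measure.volume_eq_prod, lintegral_prod]
        apply Measurable.aemeasurable
        fun_prop

structure GvCore (G P : ℝ → ℂ) (g p : ℝ → ℝ) : Prop where
  hg : ∀ x, ((g x : ℝ) : ℂ) = FTinv G x
  hp : ∀ x, ((p x : ℝ) : ℂ) = FTinv P x
  Pe : P = FT (fun x => ((p x : ℝ) : ℂ))
  pi : Integrable p
  qi : Integrable (fun x => g x ^ 2)
  hc : ∀ x, p x = 0 ∨ p x = g x ^ 2 / 2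
  Gi : Integrable G
  Pi : Integrable P

theorem gv_L2_of_bdd {f : ℝ → ℝ} (hf : Integrable f) {M : ℝ} (hM : ∀ x, |f x| ≤ M) :
    Integrable (fun ξ => ‖FT (fun x => ((f x : ℝ) : ℂ)) ξ‖ ^ 2) := by
  have hfc : Integrable (fun x => ((f x : ℝ) : ℂ)) := hf.ofReal
  have hc := gv_FT_cont hfc
  refine ⟨(hc.norm.pow 2).aestronglyMeasurable, ?_⟩
  rw [hasFiniteIntegral_iff_enorm]
  have h2 : Integrable (fun x => f x * f x) := hf.bdd_mul (c := M) hf.1 (ae_of_all _ fun x => by rw [norm_eq_abs]; exact hM x)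
  have h3 := h2.2
  rw [hasFiniteIntegral_iff_enorm] at h3
  calc ∫⁻ ξ, ‖‖FT (fun x => ((f x : ℝ) : ℂ)) ξ‖ ^ 2‖ₑ = ∫⁻ ξ, ‖FT (fun x => ((f x : ℝ) : ℂ)) ξ‖ₑ ^ 2 := by
        congr 1; ext ξ; simp [enorm_pow]
    _ ≤ _ := gv_bessel hfc
    _ < ⊤ := by
        refine mul_lt_top ofReal_lt_top ?_
        convert h3 using 3 with x
        rw [enorm_mul, sq, ← ofReal_norm, ← ofReal_norm, norm_real]

namespace GvCore
variable {G P : ℝ → ℂ} {g p : ℝ → ℝ}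

theorem gc (H : GvCore G P g p) : Continuous g := by
  have h := gv_FTinv_cont H.Gi
  have : g = fun x => (FTinv G x).re := by ext x; rw [← H.hg]; simp
  rw [this]; exact continuous_re.comp h

theorem pc (H : GvCore G P g p) : Continuous p := by
  have h := gv_FTinv_cont H.Pi
  have : p = fun x => (FTinv P x).re := by ext x; rw [← H.hp]; simp
  rw [this]; exact continuous_re.comp h

theorem gbd (H : GvCore G P g p) : ∃ M, 0 ≤ M ∧ ∀ x, g x ^ 2 / 2 ≤ M := by
  refine ⟨((1 / (2 * Real.pi)) * ∫ x, ‖G x‖) ^ 2 / 2, by positivity, fun x => ?_⟩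
  have := gv_FTinv_norm G x
  rw [← H.hg, norm_real, norm_eq_abs] at this
  rw [← sq_abs]
  gcongr

theorem p0 (H : GvCore G P g p) (x : ℝ) : 0 ≤ p x := by
  rcases H.hc x with h | h <;> rw [h]; positivity

theorem ppq (H : GvCore G P g p) (x : ℝ) : p x ≤ g x ^ 2 / 2 := by
  rcases H.hc x with h | h <;> rw [h]; positivity

theorem q0 (H : GvCore G P g p) (x : ℝ) : 0 ≤ g x ^ 2 / 2 - p x := by linarith [H.ppq x]

theorem pq0 (H : GvCore G P g p) (x : ℝ) : p x * (g x ^ 2 / 2 - p x) = 0 := by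
  rcases H.hc x with h | h <;> rw [h] <;> simp

theorem qi' (H : GvCore G P g p) : Integrable (fun x => g x ^ 2 / 2) := H.qi.div_const 2

theorem ri (H : GvCore G P g p) : Integrable (fun x => g x ^ 2 / 2 - p x) := H.qi'.sub H.pi

theorem res (H : GvCore G P g p) : GvRes volume (fun ξ : ℝ => 1 + ξ ^ 2)
    (fun ξ => ‖P ξ‖ ^ 2 + ‖FT (fun x => ((g x ^ 2 / 2 - p x : ℝ) : ℂ)) ξ‖ ^ 2)
    (fun ξ => (P ξ * (starRingEnd ℂ) (FT (fun x => ((g x ^ 2 / 2 - p x : ℝ) : ℂ)) ξ)).re)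
    (fun ξ => ‖FT (fun x => ((g x ^ 2 / 2 : ℝ) : ℂ)) ξ‖ ^ 2)
    (gvR p (fun x => g x ^ 2 / 2 - p x)) := by
  obtain ⟨M, hM0, hM⟩ := H.gbd
  have cP : Continuous P := by rw [H.Pe]; exact gv_FT_cont H.pi.ofReal
  have cR := gv_FT_cont (f := fun x => ((g x ^ 2 / 2 - p x : ℝ) : ℂ)) H.ri.ofReal
  refine ⟨by fun_prop, fun x => by nlinarith [sq_nonneg x], fun ξ => by positivity, fun ξ => by positivity, ?_, ?_, ?_, ?_, ?_, ?_, ?_, ?_⟩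
  · refine Integrable.add ?_ ?_
    · conv in P _ => rw [H.Pe]
      exact gv_L2_of_bdd H.pi (M := M) fun x => by rw [abs_of_nonneg (H.p0 x)]; exact (H.ppq x).trans (hM x)
    · exact gv_L2_of_bdd H.ri (M := M) fun x => by
        rw [abs_of_nonneg (H.q0 x)]; linarith [hM x, H.p0 x]
  · exact (continuous_re.comp (cP.mul (continuous_conj.comp cR))).aestronglyMeasurable
  · exact gv_L2_of_bdd H.qi' (M := M) fun x => by rw [abs_of_nonneg (by positivity)]; exact hM x
  · refine ae_of_all _ fun ξ => ?_
    have e : FT (fun x => ((g x ^ 2 / 2 : ℝ) : ℂ)) ξ = P ξ + FT (fun x => ((g x ^ 2 / 2 - p x : ℝ) : ℂ)) ξ := by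
      rw [H.Pe]
      unfold FT
      rw [← integral_add]
      · congr 1; ext x; push_cast; ring
      · refine H.pi.ofReal.bdd_mul (c := 1) (Continuous.aestronglyMeasurable (by fun_prop)) (ae_of_all _ fun x => (gv_norm_exp' _ _).le)
      · refine H.ri.ofReal.bdd_mul (c := 1) (Continuous.aestronglyMeasurable (by fun_prop)) (ae_of_all _ fun x => (gv_norm_exp' _ _).le)
    rw [e, ← normSq_eq_norm_sq, ← normSq_eq_norm_sq, ← normSq_eq_norm_sq, Complex.normSq_add]
    ring
  · intro ξ
    have h1 := Complex.abs_re_le_norm (P ξ * (starRingEnd ℂ) (FT (fun x => ((g x ^ 2 / 2 - p x : ℝ) : ℂ)) ξ))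
    rw [norm_mul, RCLike.norm_conj] at h1
    nlinarith [sq_nonneg (‖P ξ‖ - ‖FT (fun x => ((g x ^ 2 / 2 - p x : ℝ) : ℂ)) ξ‖), norm_nonneg (P ξ), sq_nonneg (‖P ξ‖), sq_nonneg (‖FT (fun x => ((g x ^ 2 / 2 - p x : ℝ) : ℂ)) ξ‖)]
  · exact fun v _ => gvR_nonneg H.p0 H.q0 v
  · exact fun v w hv hw => gvR_anti H.pi H.ri H.p0 H.q0 v w hv hw
  · intro v hv
    rw [gvR_FT H.pi H.ri hv, ← H.Pe]

theorem flat (H : GvCore G P g p) (n : ℕ) (hk : ∀ k < n + 1, Integrable (fun ξ : ℝ => (ξ : ℂ) ^ k * G ξ))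
    (hkP : ∀ k < 2 * n + 1, Integrable (fun ξ : ℝ => (ξ : ℂ) ^ k * P ξ)) {x y : ℝ}
    (hx : p x ≠ 0) (hy : g y ^ 2 / 2 - p y ≠ 0) : ∃ z ∈ uIcc x y, ∀ k < n + 1, gvJ G k z = 0 := by
  obtain ⟨z, hz, f1, f2⟩ := gv_cross (p := p) (q := fun x => g x ^ 2 / 2) H.pc ((H.gc.pow 2).div_const 2) H.hc hx hy
  refine ⟨z, hz, gv_flat n H.Gi H.Pi hk hkP (f1.mono fun h hh => ?_) (f2.mono fun h hh => ?_)⟩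
  · rw [← H.hp, hh]; simp
  · rw [← H.hp, hh, ← H.hg]; push_cast; ring

theorem I_bound (H : GvCore G P g p) (n : ℕ) (hk : ∀ k < n + 1, Integrable (fun ξ : ℝ => (ξ : ℂ) ^ k * G ξ))
    (hkP : ∀ k < 2 * n + 1, Integrable (fun ξ : ℝ => (ξ : ℂ) ^ k * P ξ)) {τ β : ℝ} (hτ : 0 ≤ τ)
    (h0 : (n : ℝ) ≤ β) (h1 : β ≤ n + 1) (hβ : Integrable (fun ξ : ℝ => |ξ| ^ β * ‖G ξ‖)) :
    ∫⁻ v in Ioi 0, ofReal (v ^ τ * gvR p (fun x => g x ^ 2 / 2 - p x) v) ≤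
      ofReal (2 * Real.pi * Gamma (2 * τ + 1) * (4 ^ (-β) / Gamma (β + 1) ^ 2 * (∫ ξ : ℝ, |ξ| ^ β * ‖G ξ‖) ^ 2)) *
      ∫⁻ x, ∫⁻ y, {z : ℝ × ℝ | p z.1 ≠ 0 ∧ g z.2 ^ 2 / 2 - p z.2 ≠ 0}.indicator
        (fun q => ofReal (|q.1 - q.2| ^ (-1 - (2 * τ - 2 * β))) * (‖FTinv G q.1‖ₑ * ‖FTinv G q.2‖ₑ)) (x, y) := by
  have hpi := pi_pos
  have hβ0 : 0 ≤ β := le_trans (Nat.cast_nonneg _) h0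
  have hΓ : 0 < Gamma (β + 1) := Gamma_pos_of_pos (by linarith)
  have hΓ2 : 0 < Gamma (2 * τ + 1) := Gamma_pos_of_pos (by linarith)
  set M := ∫ ξ : ℝ, |ξ| ^ β * ‖G ξ‖ with hM
  have hM0 : 0 ≤ M := integral_nonneg fun ξ => by positivity
  refine (gv_I H.pi H.ri H.p0 H.q0 H.pc.measurable ((H.gc.pow 2).div_const 2 |>.sub H.pc).measurable H.pq0 hτ).trans ?_
  rw [ofReal_mul (p := 2 * Real.pi * Gamma (2 * τ + 1)) (by positivity), mul_assoc (ofReal _)]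
  gcongr
  rw [← lintegral_const_mul' _ _ ofReal_ne_top]
  refine lintegral_mono fun x => ?_
  rw [← lintegral_const_mul' _ _ ofReal_ne_top]
  refine lintegral_mono fun y => ?_
  by_cases hS : p x ≠ 0 ∧ g y ^ 2 / 2 - p y ≠ 0
  · rw [indicator_of_mem (by exact hS)]
    obtain ⟨hx, hy⟩ := hS
    obtain ⟨z, hz, hJ⟩ := H.flat n hk hkP hx hy
    have hxy : x ≠ y := by
      rintro rfl
      have := H.pq0 x
      rcases mul_eq_zero.1 this with h | h
      exacts [hx h, hy h]
    have ht : 0 < |x - y| := abs_pos.2 (sub_ne_zero.2 hxy)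
    have b1 := gv_flat_bound n H.Gi hk h0 h1 hβ hJ x
    have b2 := gv_flat_bound n H.Gi hk h0 h1 hβ hJ y
    rw [← H.hg, norm_real, norm_eq_abs, ← hM] at b1 b2
    have epx : p x = |g x| ^ 2 / 2 := by
      rw [sq_abs]; exact (H.hc x).resolve_left hx
    have epy : g y ^ 2 / 2 - p y = |g y| ^ 2 / 2 := by
      rw [sq_abs]
      rcases H.hc y with h | h
      · rw [h]; ring
      · exact absurd (by rw [h]; ring) hy
    have hzz : |x - z| * |y - z| ≤ |x - y| ^ 2 / 4 := by
      have : |x - z| + |y - z| = |x - y| := by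
        rcases le_total x y with h | h
        · rw [uIcc_of_le h] at hz
          rw [abs_of_nonpos (by linarith [hz.1]), abs_of_nonneg (by linarith [hz.2]), abs_of_nonpos (by linarith)]; ring
        · rw [Set.uIcc_of_ge h] at hz
          rw [abs_of_nonneg (by linarith [hz.2]), abs_of_nonpos (by linarith [hz.1]), abs_of_nonneg (by linarith)]; ring
      rw [← this]; nlinarith [sq_nonneg (|x - z| - |y - z|)]
    have hprod : |g x| * |g y| ≤ 4 ^ (-β) / Gamma (β + 1) ^ 2 * M ^ 2 * |x - y| ^ (2 * β) := by
      calc |g x| * |g y| ≤ (|x - z| ^ β / Gamma (β + 1) * M) * (|y - z| ^ β / Gamma (β + 1) * M) := by gcongr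
        _ = (|x - z| * |y - z|) ^ β * (M ^ 2 / Gamma (β + 1) ^ 2) := by
            rw [mul_rpow (abs_nonneg _) (abs_nonneg _)]; field_simp
        _ ≤ (|x - y| ^ 2 / 4) ^ β * (M ^ 2 / Gamma (β + 1) ^ 2) := by gcongr
        _ = _ := by
            rw [div_rpow (by positivity) (by norm_num), rpow_neg (by norm_num), rpow_mul (abs_nonneg _)]
            norm_num; field_simp
    have en : ∀ w : ℝ, ‖FTinv G w‖ₑ = ofReal |g w| := by
      intro w; rw [← H.hg, ← ofReal_norm, norm_real, norm_eq_abs]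
    simp only [en]
    rw [← ofReal_mul (abs_nonneg _), ← ofReal_mul (by positivity), ← ofReal_mul (by positivity)]
    apply ofReal_le_ofReal
    rw [epx, epy]
    have e3 : |x - y| ^ (-1 - (2 * τ - 2 * β)) = |x - y| ^ (2 * β) * |x - y| ^ (-2 * τ - 1) := by
      rw [← rpow_add ht]; ring_nf
    rw [e3]
    set D := |x - y| ^ (-2 * τ - 1)
    have hD : 0 ≤ D := by positivity
    calc |g x| ^ 2 / 2 * (|g y| ^ 2 / 2) * D = (|g x| * |g y|) * ((|g x| * |g y|) * D / 4) := by ring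
      _ ≤ (|g x| * |g y|) * ((4 ^ (-β) / Gamma (β + 1) ^ 2 * M ^ 2 * |x - y| ^ (2 * β)) * D / 1) := by
          gcongr; norm_num
      _ = _ := by ring
  · have : p x * (g y ^ 2 / 2 - p y) = 0 := by
      by_contra h
      exact hS (mul_ne_zero_iff.1 h)
    rw [this, zero_mul, ENNReal.ofReal_zero]; exact zero_le

end GvCore

theorem gv_Gamma_add {x t : ℝ} (hx : 1 ≤ x) (ht : 0 ≤ t) (ht1 : t ≤ 1) : Gamma (x + t) ≤ Gamma x * x := by
  have hx0 : 0 < x := by linarith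
  have hG : 0 < Gamma x := Gamma_pos_of_pos hx0
  have hb : Gamma (x + 1) = x * Gamma x := Real.Gamma_add_one hx0.ne'
  rcases eq_or_lt_of_le ht with rfl | ht
  · rw [add_zero]; nlinarith
  rcases eq_or_lt_of_le ht1 with rfl | ht1
  · rw [hb]; linarith
  have h := Gamma_mul_add_mul_le_rpow_Gamma_mul_rpow_Gamma (s := x) (t := x + 1) (a := 1 - t) (b := t) hx0 (by linarith) (by linarith) ht (by ring)
  rw [hb, show (1 - t) * x + t * (x + 1) = x + t by ring, mul_rpow hx0.le hG.le] at h
  calc _ ≤ _ := h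
    _ = (Gamma x ^ (1 - t) * Gamma x ^ t) * x ^ t := by ring
    _ = Gamma x * x ^ t := by rw [← rpow_add hG]; simp
    _ ≤ Gamma x * x ^ (1:ℝ) := by gcongr
    _ = _ := by simp

theorem gv_Gamma_ratio {β ε : ℝ} (hβ : 0 ≤ β) (h0 : 0 ≤ ε) (h1 : ε ≤ 1 / 2) :
    Gamma (2 * β + 2 + 2 * ε) * (4 ^ (-β) / Gamma (β + 1) ^ 2) ≤ 4 * (β + 1) ^ 2 := by
  have hG : 0 < Gamma (β + 1) := Gamma_pos_of_pos (by linarith)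
  have a1 := gv_Gamma_add (x := 2 * β + 2) (t := 2 * ε) (by linarith) (by linarith) (by linarith)
  have a2 := gv_Gamma_add (x := β + 1) (t := 1 / 2) (by linarith) (by norm_num) (by norm_num)
  have a3 := Real.Gamma_mul_Gamma_add_half (β + 1)
  rw [show 2 * (β + 1) = 2 * β + 2 by ring] at a3
  have hpi : 1 ≤ √Real.pi := by rw [Real.one_le_sqrt]; linarith [pi_gt_three]
  have e4 : (2:ℝ) ^ (1 - (2 * β + 2)) = 4 ^ (-β) / 2 := by
    rw [show (1 - (2 * β + 2)) = 2 * (-β) - 1 by ring, rpow_sub (by norm_num), rpow_mul (by norm_num)]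
    norm_num
  rw [e4] at a3
  set F : ℝ := 4 ^ (-β) with hF
  have hF0 : 0 < F := by positivity
  have hG2 : 0 < Gamma (2 * β + 2) := Gamma_pos_of_pos (by linarith)
  have a4 : Gamma (2 * β + 2) * F ≤ 2 * (β + 1) * Gamma (β + 1) ^ 2 := by
    have : Gamma (2 * β + 2) * F * 1 ≤ Gamma (2 * β + 2) * F * √Real.pi := by gcongr
    nlinarith
  rw [← mul_div_assoc, div_le_iff₀ (by positivity)]
  calc _ ≤ (Gamma (2 * β + 2) * (2 * β + 2)) * F := by gcongr
    _ = (Gamma (2 * β + 2) * F) * (2 * β + 2) := by ring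
    _ ≤ (2 * (β + 1) * Gamma (β + 1) ^ 2) * (2 * β + 2) := by gcongr
    _ = _ := by ring

theorem gv_M {θ : ℝ} (hθ : 0 < θ) : ∃ C > (0:ℝ), ∀ (G : ℝ → ℂ) (β : ℝ), AEStronglyMeasurable G → 0 ≤ β →
    (∫⁻ ξ : ℝ, ofReal (|ξ| ^ β) * ‖G ξ‖ₑ) ^ 2 ≤
      ofReal C * ∫⁻ ξ : ℝ, ofReal ((1 + ξ ^ 2) ^ (β + 1 / 2 + θ)) * ‖G ξ‖ₑ ^ 2 := by
  have hi : Integrable (fun ξ : ℝ => (1 + ‖ξ‖ ^ 2) ^ (-(1 + 2 * θ) / 2)) := integrable_rpow_neg_one_add_norm_sq (by simp; linarith)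
  refine ⟨(∫ ξ : ℝ, (1 + ‖ξ‖ ^ 2) ^ (-(1 + 2 * θ) / 2)) + 1, ?_, fun G β hG hβ => ?_⟩
  · have : 0 ≤ ∫ ξ : ℝ, (1 + ‖ξ‖ ^ 2) ^ (-(1 + 2 * θ) / 2) := integral_nonneg fun ξ => by positivity
    linarith
  have h := gv_cs (μ := volume) (f := fun ξ : ℝ => ofReal ((1 + ξ ^ 2) ^ (-(1 + 2 * θ) / 4))) (g := fun ξ : ℝ => ofReal ((1 + ξ ^ 2) ^ ((β + 1 / 2 + θ) / 2)) * ‖G ξ‖ₑ)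
    (by fun_prop) (AEMeasurable.mul (by fun_prop) hG.enorm)
  have hb : ∀ ξ : ℝ, 0 < 1 + ξ ^ 2 := fun ξ => by positivity
  refine le_trans ?_ (h.trans (mul_le_mul' ?_ ?_))
  · refine pow_le_pow_left₀ zero_le (lintegral_mono fun ξ => ?_) 2
    rw [← mul_assoc, ← ofReal_mul (by positivity)]
    gcongr
    rw [← rpow_add (hb ξ)]
    calc |ξ| ^ β ≤ ((1 + ξ ^ 2) ^ (1 / 2 : ℝ)) ^ β := by
          gcongr
          rw [← sqrt_eq_rpow]
          apply abs_le_sqrt; linarith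
      _ = _ := by rw [← rpow_mul (hb ξ).le]; ring_nf
  · calc _ = ∫⁻ ξ : ℝ, ofReal ((1 + ‖ξ‖ ^ 2) ^ (-(1 + 2 * θ) / 2)) := by
          congr 1; ext ξ
          rw [← ofReal_pow (by positivity), ← rpow_natCast, ← rpow_mul (hb ξ).le, norm_eq_abs, sq_abs]
          push_cast; ring_nf
      _ = ofReal (∫ ξ : ℝ, (1 + ‖ξ‖ ^ 2) ^ (-(1 + 2 * θ) / 2)) := by
          rw [ofReal_integral_eq_lintegral_ofReal hi (ae_of_all _ fun ξ => by positivity)]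
      _ ≤ _ := by gcongr; linarith
  · refine le_of_eq ?_
    congr 1; ext ξ
    rw [mul_pow, ← ofReal_pow (by positivity), ← rpow_natCast, ← rpow_mul (hb ξ).le]
    push_cast; ring_nf

theorem gv_ptA {θ : ℝ} (h0 : 0 ≤ θ) (h1 : θ < 1) : ∃ K > (0:ℝ), ∀ (a b E κ r : ℝ), 0 ≤ a → a ≤ 1 → 1 ≤ b → 0 ≤ E → 0 ≤ κ →
    ∑' j : ℕ, ofReal ((θ * E) ^ j / (j.factorial : ℝ) * ((1 + a * j) ^ 2 * b ^ (r - κ + a * j))) ≤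
      ofReal (K * (b ^ r * exp (E * b ^ a))) := by
  have ht := tendsto_pow_const_mul_const_pow_of_abs_lt_one 2 (r := θ) (by rw [abs_of_nonneg h0]; exact h1)
  obtain ⟨K0, hK0⟩ := ht.bddAbove_range
  have hT := tendsto_pow_const_mul_const_pow_of_abs_lt_one 0 (r := θ) (by rw [abs_of_nonneg h0]; exact h1)
  have hb0 : ∀ j : ℕ, (1 + (j:ℝ)) ^ 2 * θ ^ j ≤ 2 + 2 * K0 := by
    intro j
    have := hK0 ⟨j, rfl⟩
    simp only at this
    have h2 : θ ^ j ≤ 1 := pow_le_one₀ h0 h1.le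
    have h3 : 0 ≤ θ ^ j := by positivity
    nlinarith [sq_nonneg ((j:ℝ) - 1)]
  have hKpos : 0 < 2 + 2 * K0 := by
    have := hb0 0; norm_num at this; linarith
  refine ⟨2 + 2 * K0, hKpos, fun a b E κ r ha ha1 hb hE hκ => ?_⟩
  have hb' : 0 < b := by linarith
  have hs := (gv_hasSum_pow (b := b) (r := r) (a := a) (e := E) hb').mul_left (2 + 2 * K0)
  rw [← hs.tsum_eq, ofReal_tsum_of_nonneg (fun j => by positivity) hs.summable]
  refine tsum_le_tsum fun j => ofReal_le_ofReal ?_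
  have c1 : (1 + a * j) ^ 2 ≤ (1 + (j:ℝ)) ^ 2 := by
    gcongr
    exact mul_le_of_le_one_left (by positivity) ha1
  have c2 : b ^ (r - κ + a * j) ≤ b ^ (r + a * j) := rpow_le_rpow_of_exponent_le hb (by linarith)
  rw [mul_pow]
  calc θ ^ j * E ^ j / (j.factorial : ℝ) * ((1 + a * j) ^ 2 * b ^ (r - κ + a * j))
      ≤ θ ^ j * E ^ j / (j.factorial : ℝ) * ((1 + (j:ℝ)) ^ 2 * b ^ (r + a * j)) := by gcongr
    _ = ((1 + (j:ℝ)) ^ 2 * θ ^ j) * (E ^ j / (j.factorial : ℝ) * b ^ (r + a * j)) := by ring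
    _ ≤ _ := by gcongr; exact hb0 j

theorem gv_ptB : ∃ K > (0:ℝ), ∀ (a b E κ r : ℝ), 0 ≤ a → a ≤ 1 / 2 → 1 ≤ b → 0 ≤ E → 2 * a ≤ κ →
    ∑' j : ℕ, ofReal (E ^ j / (j.factorial : ℝ) * ((1 + a * j) ^ 2 * b ^ (r - κ + a * j))) ≤
      ofReal (K * exp E * (b ^ r * exp (E * b ^ a))) := by
  refine ⟨4 * exp (2 * exp 1), by positivity, fun a b E κ r ha ha1 hb hE hκ => ?_⟩
  have hb' : 0 < b := by linarith
  set y := E * b ^ a with hy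
  have hy0 : 0 ≤ y := by positivity
  set L := 1 + a * y with hL
  have hL1 : 1 ≤ L := by rw [hL]; nlinarith [mul_nonneg ha hy0]
  have hL0 : 0 < L := by linarith
  set E1 := E * exp (2 * a / L) with hE1
  have hs := (gv_hasSum_pow (b := b) (r := r - κ) (a := a) (e := E1) hb').mul_left (L ^ 2)
  have step1 : ∑' j : ℕ, ofReal (E ^ j / (j.factorial : ℝ) * ((1 + a * j) ^ 2 * b ^ (r - κ + a * j))) ≤
      ofReal (L ^ 2 * (b ^ (r - κ) * exp (E1 * b ^ a))) := by
    rw [← hs.tsum_eq, ofReal_tsum_of_nonneg (fun j => by positivity) hs.summable]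
    refine tsum_le_tsum fun j => ofReal_le_ofReal ?_
    have c1 : 1 + a * j ≤ L * exp (a * j / L) := by
      have := add_one_le_exp (a * j / L)
      calc 1 + a * j ≤ L * (a * j / L + 1) := by
            rw [mul_add, mul_div_cancel₀ _ hL0.ne']; linarith
        _ ≤ _ := by gcongr
    have c2 : exp (2 * a / L) ^ j = exp (a * j / L) ^ 2 := by
      rw [← exp_nat_mul, ← exp_nat_mul]; congr 1; push_cast; ring
    calc _ ≤ E ^ j / (j.factorial : ℝ) * ((L * exp (a * j / L)) ^ 2 * b ^ (r - κ + a * j)) := by gcongr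
      _ = _ := by rw [hE1, mul_pow E, c2]; ring
  refine step1.trans (ofReal_le_ofReal ?_)
  have d1 : E1 * b ^ a ≤ y + 2 * exp 1 := by
    have x0 : 0 ≤ 2 * a / L := by positivity
    have x1 : 2 * a / L ≤ 1 := by rw [div_le_one hL0]; linarith
    have e1 : exp (2 * a / L) ≤ 1 + 2 * a / L * exp 1 := by
      have := add_one_le_exp (-(2 * a / L))
      have h3 : exp (2 * a / L) * exp (-(2 * a / L)) = 1 := by rw [← Real.exp_add]; simp
      have h4 : exp (2 * a / L) ≤ exp 1 := exp_le_exp.2 x1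
      have h5 := Real.exp_pos (2 * a / L)
      nlinarith
    have e2 : y * (2 * a / L) ≤ 2 := by
      rw [← mul_div_assoc, div_le_iff₀ hL0, hL]; nlinarith
    calc E1 * b ^ a = y * exp (2 * a / L) := by rw [hE1, hy]; ring
      _ ≤ y * (1 + 2 * a / L * exp 1) := by gcongr
      _ = y + (y * (2 * a / L)) * exp 1 := by ring
      _ ≤ _ := by gcongr
  have hba : 1 ≤ b ^ a := one_le_rpow hb ha
  have d2 : L ^ 2 ≤ 4 * exp E * b ^ κ := by
    have l1 : L ≤ (1 + E) * b ^ a := by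
      rw [hL, hy]; nlinarith [mul_nonneg hE (zero_le_one.trans hba)]
    have l2 : 1 + E ≤ 2 * exp (E / 2) := by linarith [add_one_le_exp (E / 2)]
    calc L ^ 2 ≤ ((2 * exp (E / 2)) * b ^ a) ^ 2 := by gcongr; exact l1.trans (by gcongr)
      _ = 4 * exp E * b ^ (2 * a) := by
          rw [mul_pow, mul_pow, ← exp_nat_mul, ← rpow_natCast (b ^ a), ← rpow_mul hb'.le]; push_cast
          rw [show (2 * (E / 2)) = E by ring, mul_comm a]; norm_num
      _ ≤ _ := by gcongr
  calc L ^ 2 * (b ^ (r - κ) * exp (E1 * b ^ a)) ≤ (4 * exp E * b ^ κ) * (b ^ (r - κ) * exp (y + 2 * exp 1)) := by gcongr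
    _ = 4 * exp (2 * exp 1) * exp E * ((b ^ κ * b ^ (r - κ)) * exp y) := by rw [Real.exp_add]; ring
    _ = _ := by rw [← rpow_add hb']; ring_nf

theorem gv_growth {a δ : ℝ} (ha : 0 < a) (hδ : 0 < δ) (m : ℝ) : ∃ K > (0:ℝ), ∀ b : ℝ, 1 ≤ b → b ^ m ≤ K * exp (δ * b ^ a) := by
  obtain ⟨N, hN⟩ := exists_nat_ge (m / a)
  refine ⟨N.factorial / δ ^ N, by positivity, fun b hb => ?_⟩
  have hb' : 0 < b := by linarith
  have h := Real.pow_div_factorial_le_exp (δ * b ^ a) (by positivity) N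
  have h2 : b ^ m ≤ (b ^ a) ^ N := by
    rw [← rpow_natCast (b ^ a), ← rpow_mul hb'.le]
    apply rpow_le_rpow_of_exponent_le hb
    rw [div_le_iff₀ ha] at hN; linarith
  calc b ^ m ≤ (b ^ a) ^ N := h2
    _ = N.factorial / δ ^ N * ((δ * b ^ a) ^ N / N.factorial) := by
        rw [mul_pow]; field_simp
    _ ≤ _ := by gcongr

noncomputable def gvY (G : ℝ → ℂ) (τ : ℝ) : ENNReal := ∫⁻ ξ : ℝ, ofReal ((1 + ξ ^ 2) ^ τ) * ‖G ξ‖ₑ ^ 2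

theorem gvY_mono (G : ℝ → ℂ) {τ τ' : ℝ} (h : τ ≤ τ') : gvY G τ ≤ gvY G τ' := by
  unfold gvY
  refine lintegral_mono fun ξ => mul_le_mul' (ofReal_le_ofReal ?_) le_rfl
  exact rpow_le_rpow_of_exponent_le (by nlinarith [sq_nonneg ξ]) h

theorem gv_pow_int {G : ℝ → ℂ} (hk : ∀ k : ℕ, Integrable (fun ξ : ℝ => (ξ : ℂ) ^ k * G ξ)) {β : ℝ} (h0 : 0 ≤ β) :
    Integrable (fun ξ : ℝ => |ξ| ^ β * ‖G ξ‖) := by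
  have hG : Integrable G := by simpa using hk 0
  obtain ⟨n, hn⟩ := exists_nat_ge β
  refine (hG.norm.add (hk n).norm).mono' ?_ (ae_of_all _ fun ξ => ?_)
  · exact AEStronglyMeasurable.mul (by fun_prop) hG.1.norm
  · rw [norm_of_nonneg (by positivity)]
    simp only [Pi.add_apply, norm_mul, norm_pow, norm_real, norm_eq_abs]
    have : |ξ| ^ β ≤ 1 + |ξ| ^ n := by
      rcases le_total |ξ| 1 with h | h
      · have := Real.rpow_le_one (abs_nonneg ξ) h h0
        have : 0 ≤ |ξ| ^ n := by positivity
        linarith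
      · have := rpow_le_rpow_of_exponent_le h hn
        rw [rpow_natCast] at this; linarith
    nlinarith [norm_nonneg (G ξ)]

theorem gv_M_real {G : ℝ → ℂ} {β : ℝ} (hi : Integrable (fun ξ : ℝ => |ξ| ^ β * ‖G ξ‖)) :
    ofReal (∫ ξ : ℝ, |ξ| ^ β * ‖G ξ‖) = ∫⁻ ξ : ℝ, ofReal (|ξ| ^ β) * ‖G ξ‖ₑ := by
  rw [ofReal_integral_eq_lintegral_ofReal hi (ae_of_all _ fun ξ => by positivity)]
  congr 1; ext ξ
  rw [ofReal_mul (by positivity), ofReal_norm]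

theorem gv_Ij {r : ℝ} (hr : 1 / 2 < r) : ∃ K > (0:ℝ), ∃ κ > (0:ℝ), ∀ (G P : ℝ → ℂ) (g p : ℝ → ℝ), GvCore G P g p →
    (∀ k : ℕ, Integrable (fun ξ : ℝ => (ξ : ℂ) ^ k * G ξ)) → (∀ k : ℕ, Integrable (fun ξ : ℝ => (ξ : ℂ) ^ k * P ξ)) →
    ∀ τ : ℝ, r ≤ τ → ∫⁻ v in Ioi 0, ofReal (v ^ τ * gvR p (fun x => g x ^ 2 / 2 - p x) v) ≤
      ofReal (K * (1 + (τ - r)) ^ 2) * gvY G (τ - κ) * gvY G r := by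
  set d := min r 1 - 1 / 2 with hd
  have hd0 : 0 < d := by rw [hd]; have : 1 / 2 < min r 1 := lt_min hr (by norm_num); linarith
  have hd1 : d ≤ 1 / 2 := by rw [hd]; linarith [min_le_right r 1]
  have hd2 : d ≤ r - 1 / 2 := by rw [hd]; linarith [min_le_left r 1]
  obtain ⟨CX, hCX, hX⟩ := gv_X 0 (ρ := 1 / 2 + 3 * d / 4) (lam := 1 + d) (by linarith) (by linarith) (by linarith) (by push_cast; linarith)
  obtain ⟨CM, hCM, hM⟩ := gv_M (θ := d / 4) (by linarith)
  have hpi := pi_pos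
  refine ⟨8 * Real.pi * (r + 1) ^ 2 * CM * CX, by positivity, d / 4, by linarith, fun G P g p H hG hP τ hτ => ?_⟩
  set β := τ - 1 / 2 - d / 2 with hβ
  have hβ0 : 0 ≤ β := by rw [hβ]; linarith
  have hβi := gv_pow_int hG hβ0
  have hb := H.I_bound ⌊β⌋₊ (fun k _ => hG k) (fun k _ => hP k) (τ := τ) (β := β) (by linarith) (Nat.floor_le hβ0)
    (Nat.lt_floor_add_one β).le hβi
  have hx := hX G (fun k _ => hG k) {z : ℝ × ℝ | p z.1 ≠ 0 ∧ g z.2 ^ 2 / 2 - p z.2 ≠ 0} (fun x y hxy => by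
    exact H.flat 0 (fun k _ => hG k) (fun k _ => hP k) hxy.1 hxy.2)
  have hm := hM G β H.Gi.1 hβ0
  rw [← gv_M_real hβi] at hm
  set M := ∫ ξ : ℝ, |ξ| ^ β * ‖G ξ‖ with hMd
  have hM0 : 0 ≤ M := integral_nonneg fun ξ => by positivity
  have hΓ := gv_Gamma_ratio (β := β) (ε := d / 2) hβ0 (by linarith) (by linarith)
  rw [show 2 * β + 2 + 2 * (d / 2) = 2 * τ + 1 by rw [hβ]; ring] at hΓ
  rw [show 2 * τ - 2 * β = 1 + d by rw [hβ]; ring] at hb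
  refine hb.trans ?_
  have e1 : ofReal (2 * Real.pi * Gamma (2 * τ + 1) * (4 ^ (-β) / Gamma (β + 1) ^ 2 * M ^ 2)) ≤
      ofReal (8 * Real.pi * ((r + 1) ^ 2 * (1 + (τ - r)) ^ 2)) * (ofReal CM * gvY G (τ - d / 4)) := by
    calc _ = ofReal (2 * Real.pi * (Gamma (2 * τ + 1) * (4 ^ (-β) / Gamma (β + 1) ^ 2))) * ofReal M ^ 2 := by
          rw [← ofReal_pow hM0, ← ofReal_mul]
          · congr 1; ring
          · have := Gamma_pos_of_pos (s := 2 * τ + 1) (by linarith)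
            positivity
      _ ≤ _ := by
          refine mul_le_mul' (ofReal_le_ofReal ?_) (hm.trans (le_of_eq ?_))
          · have h3 : (β + 1) ^ 2 ≤ ((r + 1) * (1 + (τ - r))) ^ 2 := by
              gcongr; rw [hβ]; nlinarith
            rw [mul_pow] at h3
            nlinarith
          · unfold gvY
            rw [show β + 1 / 2 + d / 4 = τ - d / 4 by rw [hβ]; ring]
  have e2 : ∫⁻ ξ : ℝ, ofReal ((1 + ξ ^ 2) ^ (((0:ℕ):ℝ) + (1 / 2 + 3 * d / 4))) * ‖G ξ‖ₑ ^ 2 ≤ gvY G r :=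
    gvY_mono G (by push_cast; linarith)
  refine (mul_le_mul' e1 (hx.trans (mul_le_mul' le_rfl e2))).trans (le_of_eq ?_)
  rw [show 8 * Real.pi * (r + 1) ^ 2 * CM * CX * (1 + (τ - r)) ^ 2 = (8 * Real.pi * ((r + 1) ^ 2 * (1 + (τ - r)) ^ 2)) * CM * CX by ring,
    ofReal_mul (p := 8 * Real.pi * ((r + 1) ^ 2 * (1 + (τ - r)) ^ 2) * CM) (by positivity), ofReal_mul (p := 8 * Real.pi * ((r + 1) ^ 2 * (1 + (τ - r)) ^ 2)) (by positivity)]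
  ring

theorem gv_I0 {r : ℝ} (hr : 1 / 2 < r) : ∃ K > (0:ℝ), ∀ (G P : ℝ → ℂ) (g p : ℝ → ℝ), GvCore G P g p →
    Integrable (fun ξ : ℝ => (1 + ξ ^ 2) ^ (r / 2) * ‖G ξ‖) → Integrable (fun ξ : ℝ => (1 + ξ ^ 2) ^ (r / 2) * ‖P ξ‖) →
    ∫⁻ v in Ioi 0, ofReal (v ^ r * gvR p (fun x => g x ^ 2 / 2 - p x) v) ≤
      ofReal K * gvY G r * gvY G r := by
  set d := min r 1 - 1 / 2 with hd
  have hd0 : 0 < d := by rw [hd]; have : 1 / 2 < min r 1 := lt_min hr (by norm_num); linarith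
  have hd1 : d ≤ 1 / 2 := by rw [hd]; linarith [min_le_right r 1]
  have hd2 : d ≤ r - 1 / 2 := by rw [hd]; linarith [min_le_left r 1]
  set n := ⌊r / 2⌋₊ with hn
  have hn0 : (n : ℝ) ≤ r / 2 := Nat.floor_le (by linarith)
  have hn1 : r / 2 < n + 1 := Nat.lt_floor_add_one _
  have hnr : (n : ℝ) ≤ r - 1 / 2 - d / 2 := by
    rcases lt_or_ge r 2 with h | h
    · have : n = 0 := by rw [hn, Nat.floor_eq_zero]; linarith
      rw [this]; push_cast; linarith
    · linarith
  -- choice of parameters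
  obtain ⟨β, n', ρ, hβn, hβn1, hβr, hn', hρ1, hρ2, hlam0, hlam, hρr⟩ : ∃ (β : ℝ) (n' : ℕ) (ρ : ℝ), (n : ℝ) ≤ β ∧ β ≤ n + 1 ∧
      β ≤ r - 1 / 2 - d / 2 ∧ n' ≤ n ∧ 1 / 2 < ρ ∧ ρ < 1 ∧ 0 < 2 * r - 2 * β ∧ 2 * r - 2 * β < 2 * (n' + ρ) ∧ n' + ρ ≤ r := by
    rcases le_or_gt (r - 1 / 2 - d / 2) (n + 1) with h | h
    · refine ⟨r - 1 / 2 - d / 2, 0, 1 / 2 + 3 * d / 4, hnr, h, le_rfl, Nat.zero_le _, by linarith, by linarith, by linarith, ?_, ?_⟩ <;> push_cast <;> linarith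
    · refine ⟨n + 1, n, max (3 / 4) ((r - 2 * n) / 2), by linarith, le_rfl, h.le, le_rfl, ?_, ?_, by linarith, ?_, ?_⟩
      · exact lt_of_lt_of_le (by norm_num) (le_max_left _ _)
      · exact max_lt (by norm_num) (by linarith)
      · have := le_max_right (3 / 4) ((r - 2 * n) / 2)
        linarith
      · have : max (3 / 4) ((r - 2 * n) / 2) ≤ 1 := max_le (by norm_num) (by linarith)
        have h0 : (0:ℝ) ≤ n := Nat.cast_nonneg _
        linarith
  obtain ⟨CX, hCX, hX⟩ := gv_X n' (ρ := ρ) (lam := 2 * r - 2 * β) hρ1 hρ2 hlam0 hlam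
  obtain ⟨CM, hCM, hM⟩ := gv_M (θ := d / 4) (by linarith)
  have hpi := pi_pos
  have hβ0 : 0 ≤ β := le_trans (Nat.cast_nonneg _) hβn
  have hΓ1 := Gamma_pos_of_pos (s := 2 * r + 1) (by linarith)
  have hΓ2 := Gamma_pos_of_pos (s := β + 1) (by linarith)
  refine ⟨2 * Real.pi * Gamma (2 * r + 1) * (4 ^ (-β) / Gamma (β + 1) ^ 2) * CM * CX, by positivity, fun G P g p H wG wP => ?_⟩
  have hpow : ∀ {F : ℝ → ℂ}, Integrable F → Integrable (fun ξ : ℝ => (1 + ξ ^ 2) ^ (r / 2) * ‖F ξ‖) → ∀ k : ℕ, (k : ℝ) ≤ r →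
      Integrable (fun ξ : ℝ => (ξ : ℂ) ^ k * F ξ) := by
    intro F hF hw k hk
    refine hw.mono' (AEStronglyMeasurable.mul (Continuous.aestronglyMeasurable (by fun_prop)) hF.1) (ae_of_all _ fun ξ => ?_)
    rw [norm_mul, norm_pow, norm_real, norm_eq_abs]
    gcongr
    have hb : 1 ≤ 1 + ξ ^ 2 := by nlinarith [sq_nonneg ξ]
    calc |ξ| ^ k ≤ ((1 + ξ ^ 2) ^ (1 / 2 : ℝ)) ^ k := by
          gcongr
          rw [← sqrt_eq_rpow]
          apply abs_le_sqrt; linarith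
      _ = (1 + ξ ^ 2) ^ ((k : ℝ) / 2) := by rw [← rpow_natCast, ← rpow_mul (by linarith)]; ring_nf
      _ ≤ _ := rpow_le_rpow_of_exponent_le hb (by linarith)
  have hG : ∀ k < n + 1, Integrable (fun ξ : ℝ => (ξ : ℂ) ^ k * G ξ) := fun k hk => hpow H.Gi wG k (by
    have : (k:ℝ) ≤ n := by exact_mod_cast Nat.lt_succ_iff.1 hk
    linarith)
  have hP : ∀ k < 2 * n + 1, Integrable (fun ξ : ℝ => (ξ : ℂ) ^ k * P ξ) := fun k hk => hpow H.Pi wP k (by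
    have : (k:ℝ) ≤ 2 * n := by exact_mod_cast Nat.lt_succ_iff.1 hk
    linarith)
  by_cases htop : gvY G r = ⊤
  · have hne : gvY G r ≠ 0 := by rw [htop]; simp
    rw [htop, mul_assoc]; simp [mul_top, hCX, hCM]
    rw [mul_top]
    · exact le_top
    · simp only [ne_eq, ofReal_eq_zero, not_le]; positivity
  have hm := hM G β H.Gi.1 hβ0
  have hY : ∫⁻ ξ : ℝ, ofReal ((1 + ξ ^ 2) ^ (β + 1 / 2 + d / 4)) * ‖G ξ‖ₑ ^ 2 ≤ gvY G r := gvY_mono G (by linarith)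
  have hm' := hm.trans (mul_le_mul' le_rfl hY)
  have hβi : Integrable (fun ξ : ℝ => |ξ| ^ β * ‖G ξ‖) := by
    refine ⟨AEStronglyMeasurable.mul (by fun_prop) H.Gi.1.norm, ?_⟩
    rw [hasFiniteIntegral_iff_enorm]
    have e : ∀ ξ : ℝ, ‖|ξ| ^ β * ‖G ξ‖‖ₑ = ofReal (|ξ| ^ β) * ‖G ξ‖ₑ := by
      intro ξ
      rw [← ofReal_norm, norm_of_nonneg (by positivity), ofReal_mul (by positivity), ofReal_norm]
    simp only [e]
    have : (∫⁻ ξ : ℝ, ofReal (|ξ| ^ β) * ‖G ξ‖ₑ) ^ 2 < ⊤ :=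
      hm'.trans_lt (mul_lt_top ofReal_lt_top (lt_top_iff_ne_top.2 htop))
    exact (ENNReal.pow_lt_top_iff.1 this).resolve_right (by norm_num)
  rw [← gv_M_real hβi] at hm'
  have hb := H.I_bound n hG hP (τ := r) (β := β) (by linarith) hβn hβn1 hβi
  have hx := hX G (fun k hk => hG k (by omega)) {z : ℝ × ℝ | p z.1 ≠ 0 ∧ g z.2 ^ 2 / 2 - p z.2 ≠ 0} (fun x y hxy => by
    exact H.flat n' (fun k hk => hG k (by omega)) (fun k hk => hP k (by omega)) hxy.1 hxy.2)
  set M := ∫ ξ : ℝ, |ξ| ^ β * ‖G ξ‖ with hMd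
  have hM0 : 0 ≤ M := integral_nonneg fun ξ => by positivity
  refine hb.trans ?_
  have e1 : ofReal (2 * Real.pi * Gamma (2 * r + 1) * (4 ^ (-β) / Gamma (β + 1) ^ 2 * M ^ 2)) ≤
      ofReal (2 * Real.pi * Gamma (2 * r + 1) * (4 ^ (-β) / Gamma (β + 1) ^ 2)) * (ofReal CM * gvY G r) := by
    rw [← mul_assoc, ofReal_mul (p := 2 * Real.pi * Gamma (2 * r + 1) * (4 ^ (-β) / Gamma (β + 1) ^ 2)) (by positivity), ofReal_pow hM0]
    gcongr
  have e2 : ∫⁻ ξ : ℝ, ofReal ((1 + ξ ^ 2) ^ ((n':ℝ) + ρ)) * ‖G ξ‖ₑ ^ 2 ≤ gvY G r := gvY_mono G hρr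
  refine (mul_le_mul' e1 (hx.trans (mul_le_mul' le_rfl e2))).trans (le_of_eq ?_)
  rw [ofReal_mul (p := 2 * Real.pi * Gamma (2 * r + 1) * (4 ^ (-β) / Gamma (β + 1) ^ 2) * CM) (by positivity),
    ofReal_mul (p := 2 * Real.pi * Gamma (2 * r + 1) * (4 ^ (-β) / Gamma (β + 1) ^ 2)) (by positivity)]
  ring

noncomputable def gvW (r a e : ℝ) (G : ℝ → ℂ) : ENNReal :=
  ∫⁻ ξ : ℝ, ofReal ((1 + ξ ^ 2) ^ r * exp (e * (1 + ξ ^ 2) ^ a)) * ‖G ξ‖ₑ ^ 2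

theorem gv_sq_ofReal {w : ℝ} (hw : 0 ≤ w) (z : ℂ) : ofReal w * ‖z‖ₑ ^ 2 = ofReal (w * ‖z‖ ^ 2) := by
  rw [ofReal_mul hw, ofReal_pow (norm_nonneg _), ofReal_norm]

theorem gvW_mono {r a e e' : ℝ} (h : e ≤ e') (G : ℝ → ℂ) : gvW r a e G ≤ gvW r a e' G := by
  unfold gvW
  refine lintegral_mono fun ξ => mul_le_mul' (ofReal_le_ofReal ?_) le_rfl
  gcongr

theorem gvY_le_W {r a e : ℝ} (ha : 0 ≤ a) (he : 0 ≤ e) (G : ℝ → ℂ) :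
    gvY G r ≤ ofReal (exp (-e)) * gvW r a e G := by
  unfold gvW gvY
  rw [← lintegral_const_mul' _ _ ofReal_ne_top]
  refine lintegral_mono fun ξ => ?_
  rw [← mul_assoc, ← ofReal_mul (by positivity)]
  refine mul_le_mul' (ofReal_le_ofReal ?_) le_rfl
  have h1 : 1 ≤ (1 + ξ ^ 2) ^ a := one_le_rpow (by nlinarith [sq_nonneg ξ]) ha
  have h2 : 1 ≤ exp (-e) * exp (e * (1 + ξ ^ 2) ^ a) := by
    rw [← Real.exp_add]; apply one_le_exp; nlinarith
  calc (1 + ξ ^ 2) ^ r = (1 + ξ ^ 2) ^ r * 1 := by ring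
    _ ≤ (1 + ξ ^ 2) ^ r * (exp (-e) * exp (e * (1 + ξ ^ 2) ^ a)) := by gcongr
    _ = _ := by ring

/-- summation step -/
theorem gv_sum_lint {r a κ e K : ℝ} {G : ℝ → ℂ} (hG : AEStronglyMeasurable G) {c : ℕ → ℝ} (hc : ∀ j, 0 ≤ c j) (hK : 0 ≤ K)
    (h : ∀ b : ℝ, 1 ≤ b → ∑' j : ℕ, ofReal (c j / (j.factorial : ℝ) * ((1 + a * j) ^ 2 * b ^ (r - κ + a * j))) ≤
      ofReal (K * (b ^ r * exp (e * b ^ a)))) :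
    ∑' j : ℕ, ofReal (c j / (j.factorial : ℝ) * (1 + a * j) ^ 2) * gvY G (r - κ + a * j) ≤ ofReal K * gvW r a e G := by
  unfold gvY gvW
  have : ∀ j : ℕ, ofReal (c j / (j.factorial : ℝ) * (1 + a * j) ^ 2) * (∫⁻ ξ : ℝ, ofReal ((1 + ξ ^ 2) ^ (r - κ + a * j)) * ‖G ξ‖ₑ ^ 2) =
      ∫⁻ ξ : ℝ, ofReal (c j / (j.factorial : ℝ) * ((1 + a * j) ^ 2 * (1 + ξ ^ 2) ^ (r - κ + a * j))) * ‖G ξ‖ₑ ^ 2 := by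
    intro j
    rw [← lintegral_const_mul' _ _ ofReal_ne_top]
    congr 1; ext ξ
    rw [← mul_assoc, ← ofReal_mul (by have := hc j; positivity), mul_assoc]
  simp only [this]
  have hmeas : ∀ j : ℕ, AEMeasurable (fun ξ : ℝ => ofReal (c j / (j.factorial : ℝ) * ((1 + a * j) ^ 2 * (1 + ξ ^ 2) ^ (r - κ + a * j))) * ‖G ξ‖ₑ ^ 2) :=
    fun j => AEMeasurable.mul (by fun_prop) (hG.enorm.pow_const 2)
  rw [← lintegral_tsum hmeas, ← lintegral_const_mul' _ _ ofReal_ne_top]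
  refine lintegral_mono fun ξ => ?_
  simp only
  rw [ENNReal.tsum_mul_right, ← mul_assoc, ← ofReal_mul hK]
  exact mul_le_mul' (h _ (by nlinarith [sq_nonneg ξ])) le_rfl

theorem gv_weight_pow {a δ r : ℝ} (ha : 0 < a) (hδ : 0 < δ) (hr : 0 ≤ r) {F : ℝ → ℂ} (hF : Integrable F)
    (hw : Integrable (fun ξ : ℝ => (1 + ξ ^ 2) ^ (r / 2) * exp (δ * (1 + ξ ^ 2) ^ a) * ‖F ξ‖)) (k : ℕ) :
    Integrable (fun ξ : ℝ => (ξ : ℂ) ^ k * F ξ) := by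
  obtain ⟨K, hK, h⟩ := gv_growth ha hδ k
  refine (hw.const_mul K).mono' (AEStronglyMeasurable.mul (Continuous.aestronglyMeasurable (by fun_prop)) hF.1) (ae_of_all _ fun ξ => ?_)
  rw [norm_mul, norm_pow, norm_real, norm_eq_abs]
  have hb : 1 ≤ 1 + ξ ^ 2 := by nlinarith [sq_nonneg ξ]
  have h1 : |ξ| ^ k ≤ (1 + ξ ^ 2) ^ (k:ℝ) := by
    rw [rpow_natCast]
    gcongr
    nlinarith [sq_abs ξ, sq_nonneg (|ξ| - 1), abs_nonneg ξ]
  have h2 : 1 ≤ (1 + ξ ^ 2) ^ (r / 2) := one_le_rpow hb (by linarith)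
  have h3 := h _ hb
  calc |ξ| ^ k * ‖F ξ‖ ≤ (1 * (K * exp (δ * (1 + ξ ^ 2) ^ a))) * ‖F ξ‖ := by
        gcongr; linarith
    _ ≤ ((1 + ξ ^ 2) ^ (r / 2) * (K * exp (δ * (1 + ξ ^ 2) ^ a))) * ‖F ξ‖ := by gcongr
    _ = _ := by ring

theorem gv_core_zero {r : ℝ} (hr : 1 / 2 < r) : ∃ K > (0:ℝ), ∀ (a : ℝ) (G P : ℝ → ℂ) (g p : ℝ → ℝ), GvCore G P g p →
    Integrable (fun ξ : ℝ => (1 + ξ ^ 2) ^ (r / 2) * ‖G ξ‖) → Integrable (fun ξ : ℝ => (1 + ξ ^ 2) ^ (r / 2) * ‖P ξ‖) →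
    gvW r a 0 P ≤ gvW r a 0 (FT (fun x => ((g x ^ 2 / 2 : ℝ) : ℂ))) + ofReal K * gvW r a 0 G ^ 2 := by
  obtain ⟨K, hK, h⟩ := gv_I0 hr
  refine ⟨K, hK, fun a G P g p H wG wP => ?_⟩
  have h := h G P g p H wG wP
  have eW : ∀ F, gvW r a 0 F = gvY F r := fun F => by unfold gvW gvY; simp
  rw [eW, eW, eW]
  set q := FT (fun x => ((g x ^ 2 / 2 : ℝ) : ℂ)) with hq
  by_cases t1 : gvY q r = ⊤
  · rw [t1]; simp
  by_cases t2 : gvY G r = ⊤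
  · rw [t2]; simp [mul_top, hK]
  have qc : Continuous q := gv_FT_cont H.qi'.ofReal
  have hres := H.res
  set R := gvR p (fun x => g x ^ 2 / 2 - p x) with hR
  have hR0 : ∀ v ∈ Ioi (0:ℝ), 0 ≤ v ^ r * R v := fun v hv => mul_nonneg (rpow_nonneg (le_of_lt hv) _) (hres.R0 v hv)
  have hRm : AEStronglyMeasurable (fun v => v ^ r * R v) (volume.restrict (Ioi 0)) := by
    refine AEStronglyMeasurable.mul (by fun_prop) ?_
    have : AntitoneOn R (Ioi 0) := fun v hv w _ hvw => hres.Ra v w hv hvw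
    exact (aemeasurable_restrict_of_antitoneOn measurableSet_Ioi this).aestronglyMeasurable
  have hI : IntegrableOn (fun v => v ^ r * R v) (Ioi 0) := by
    refine ⟨hRm, ?_⟩
    rw [hasFiniteIntegral_iff_ofReal ((ae_restrict_iff' measurableSet_Ioi).2 (ae_of_all _ hR0))]
    refine h.trans_lt ?_
    exact mul_lt_top (mul_lt_top ofReal_lt_top (lt_top_iff_ne_top.2 t2)) (lt_top_iff_ne_top.2 t2)
  have hQ : Integrable (fun ξ : ℝ => (1 + ξ ^ 2) ^ r * ‖q ξ‖ ^ 2) := by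
    refine ⟨AEStronglyMeasurable.mul (Measurable.aestronglyMeasurable (by fun_prop)) (qc.norm.pow 2).aestronglyMeasurable, ?_⟩
    rw [hasFiniteIntegral_iff_ofReal (ae_of_all _ fun ξ => by positivity)]
    refine lt_of_eq_of_lt ?_ (lt_top_iff_ne_top.2 t1)
    unfold gvY
    congr 1; ext ξ; rw [gv_sq_ofReal (by positivity)]
  obtain ⟨hA, hAe⟩ := gv_resolvent hres (by linarith : 0 ≤ r) hI hQ
  set I := ∫ v in Ioi 0, v ^ r * R v with hId
  have hI0 : 0 ≤ I := setIntegral_nonneg measurableSet_Ioi hR0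
  calc gvY P r ≤ ∫⁻ ξ : ℝ, ofReal ((1 + ξ ^ 2) ^ r * (‖P ξ‖ ^ 2 + ‖FT (fun x => ((g x ^ 2 / 2 - p x : ℝ) : ℂ)) ξ‖ ^ 2)) := by
        unfold gvY
        refine lintegral_mono fun ξ => ?_
        rw [gv_sq_ofReal (by positivity)]
        apply ofReal_le_ofReal
        gcongr
        have : 0 ≤ ‖FT (fun x => ((g x ^ 2 / 2 - p x : ℝ) : ℂ)) ξ‖ ^ 2 := by positivity
        linarith
    _ = ofReal (∫ ξ : ℝ, (1 + ξ ^ 2) ^ r * (‖P ξ‖ ^ 2 + ‖FT (fun x => ((g x ^ 2 / 2 - p x : ℝ) : ℂ)) ξ‖ ^ 2)) := by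
        rw [ofReal_integral_eq_lintegral_ofReal hA (ae_of_all _ fun ξ => by positivity)]
    _ ≤ ofReal ((∫ ξ : ℝ, (1 + ξ ^ 2) ^ r * ‖q ξ‖ ^ 2) + I) := by
        apply ofReal_le_ofReal
        rw [hAe]
        gcongr
        refine mul_le_of_le_one_left hI0 ?_
        have h1 : 2 / Real.pi ≤ 1 := by rw [div_le_one pi_pos]; linarith [pi_gt_three]
        have h2 : 0 < 2 / Real.pi := by have := pi_pos; positivity
        nlinarith [sin_le_one (Real.pi * r)]
    _ ≤ ofReal (∫ ξ : ℝ, (1 + ξ ^ 2) ^ r * ‖q ξ‖ ^ 2) + ofReal I := ofReal_add_le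
    _ ≤ _ := by
        gcongr
        · rw [ofReal_integral_eq_lintegral_ofReal hQ (ae_of_all _ fun ξ => by positivity)]
          unfold gvY
          refine lintegral_mono fun ξ => ?_
          rw [gv_sq_ofReal (by positivity)]
        · rw [hId, ofReal_integral_eq_lintegral_ofReal hI ((ae_restrict_iff' measurableSet_Ioi).2 (ae_of_all _ hR0))]
          rw [sq, ← mul_assoc]; exact h

theorem gv_core_step {r a E e c K K1 κ : ℝ} {G P : ℝ → ℂ} {g p : ℝ → ℝ} (H : GvCore G P g p) (hr : 1 / 2 < r)
    (ha : 0 < a) (ha1 : a ≤ 1 / 2) (he : 0 ≤ e) (heE : e < E) (hK : 0 ≤ K) (hK1 : 0 ≤ K1) (hκ : 0 ≤ κ)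
    (hJ : ∀ τ : ℝ, r ≤ τ → ∫⁻ v in Ioi 0, ofReal (v ^ τ * gvR p (fun x => g x ^ 2 / 2 - p x) v) ≤
      ofReal (K1 * (1 + (τ - r)) ^ 2) * gvY G (τ - κ) * gvY G r)
    (tW : gvW r a E G ≠ ⊤) (tQ : gvW r a E (FT (fun x => ((g x ^ 2 / 2 : ℝ) : ℂ))) ≠ ⊤)
    (hc0 : 0 ≤ c) (hc : e * cos (Real.pi * a) ≤ c)
    (h : ∀ b : ℝ, 1 ≤ b → ∑' j : ℕ, ofReal (c ^ j / (j.factorial : ℝ) * ((1 + a * j) ^ 2 * b ^ (r - κ + a * j))) ≤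
      ofReal (K * (b ^ r * exp (E * b ^ a)))) :
    gvW r a e P ≤ gvW r a E (FT (fun x => ((g x ^ 2 / 2 : ℝ) : ℂ))) + ofReal K1 * ofReal K * gvW r a E G * gvY G r := by
  have hE : 0 < E := he.trans_lt heE
  set q := FT (fun x => ((g x ^ 2 / 2 : ℝ) : ℂ)) with hq
  have qc : Continuous q := gv_FT_cont H.qi'.ofReal
  have hres := H.res
  set R := gvR p (fun x => g x ^ 2 / 2 - p x) with hR
  have tY : gvY G r ≠ ⊤ := ((gvY_le_W ha.le hE.le G).trans_lt (mul_lt_top ofReal_lt_top (lt_top_iff_ne_top.2 tW))).ne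
  have hcos : 0 ≤ cos (Real.pi * a) := cos_nonneg_of_mem_Icc ⟨by nlinarith [pi_pos], by nlinarith [pi_pos]⟩
  have hR0 : ∀ τ : ℝ, ∀ v ∈ Ioi (0:ℝ), 0 ≤ v ^ τ * R v := fun τ v hv => mul_nonneg (rpow_nonneg (le_of_lt hv) _) (hres.R0 v hv)
  have hR0' : ∀ τ : ℝ, 0 ≤ᵐ[volume.restrict (Ioi 0)] fun v => v ^ τ * R v := fun τ =>
    (ae_restrict_iff' measurableSet_Ioi).2 (ae_of_all _ (hR0 τ))
  have hRm : ∀ τ : ℝ, AEStronglyMeasurable (fun v => v ^ τ * R v) (volume.restrict (Ioi 0)) := by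
    intro τ
    refine AEStronglyMeasurable.mul (by fun_prop) ?_
    have : AntitoneOn R (Ioi 0) := fun v hv w _ hvw => hres.Ra v w hv hvw
    exact (aemeasurable_restrict_of_antitoneOn measurableSet_Ioi this).aestronglyMeasurable
  set L : ℕ → ENNReal := fun j => ∫⁻ v in Ioi 0, ofReal (v ^ (r + a * j) * R v) with hL
  have sumL : ∀ (c K : ℝ), 0 ≤ c → 0 ≤ K → (∀ b : ℝ, 1 ≤ b → ∑' j : ℕ, ofReal (c ^ j / (j.factorial : ℝ) * ((1 + a * j) ^ 2 * b ^ (r - κ + a * j))) ≤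
      ofReal (K * (b ^ r * exp (E * b ^ a)))) →
      ∑' j : ℕ, ofReal (c ^ j / (j.factorial : ℝ)) * L j ≤ ofReal K1 * ofReal K * gvW r a E G * gvY G r := by
    intro c K hc hK h
    have hs := gv_sum_lint (G := G) H.Gi.1 (c := fun j => c ^ j) (fun j => by positivity) hK h
    calc _ ≤ ∑' j : ℕ, (ofReal K1 * gvY G r) * (ofReal (c ^ j / (j.factorial : ℝ) * (1 + a * j) ^ 2) * gvY G (r - κ + a * j)) := by
          refine tsum_le_tsum fun j => ?_
          have := hJ (r + a * j) (by have : 0 ≤ a * j := by positivity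
                                     linarith)
          refine (mul_le_mul' le_rfl this).trans (le_of_eq ?_)
          rw [show r + a * j - r = a * j by ring, show r + a * j - κ = r - κ + a * j by ring, ofReal_mul hK1,
            ofReal_mul (p := c ^ j / (j.factorial : ℝ)) (by positivity)]
          ring
      _ = (ofReal K1 * gvY G r) * ∑' j : ℕ, (ofReal (c ^ j / (j.factorial : ℝ) * (1 + a * j) ^ 2) * gvY G (r - κ + a * j)) := ENNReal.tsum_mul_left
      _ ≤ (ofReal K1 * gvY G r) * (ofReal K * gvW r a E G) := by gcongr
      _ = _ := by ring
  have fin : ∀ K : ℝ, ofReal K1 * ofReal K * gvW r a E G * gvY G r < ⊤ := fun K =>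
    mul_lt_top (mul_lt_top (mul_lt_top ofReal_lt_top ofReal_lt_top) (lt_top_iff_ne_top.2 tW)) (lt_top_iff_ne_top.2 tY)
  have Lfin : ∀ j, L j ≠ ⊤ := by
    obtain ⟨K2, hK2, h2⟩ := gv_ptA (θ := 1 / 2) (by norm_num) (by norm_num)
    have := sumL (1 / 2 * E) K2 (by positivity) hK2.le (fun b hb => h2 a b E κ r ha.le (by linarith) hb hE.le hκ)
    have h3 := ENNReal.ne_top_of_tsum_ne_top (this.trans_lt (fin K2)).ne
    intro j hj
    refine h3 j ?_
    rw [hj, mul_top]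
    simp only [ne_eq, ofReal_eq_zero, not_le]; positivity
  have hI : ∀ j : ℕ, IntegrableOn (fun v => v ^ (r + a * j) * R v) (Ioi 0) := by
    intro j
    refine ⟨hRm _, ?_⟩
    rw [hasFiniteIntegral_iff_ofReal (hR0' _)]
    exact lt_top_iff_ne_top.2 (Lfin j)
  have LT : ∀ j : ℕ, L j = ofReal (∫ v in Ioi 0, v ^ (r + a * j) * R v) := by
    intro j
    rw [ofReal_integral_eq_lintegral_ofReal (hI j) (hR0' _)]
  have T0 : ∀ j : ℕ, 0 ≤ ∫ v in Ioi 0, v ^ (r + a * j) * R v := fun j => setIntegral_nonneg measurableSet_Ioi (hR0 _)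
  have summ : ∀ c : ℝ, 0 ≤ c → ∑' j : ℕ, ofReal (c ^ j / (j.factorial : ℝ)) * L j ≠ ⊤ →
      Summable fun j : ℕ => c ^ j / (j.factorial : ℝ) * ∫ v in Ioi 0, v ^ (r + a * j) * R v := by
    intro c hc ht
    have := ENNReal.summable_toReal ht
    refine this.congr fun j => ?_
    rw [LT, ← ofReal_mul (by positivity), toReal_ofReal (mul_nonneg (by positivity) (T0 j))]
  have hS : Summable fun j : ℕ => e ^ j / (j.factorial : ℝ) * ∫ v in Ioi 0, v ^ (r + a * j) * R v := by
    apply summ e he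
    obtain ⟨K2, hK2, h2⟩ := gv_ptA (θ := e / E) (by positivity) (by rw [div_lt_one hE]; exact heE)
    have := sumL (e / E * E) K2 (by positivity) hK2.le (fun b hb => h2 a b E κ r ha.le (by linarith) hb hE.le hκ)
    rw [div_mul_cancel₀ _ hE.ne'] at this
    exact (this.trans_lt (fin K2)).ne
  have hm : Measurable (fun ξ : ℝ => (1 + ξ ^ 2) ^ r * exp (e * (1 + ξ ^ 2) ^ a)) := by fun_prop
  have hQ : Integrable (fun ξ : ℝ => (1 + ξ ^ 2) ^ r * exp (e * (1 + ξ ^ 2) ^ a) * ‖q ξ‖ ^ 2) := by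
    refine ⟨AEStronglyMeasurable.mul hm.aestronglyMeasurable (qc.norm.pow 2).aestronglyMeasurable, ?_⟩
    rw [hasFiniteIntegral_iff_ofReal (ae_of_all _ fun ξ => by positivity)]
    refine lt_of_eq_of_lt ?_ ((gvW_mono heE.le q).trans_lt (lt_top_iff_ne_top.2 tQ))
    unfold gvW
    congr 1; ext ξ; rw [gv_sq_ofReal (by positivity)]
  have main := gv_expsum hres (r := r) (a := a) (e := e) (by linarith) ha.le ha1 he hI hS hQ
  calc gvW r a e P ≤ _ := ?_
    _ ≤ _ := main
    _ ≤ _ := ofReal_add_le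
    _ ≤ _ := ?_
  · unfold gvW
    refine lintegral_mono fun ξ => ?_
    rw [gv_sq_ofReal (by positivity)]
    apply ofReal_le_ofReal
    gcongr
    have : 0 ≤ ‖FT (fun x => ((g x ^ 2 / 2 - p x : ℝ) : ℂ)) ξ‖ ^ 2 := by positivity
    linarith
  · refine add_le_add ?_ ?_
    · rw [ofReal_integral_eq_lintegral_ofReal hQ (ae_of_all _ fun ξ => by positivity)]
      refine le_trans (le_of_eq ?_) (gvW_mono heE.le q)
      unfold gvW
      congr 1; ext ξ; rw [gv_sq_ofReal (by positivity)]
    · refine le_trans ?_ (sumL c K hc0 hK h)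
      have hle : ∀ j : ℕ, (e * cos (Real.pi * a)) ^ j / (j.factorial : ℝ) * (∫ v in Ioi 0, v ^ (r + a * j) * R v) ≤
          e ^ j / (j.factorial : ℝ) * ∫ v in Ioi 0, v ^ (r + a * j) * R v := by
        intro j
        have := T0 j
        gcongr
        exact mul_le_of_le_one_right he (cos_le_one _)
      have h0 : ∀ j : ℕ, 0 ≤ (e * cos (Real.pi * a)) ^ j / (j.factorial : ℝ) * (∫ v in Ioi 0, v ^ (r + a * j) * R v) := by
        intro j
        have := T0 j
        positivity
      rw [ofReal_tsum_of_nonneg h0 (hS.of_nonneg_of_le h0 hle)]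
      refine tsum_le_tsum fun j => ?_
      rw [LT, ← ofReal_mul (by positivity)]
      apply ofReal_le_ofReal
      have := T0 j
      gcongr

theorem gv_core_pos {r : ℝ} (hr : 1 / 2 < r) : ∃ K > (0:ℝ), ∀ a δ : ℝ, 0 < a → a ≤ 1 / 2 → 0 < δ →
    ∀ (G P : ℝ → ℂ) (g p : ℝ → ℝ), GvCore G P g p →
    Integrable (fun ξ : ℝ => (1 + ξ ^ 2) ^ (r / 2) * exp (δ * (1 + ξ ^ 2) ^ a) * ‖G ξ‖) →
    Integrable (fun ξ : ℝ => (1 + ξ ^ 2) ^ (r / 2) * exp (δ * (1 + ξ ^ 2) ^ a) * ‖P ξ‖) →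
    gvW r a (2 * δ) P ≤ gvW r a (2 * δ) (FT (fun x => ((g x ^ 2 / 2 : ℝ) : ℂ))) + ofReal K * gvW r a (2 * δ) G ^ 2 := by
  obtain ⟨K1, hK1, κ, hκ, hJ⟩ := gv_Ij hr
  set κ0 := min (κ / 2) (1 / 4) with hκ0
  have k1 : 0 < κ0 := lt_min (by linarith) (by norm_num)
  have k2 : κ0 ≤ 1 / 4 := min_le_right _ _
  have k3 : κ0 ≤ κ / 2 := min_le_left _ _
  have hpi := pi_pos
  have c1 : 0 ≤ cos (Real.pi * κ0) := cos_nonneg_of_mem_Icc ⟨by nlinarith, by nlinarith⟩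
  have c2 : cos (Real.pi * κ0) < 1 := by
    rw [← Real.cos_zero]
    exact Real.cos_lt_cos_of_nonneg_of_le_pi le_rfl (by nlinarith) (by positivity)
  obtain ⟨KA, hKA, hA⟩ := gv_ptA c1 c2
  obtain ⟨KB, hKB, hB⟩ := gv_ptB
  refine ⟨K1 * KA + K1 * KB, by positivity, fun a δ ha ha1 hδ G P g p H wG wP => ?_⟩
  set E := 2 * δ with hE
  have hE0 : 0 < E := by positivity
  have hJ' := hJ G P g p H (gv_weight_pow ha hδ (by linarith) H.Gi wG) (gv_weight_pow ha hδ (by linarith) H.Pi wP)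
  have hKp : 0 < K1 * KA + K1 * KB := by positivity
  by_cases tQ : gvW r a E (FT (fun x => ((g x ^ 2 / 2 : ℝ) : ℂ))) = ⊤
  · rw [tQ]; simp
  by_cases tW : gvW r a E G = ⊤
  · rw [tW]; simp [mul_top, hKp]
  have step : ∀ e : ℝ, 0 ≤ e → e < E → gvW r a e P ≤ gvW r a E (FT (fun x => ((g x ^ 2 / 2 : ℝ) : ℂ))) + ofReal (K1 * KA + K1 * KB) * gvW r a E G ^ 2 := by
    intro e he heE
    rw [ofReal_add (by positivity) (by positivity)]
    rcases le_or_gt κ0 a with h | h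
    · have hcc : cos (Real.pi * a) ≤ cos (Real.pi * κ0) :=
        Real.cos_le_cos_of_nonneg_of_le_pi (by positivity) (by nlinarith) (by gcongr)
      refine (gv_core_step H hr ha ha1 he heE hKA.le hK1.le hκ.le hJ' tW tQ (c := cos (Real.pi * κ0) * E) (by positivity) ?_
        (fun b hb => hA a b E κ r ha.le (by linarith) hb hE0.le hκ.le)).trans ?_
      · rw [mul_comm]; exact mul_le_mul hcc heE.le he c1
      · refine add_le_add le_rfl ?_
        have hY : gvY G r ≤ gvW r a E G := by
          refine (gvY_le_W ha.le hE0.le G).trans ?_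
          refine mul_le_of_le_one_left zero_le ?_
          rw [ofReal_le_one, exp_le_one_iff]; linarith
        rw [← ofReal_mul hK1.le, sq, mul_assoc]
        refine mul_le_mul' le_self_add ?_
        gcongr
    · refine (gv_core_step H hr ha ha1 he heE (K := KB * exp E) (by positivity) hK1.le hκ.le hJ' tW tQ (c := E) hE0.le ?_
        (fun b hb => hB a b E κ r ha.le ha1 hb hE0.le (by linarith))).trans ?_
      · exact (mul_le_of_le_one_right he (cos_le_one _)).trans heE.le
      · refine add_le_add le_rfl ?_
        calc ofReal K1 * ofReal (KB * exp E) * gvW r a E G * gvY G r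
            ≤ ofReal K1 * ofReal (KB * exp E) * gvW r a E G * (ofReal (exp (-E)) * gvW r a E G) := by
              gcongr; exact gvY_le_W ha.le hE0.le G
          _ = (ofReal K1 * ofReal (KB * exp E) * ofReal (exp (-E))) * gvW r a E G ^ 2 := by ring
          _ = ofReal (K1 * KB) * gvW r a E G ^ 2 := by
              rw [← ofReal_mul hK1.le, ← ofReal_mul (by positivity)]
              congr 2
              rw [mul_assoc, mul_assoc, ← Real.exp_add]; simp
          _ ≤ _ := mul_le_mul' le_add_self le_rfl
  have PC : Continuous P := by rw [H.Pe]; exact gv_FT_cont H.pi.ofReal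
  have ht1 : Tendsto (fun n : ℕ => E * (1 - 1 / ((n:ℝ) + 1))) atTop (nhds E) := by
    have := (tendsto_const_nhds (x := (1:ℝ))).sub (tendsto_one_div_add_atTop_nhds_zero_nat (𝕜 := ℝ))
    simpa using this.const_mul E
  unfold gvW at step ⊢
  refine gv_fatou (f := fun n ξ => ofReal ((1 + ξ ^ 2) ^ r * exp ((E * (1 - 1 / ((n:ℝ) + 1))) * (1 + ξ ^ 2) ^ a)) * ‖P ξ‖ₑ ^ 2) ?_ ?_
    (fun n => step _ ?_ ?_)
  · intro n
    exact AEMeasurable.mul (by fun_prop) (PC.enorm.aemeasurable.pow_const 2)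
  · refine ae_of_all _ fun ξ => ?_
    refine ENNReal.Tendsto.mul_const ?_ (Or.inr (by finiteness))
    refine tendsto_ofReal (Tendsto.const_mul _ ?_)
    exact (Real.continuous_exp.tendsto _).comp (ht1.mul_const _)
  · have : 1 / ((n:ℝ) + 1) ≤ 1 := by rw [div_le_one (by positivity)]; linarith [n.cast_nonneg (α := ℝ)]
    exact mul_nonneg hE0.le (by linarith)
  · have : 0 < 1 / ((n:ℝ) + 1) := by positivity
    nlinarith

theorem gv_core {r : ℝ} (hr : 1 / 2 < r) : ∃ K > (0:ℝ), ∀ a δ : ℝ, 0 < a → a ≤ 1 / 2 → 0 ≤ δ →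
    ∀ (G P : ℝ → ℂ) (g p : ℝ → ℝ), GvCore G P g p →
    Integrable (fun ξ : ℝ => (1 + ξ ^ 2) ^ (r / 2) * exp (δ * (1 + ξ ^ 2) ^ a) * ‖G ξ‖) →
    Integrable (fun ξ : ℝ => (1 + ξ ^ 2) ^ (r / 2) * exp (δ * (1 + ξ ^ 2) ^ a) * ‖P ξ‖) →
    gvW r a (2 * δ) P ≤ gvW r a (2 * δ) (FT (fun x => ((g x ^ 2 / 2 : ℝ) : ℂ))) + ofReal K * gvW r a (2 * δ) G ^ 2 := by
  obtain ⟨K1, hK1, h1⟩ := gv_core_pos hr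
  obtain ⟨K2, hK2, h2⟩ := gv_core_zero hr
  refine ⟨K1 + K2, by positivity, fun a δ ha ha1 hδ G P g p H wG wP => ?_⟩
  rcases eq_or_lt_of_le hδ with rfl | hδ
  · simp only [zero_mul, Real.exp_zero, mul_one, mul_zero] at wG wP ⊢
    refine (h2 a G P g p H wG wP).trans ?_
    gcongr; linarith
  · refine (h1 a δ ha ha1 hδ G P g p H wG wP).trans ?_
    gcongr; linarith

noncomputable def gvConv (Φ Ψ : ℝ → ℂ) (ξ : ℝ) : ℂ := (1 / (2 * Real.pi) : ℂ) * ∫ η : ℝ, Φ η * Ψ (ξ - η)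

theorem gvConv_int {Φ Ψ : ℝ → ℂ} (h1 : Integrable Φ) (h2 : Integrable Ψ) : Integrable (gvConv Φ Ψ) := by
  have := Integrable.integrable_convolution (ContinuousLinearMap.mul ℝ ℂ) h1 h2
  exact this.const_mul _

theorem gvConv_FTinv {Φ Ψ : ℝ → ℂ} (h1 : Integrable Φ) (h2 : Integrable Ψ) (x : ℝ) :
    FTinv (gvConv Φ Ψ) x = FTinv Φ x * FTinv Ψ x := by
  have k1 : ∀ {F : ℝ → ℂ}, Integrable F → Integrable (fun ξ : ℝ => Complex.exp (Complex.I * ξ * x) * F ξ) := fun {F} hF =>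
    hF.bdd_mul (c := 1) (Continuous.aestronglyMeasurable (by fun_prop)) (ae_of_all _ fun ξ => (gv_norm_exp ξ x).le)
  have h := integral_convolution (ContinuousLinearMap.mul ℝ ℂ) (k1 h1) (k1 h2) (μ := volume) (ν := volume)
  simp only [convolution_def, ContinuousLinearMap.mul_apply'] at h
  unfold FTinv gvConv
  rw [show (1 / (2 * Real.pi) : ℂ) * (∫ ξ : ℝ, Complex.exp (Complex.I * ξ * x) * Φ ξ) * ((1 / (2 * Real.pi) : ℂ) * ∫ ξ : ℝ, Complex.exp (Complex.I * ξ * x) * Ψ ξ) = (1 / (2 * Real.pi) : ℂ) * ((1 / (2 * Real.pi) : ℂ) * ((∫ ξ : ℝ, Complex.exp (Complex.I * ξ * x) * Φ ξ) * (∫ ξ : ℝ, Complex.exp (Complex.I * ξ * x) * Ψ ξ))) by ring, ← h]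
  congr 1
  rw [← integral_const_mul]
  congr 1
  ext ξ
  rw [← integral_const_mul, ← integral_const_mul, ← integral_const_mul]
  congr 1
  ext η
  have : Complex.exp (Complex.I * ξ * x) = Complex.exp (Complex.I * η * x) * Complex.exp (Complex.I * ((ξ - η : ℝ):ℂ) * x) := by
    rw [← exp_add]; push_cast; ring_nf
  rw [this]; ring

theorem gv_young {f g : ℝ → ENNReal} (hf : AEMeasurable f) (hg : AEMeasurable g) :
    ∫⁻ ξ : ℝ, (∫⁻ η : ℝ, f η * g (ξ - η)) ^ 2 ≤ (∫⁻ η, f η) ^ 2 * ∫⁻ η, g η ^ 2 := by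
  have hg' : ∀ ξ : ℝ, AEMeasurable (fun η => g (ξ - η)) := fun ξ =>
    hg.comp_quasiMeasurePreserving (quasiMeasurePreserving_sub_left volume ξ)
  have hsq : ∀ t : ENNReal, (t ^ (1 / 2 : ℝ)) ^ 2 = t := fun t => by
    rw [← ENNReal.rpow_natCast, ← ENNReal.rpow_mul]; norm_num
  have h1 : ∀ ξ : ℝ, (∫⁻ η : ℝ, f η * g (ξ - η)) ^ 2 ≤ (∫⁻ η, f η) * ∫⁻ η, f η * g (ξ - η) ^ 2 := by
    intro ξ
    have := gv_cs (μ := volume) (f := fun η => f η ^ (1 / 2 : ℝ)) (g := fun η => f η ^ (1 / 2 : ℝ) * g (ξ - η))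
      (hf.pow_const _) ((hf.pow_const _).mul (hg' ξ))
    simp only [mul_pow, hsq] at this
    refine le_trans (le_of_eq ?_) this
    congr 2; ext η
    rw [← mul_assoc, ← sq, hsq]
  have q0 : AEMeasurable (fun p : ℝ × ℝ => g (p.1 - p.2)) (volume.prod volume) :=
    hg.comp_quasiMeasurePreserving (quasiMeasurePreserving_sub_of_right_invariant volume volume)
  have q1 : AEMeasurable (fun p : ℝ × ℝ => f p.2) (volume.prod volume) :=
    hf.comp_quasiMeasurePreserving Measure.quasiMeasurePreserving_snd
  have q2 : AEMeasurable (Function.uncurry fun ξ η : ℝ => f η * g (ξ - η) ^ 2) (volume.prod volume) := q1.mul (q0.pow_const 2)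
  have q3 : AEMeasurable (fun ξ : ℝ => ∫⁻ η, f η * g (ξ - η) ^ 2) := q2.lintegral_prod_right'
  calc ∫⁻ ξ : ℝ, (∫⁻ η : ℝ, f η * g (ξ - η)) ^ 2 ≤ ∫⁻ ξ : ℝ, (∫⁻ η, f η) * ∫⁻ η, f η * g (ξ - η) ^ 2 := lintegral_mono h1
    _ = (∫⁻ η, f η) * ∫⁻ ξ : ℝ, ∫⁻ η, f η * g (ξ - η) ^ 2 := lintegral_const_mul'' _ q3
    _ = (∫⁻ η, f η) * ∫⁻ η : ℝ, ∫⁻ ξ, f η * g (ξ - η) ^ 2 := by rw [lintegral_lintegral_swap q2]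
    _ = (∫⁻ η, f η) * ∫⁻ η : ℝ, f η * ∫⁻ ξ, g ξ ^ 2 := by
        congr 2; ext η
        have q4 : AEMeasurable (fun ξ => g (ξ - η) ^ 2) := (hg.comp_quasiMeasurePreserving (measurePreserving_sub_right volume η).quasiMeasurePreserving).pow_const 2
        rw [lintegral_const_mul'' _ q4]
        rw [lintegral_sub_right_eq_self (fun ξ => g ξ ^ 2) η]
    _ = _ := by rw [lintegral_mul_const'' _ hf]; ring

theorem gv_young' {f g : ℝ → ENNReal} (hf : AEMeasurable f) (hg : AEMeasurable g) :
    ∫⁻ ξ : ℝ, (∫⁻ η : ℝ, f η * g (ξ - η)) ^ 2 ≤ (∫⁻ η, f η ^ 2) * (∫⁻ η, g η) ^ 2 := by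
  rw [mul_comm]
  refine le_trans (le_of_eq ?_) (gv_young hg hf)
  congr 1; ext ξ; congr 1
  rw [← lintegral_sub_left_eq_self _ ξ]
  congr 1; ext η; rw [sub_sub_cancel, mul_comm]

theorem gv_sub_b {a : ℝ} (ha : 0 ≤ a) (ha' : a ≤ 1 / 2) (η ζ : ℝ) : (1 + (η + ζ) ^ 2) ^ a ≤ (1 + η ^ 2) ^ a + (1 + ζ ^ 2) ^ a := by
  have e : ∀ t : ℝ, (1 + t ^ 2) ^ a = (sqrt (1 + t ^ 2)) ^ (2 * a) := fun t => by
    rw [sqrt_eq_rpow, ← rpow_mul (by positivity)]; congr 1; ring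
  rw [e, e, e]
  refine le_trans ?_ (Real.rpow_add_le_add_rpow (sqrt_nonneg _) (sqrt_nonneg _) (by linarith) (by linarith))
  refine rpow_le_rpow (sqrt_nonneg _) ?_ (by linarith)
  rw [sqrt_le_left (by positivity)]
  have h1 := sq_sqrt (show 0 ≤ 1 + η ^ 2 by positivity)
  have h2 := sq_sqrt (show 0 ≤ 1 + ζ ^ 2 by positivity)
  have h3 : η * ζ ≤ sqrt (1 + η ^ 2) * sqrt (1 + ζ ^ 2) := by
    rw [← Real.sqrt_mul (by positivity)]
    apply le_sqrt_of_sq_le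
    nlinarith [sq_nonneg η, sq_nonneg ζ]
  nlinarith

theorem gv_w_sub {a r δ : ℝ} (ha : 0 ≤ a) (ha' : a ≤ 1 / 2) (hr : 0 ≤ r) (hδ : 0 ≤ δ) (η ζ : ℝ) :
    (1 + (η + ζ) ^ 2) ^ (r / 2) * exp (δ * (1 + (η + ζ) ^ 2) ^ a) ≤
    2 ^ r * ((1 + η ^ 2) ^ (r / 2) * exp (δ * (1 + η ^ 2) ^ a) * exp (δ * (1 + ζ ^ 2) ^ a) +
      exp (δ * (1 + η ^ 2) ^ a) * ((1 + ζ ^ 2) ^ (r / 2) * exp (δ * (1 + ζ ^ 2) ^ a))) := by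
  have h1 : exp (δ * (1 + (η + ζ) ^ 2) ^ a) ≤ exp (δ * (1 + η ^ 2) ^ a) * exp (δ * (1 + ζ ^ 2) ^ a) := by
    rw [← Real.exp_add, exp_le_exp, ← mul_add]
    exact mul_le_mul_of_nonneg_left (gv_sub_b ha ha' η ζ) hδ
  have h4 : ∀ x : ℝ, 0 ≤ x → (4 * x) ^ (r / 2) = 2 ^ r * x ^ (r / 2) := fun x hx => by
    rw [mul_rpow (by norm_num) hx, show (4:ℝ) = 2 ^ (2:ℝ) by norm_num, ← rpow_mul (by norm_num)]
    congr 2; ring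
  have h2 : (1 + (η + ζ) ^ 2) ^ (r / 2) ≤ 2 ^ r * ((1 + η ^ 2) ^ (r / 2) + (1 + ζ ^ 2) ^ (r / 2)) := by
    have p1 : 0 ≤ 2 ^ r * (1 + η ^ 2) ^ (r / 2) := by positivity
    have p2 : 0 ≤ 2 ^ r * (1 + ζ ^ 2) ^ (r / 2) := by positivity
    rcases le_total (η ^ 2) (ζ ^ 2) with h | h
    · have := rpow_le_rpow (z := r / 2) (by positivity) (show 1 + (η + ζ) ^ 2 ≤ 4 * (1 + ζ ^ 2) by nlinarith [sq_nonneg (η - ζ)]) (by linarith)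
      rw [h4 _ (by positivity)] at this
      linarith
    · have := rpow_le_rpow (z := r / 2) (by positivity) (show 1 + (η + ζ) ^ 2 ≤ 4 * (1 + η ^ 2) by nlinarith [sq_nonneg (η - ζ)]) (by linarith)
      rw [h4 _ (by positivity)] at this
      linarith
  refine (mul_le_mul h2 h1 (by positivity) (by positivity)).trans (le_of_eq ?_)
  ring

theorem gv_b_int {r : ℝ} (hr : 1 / 2 < r) : Integrable (fun ξ : ℝ => (1 + ξ ^ 2) ^ (-r)) := by
  have := integrable_rpow_neg_one_add_norm_sq (E := ℝ) (μ := volume) (r := 2 * r) (by simp; linarith)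
  refine this.congr (ae_of_all _ fun ξ => ?_)
  simp only [norm_eq_abs, sq_abs]
  congr 1; ring

/-- weighted L1 bound -/
theorem gv_l1 {r κ : ℝ} (hr : 1 / 2 < r - κ) : ∃ K > (0:ℝ), ∀ (a δ : ℝ) (Φ : ℝ → ℂ), AEStronglyMeasurable Φ →
    (∫⁻ ξ : ℝ, ofReal ((1 + ξ ^ 2) ^ (κ / 2) * exp (δ * (1 + ξ ^ 2) ^ a)) * ‖Φ ξ‖ₑ) ^ 2 ≤ ofReal K * gvW r a (2 * δ) Φ := by
  have hi := gv_b_int hr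
  refine ⟨(∫ ξ : ℝ, (1 + ξ ^ 2) ^ (-(r - κ))) + 1, ?_, fun a δ Φ hΦ => ?_⟩
  · have : 0 ≤ ∫ ξ : ℝ, (1 + ξ ^ 2) ^ (-(r - κ)) := integral_nonneg fun ξ => by positivity
    linarith
  have hm : AEMeasurable (fun ξ : ℝ => ofReal ((1 + ξ ^ 2) ^ (r / 2) * exp (δ * (1 + ξ ^ 2) ^ a)) * ‖Φ ξ‖ₑ) :=
    AEMeasurable.mul (by fun_prop) hΦ.enorm
  have h := gv_cs (μ := volume) (f := fun ξ : ℝ => ofReal ((1 + ξ ^ 2) ^ (-(r - κ) / 2))) (by fun_prop) hm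
  have e1 : ∀ ξ : ℝ, ofReal ((1 + ξ ^ 2) ^ (-(r - κ) / 2)) * (ofReal ((1 + ξ ^ 2) ^ (r / 2) * exp (δ * (1 + ξ ^ 2) ^ a)) * ‖Φ ξ‖ₑ) =
      ofReal ((1 + ξ ^ 2) ^ (κ / 2) * exp (δ * (1 + ξ ^ 2) ^ a)) * ‖Φ ξ‖ₑ := by
    intro ξ
    rw [← mul_assoc, ← ofReal_mul (by positivity), ← mul_assoc, ← rpow_add (by positivity)]
    congr 4; ring
  have e2 : ∀ ξ : ℝ, ofReal ((1 + ξ ^ 2) ^ (-(r - κ) / 2)) ^ 2 = ofReal ((1 + ξ ^ 2) ^ (-(r - κ))) := by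
    intro ξ
    rw [← ofReal_pow (by positivity), ← rpow_natCast, ← rpow_mul (by positivity)]
    congr 2; push_cast; ring
  have e3 : ∀ ξ : ℝ, (ofReal ((1 + ξ ^ 2) ^ (r / 2) * exp (δ * (1 + ξ ^ 2) ^ a)) * ‖Φ ξ‖ₑ) ^ 2 =
      ofReal ((1 + ξ ^ 2) ^ r * exp (2 * δ * (1 + ξ ^ 2) ^ a)) * ‖Φ ξ‖ₑ ^ 2 := by
    intro ξ
    rw [mul_pow, ← ofReal_pow (by positivity), mul_pow, ← rpow_natCast, ← rpow_mul (by positivity), ← exp_nat_mul]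
    congr 3
    · congr 1; push_cast; ring
    · congr 1; push_cast; ring
  simp only [e1, e2, e3] at h
  refine h.trans (mul_le_mul' ?_ le_rfl)
  rw [← ofReal_integral_eq_lintegral_ofReal hi (ae_of_all _ fun ξ => by positivity)]
  exact ofReal_le_ofReal (by linarith)

theorem gv_w_sq {a r δ : ℝ} (Φ : ℝ → ℂ) (ξ : ℝ) : (ofReal ((1 + ξ ^ 2) ^ (r / 2) * exp (δ * (1 + ξ ^ 2) ^ a)) * ‖Φ ξ‖ₑ) ^ 2 =
      ofReal ((1 + ξ ^ 2) ^ r * exp (2 * δ * (1 + ξ ^ 2) ^ a)) * ‖Φ ξ‖ₑ ^ 2 := by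
    rw [mul_pow, ← ofReal_pow (by positivity), mul_pow, ← rpow_natCast, ← rpow_mul (by positivity), ← exp_nat_mul]
    congr 3
    · congr 1; push_cast; ring
    · congr 1; push_cast; ring

theorem gv_alg {r : ℝ} (hr : 1 / 2 < r) : ∃ K > (0:ℝ), ∀ a δ : ℝ, 0 < a → a ≤ 1 / 2 → 0 ≤ δ → ∀ Φ Ψ : ℝ → ℂ,
    AEStronglyMeasurable Φ → AEStronglyMeasurable Ψ →
    gvW r a (2 * δ) (gvConv Φ Ψ) ≤ ofReal K * (gvW r a (2 * δ) Φ * gvW r a (2 * δ) Ψ) := by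
  obtain ⟨K, hK, h1⟩ := gv_l1 (r := r) (κ := 0) (by linarith)
  refine ⟨4 * (2 ^ r) ^ 2 * K, by positivity, fun a δ ha ha' hδ Φ Ψ hΦ hΨ => ?_⟩
  have kΦ := h1 a δ Φ hΦ
  have kΨ := h1 a δ Ψ hΨ
  simp only [zero_div, rpow_zero, one_mul] at kΦ kΨ
  set w : ℝ → ENNReal := fun ξ => ofReal ((1 + ξ ^ 2) ^ (r / 2) * exp (δ * (1 + ξ ^ 2) ^ a)) with hw
  set E : ℝ → ENNReal := fun ξ => ofReal (exp (δ * (1 + ξ ^ 2) ^ a)) with hE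
  have wm : AEMeasurable w := by rw [hw]; fun_prop
  have Em : AEMeasurable E := by rw [hE]; fun_prop
  have eW : ∀ F : ℝ → ℂ, gvW r a (2 * δ) F = ∫⁻ ξ, (w ξ * ‖F ξ‖ₑ) ^ 2 := fun F => by
    unfold gvW; congr 1; ext ξ; rw [hw]; simp only; rw [gv_w_sq]
  have wsub : ∀ η ξ : ℝ, w ξ ≤ ofReal (2 ^ r) * (w η * E (ξ - η) + E η * w (ξ - η)) := by
    intro η ξ
    have := gv_w_sub ha.le ha' (by linarith : 0 ≤ r) hδ η (ξ - η)
    rw [add_sub_cancel] at this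
    refine (ofReal_le_ofReal this).trans (le_of_eq ?_)
    rw [ofReal_mul (by positivity), ofReal_add (by positivity) (by positivity), ofReal_mul (by positivity), ofReal_mul (p := exp _) (by positivity)]
  have wne : ∀ ξ, w ξ ≠ ⊤ := fun ξ => ofReal_ne_top
  have mm : ∀ ξ : ℝ, AEMeasurable (fun η => (w η * ‖Φ η‖ₑ) * (E (ξ - η) * ‖Ψ (ξ - η)‖ₑ)) := fun ξ =>
    (wm.mul hΦ.enorm).mul ((Em.mul hΨ.enorm).comp_quasiMeasurePreserving (quasiMeasurePreserving_sub_left volume ξ))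
  have pt : ∀ ξ, w ξ * ‖gvConv Φ Ψ ξ‖ₑ ≤ ofReal (2 ^ r) * ((∫⁻ η : ℝ, (w η * ‖Φ η‖ₑ) * (E (ξ - η) * ‖Ψ (ξ - η)‖ₑ)) +
      ∫⁻ η : ℝ, (E η * ‖Φ η‖ₑ) * (w (ξ - η) * ‖Ψ (ξ - η)‖ₑ)) := by
    intro ξ
    have c1 : ‖gvConv Φ Ψ ξ‖ₑ ≤ ∫⁻ η : ℝ, ‖Φ η‖ₑ * ‖Ψ (ξ - η)‖ₑ := by
      unfold gvConv
      rw [enorm_mul]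
      have hp : ‖(1 / (2 * Real.pi) : ℂ)‖ₑ ≤ 1 := by
        rw [← ofReal_norm, show (1 / (2 * Real.pi) : ℂ) = ((1 / (2 * Real.pi) : ℝ) : ℂ) by push_cast; ring, norm_real, norm_of_nonneg (by have := pi_pos; positivity)]
        apply ofReal_le_one.2
        rw [div_le_one (by have := pi_pos; positivity)]
        linarith [pi_gt_three]
      refine (mul_le_mul' hp (enorm_integral_le_lintegral_enorm _)).trans (le_of_eq ?_)
      rw [one_mul]; congr 1; ext η; rw [enorm_mul]
    calc w ξ * ‖gvConv Φ Ψ ξ‖ₑ ≤ w ξ * ∫⁻ η : ℝ, ‖Φ η‖ₑ * ‖Ψ (ξ - η)‖ₑ := mul_le_mul' le_rfl c1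
      _ = ∫⁻ η : ℝ, w ξ * (‖Φ η‖ₑ * ‖Ψ (ξ - η)‖ₑ) := (lintegral_const_mul' _ _ (wne ξ)).symm
      _ ≤ ∫⁻ η : ℝ, ofReal (2 ^ r) * ((w η * ‖Φ η‖ₑ) * (E (ξ - η) * ‖Ψ (ξ - η)‖ₑ) + (E η * ‖Φ η‖ₑ) * (w (ξ - η) * ‖Ψ (ξ - η)‖ₑ)) := by
          refine lintegral_mono fun η => (mul_le_mul' (wsub η ξ) le_rfl).trans (le_of_eq ?_)
          ring
      _ = _ := by
          rw [lintegral_const_mul' _ _ ofReal_ne_top, lintegral_add_left' (mm ξ)]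
  have y1 := gv_young' (wm.mul hΦ.enorm) (Em.mul hΨ.enorm)
  have y2 := gv_young (Em.mul hΦ.enorm) (wm.mul hΨ.enorm)
  simp only [Pi.mul_apply] at y1 y2
  have am : AEMeasurable (fun ξ : ℝ => ∫⁻ η : ℝ, (w η * ‖Φ η‖ₑ) * (E (ξ - η) * ‖Ψ (ξ - η)‖ₑ)) := by
    have q0 : AEMeasurable (fun p : ℝ × ℝ => E (p.1 - p.2) * ‖Ψ (p.1 - p.2)‖ₑ) (volume.prod volume) :=
      (Em.mul hΨ.enorm).comp_quasiMeasurePreserving (quasiMeasurePreserving_sub_of_right_invariant volume volume)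
    have q1 : AEMeasurable (fun p : ℝ × ℝ => w p.2 * ‖Φ p.2‖ₑ) (volume.prod volume) :=
      (wm.mul hΦ.enorm).comp_quasiMeasurePreserving Measure.quasiMeasurePreserving_snd
    exact (q1.mul q0).lintegral_prod_right'
  rw [eW, eW, eW]
  rw [eW] at kΦ kΨ
  set NΦ := ∫⁻ ξ, (w ξ * ‖Φ ξ‖ₑ) ^ 2 with hNΦ
  set NΨ := ∫⁻ ξ, (w ξ * ‖Ψ ξ‖ₑ) ^ 2 with hNΨ
  calc ∫⁻ ξ, (w ξ * ‖gvConv Φ Ψ ξ‖ₑ) ^ 2 ≤ ∫⁻ ξ : ℝ, ofReal ((2 ^ r) ^ 2) * (2 * ((∫⁻ η : ℝ, (w η * ‖Φ η‖ₑ) * (E (ξ - η) * ‖Ψ (ξ - η)‖ₑ)) ^ 2 +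
      (∫⁻ η : ℝ, (E η * ‖Φ η‖ₑ) * (w (ξ - η) * ‖Ψ (ξ - η)‖ₑ)) ^ 2)) := by
        refine lintegral_mono fun ξ => (pow_le_pow_left₀ zero_le (pt ξ) 2).trans ?_
        rw [mul_pow, ← ofReal_pow (by positivity)]
        exact mul_le_mul' le_rfl (gv_sq_add _ _)
    _ = ofReal ((2 ^ r) ^ 2) * (2 * ((∫⁻ ξ : ℝ, (∫⁻ η : ℝ, (w η * ‖Φ η‖ₑ) * (E (ξ - η) * ‖Ψ (ξ - η)‖ₑ)) ^ 2) +
      ∫⁻ ξ : ℝ, (∫⁻ η : ℝ, (E η * ‖Φ η‖ₑ) * (w (ξ - η) * ‖Ψ (ξ - η)‖ₑ)) ^ 2)) := by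
        rw [lintegral_const_mul' _ _ ofReal_ne_top, lintegral_const_mul' _ _ (by simp), lintegral_add_left' (am.pow_const 2)]
    _ ≤ ofReal ((2 ^ r) ^ 2) * (2 * (NΦ * (ofReal K * NΨ) + (ofReal K * NΦ) * NΨ)) := by
        refine mul_le_mul' le_rfl (mul_le_mul' le_rfl (add_le_add (y1.trans ?_) (y2.trans ?_)))
        · exact mul_le_mul' le_rfl kΨ
        · exact mul_le_mul' kΦ le_rfl
    _ = _ := by
        rw [show 4 * (2 ^ r) ^ 2 * K = (2 ^ r) ^ 2 * (4 * K) by ring, ofReal_mul (by positivity), ofReal_mul (p := 4) (by norm_num), show ofReal 4 = 4 by simp]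
        ring

theorem gv_deriv_choice {v w w' : ℝ → ℂ} (hw : ∀ x, HasDerivAt w (w' x) x) (h : v =ᵐ[volume] w) (x : ℝ) :
    deriv v x = 0 ∨ deriv v x = w' x := by
  by_cases hd : DifferentiableAt ℝ v x
  · right
    by_contra hne
    have h1 := hd.hasDerivAt.sub (hw x)
    have h2 := h1.eventually_ne (c := 0) (sub_ne_zero.2 hne)
    rw [eventually_nhdsWithin_iff] at h2
    obtain ⟨O, hO, hOo, hxO⟩ := mem_nhds_iff.1 h2
    have h3 : volume O ≤ volume ({z | ¬ v z = w z} ∪ {x}) := by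
      refine measure_mono fun z hz => ?_
      by_cases hzx : z = x
      · right; exact hzx
      · left
        have := hO hz hzx
        intro hvw
        apply this
        simp [hvw]
    have h4 : volume ({z | ¬ v z = w z} ∪ {x}) = 0 := measure_union_null (ae_iff.1 h) (by simp)
    have h5 := hOo.measure_pos volume ⟨x, hxO⟩
    rw [h4] at h3
    exact absurd h5 (not_lt.2 h3)
  · left; exact deriv_zero_of_not_differentiableAt hd

theorem gv_real {h : ℝ → ℂ} {u : ℝ → ℝ} (hc : Continuous h) (he : h =ᵐ[volume] fun x => ((u x : ℝ) : ℂ)) (x : ℝ) :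
    (((h x).re : ℝ) : ℂ) = h x := by
  have h1 : (fun x => (h x).im) =ᵐ[volume] fun _ => (0:ℝ) := by
    filter_upwards [he] with y hy; rw [hy]; simp
  have h2 := (Continuous.ae_eq_iff_eq volume (by fun_prop) (by fun_prop)).1 h1
  have h3 := congrFun h2 x
  apply Complex.ext
  · simp
  · simp at h3 ⊢; exact h3.symm

theorem gv_int_of_W {r κ a δ : ℝ} (hr : 1 / 2 < r - κ) {Φ : ℝ → ℂ} (hm : AEStronglyMeasurable Φ) (hW : gvW r a (2 * δ) Φ < ⊤) :
    Integrable (fun ξ : ℝ => (1 + ξ ^ 2) ^ (κ / 2) * exp (δ * (1 + ξ ^ 2) ^ a) * ‖Φ ξ‖) := by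
  obtain ⟨K, hK, h⟩ := gv_l1 hr
  have h := h a δ Φ hm
  refine ⟨AEStronglyMeasurable.mul (Measurable.aestronglyMeasurable (by fun_prop)) hm.norm, ?_⟩
  rw [hasFiniteIntegral_iff_ofReal (ae_of_all _ fun ξ => by positivity)]
  have h2 := h.trans_lt (mul_lt_top ofReal_lt_top hW)
  have h3 : (∫⁻ ξ : ℝ, ofReal ((1 + ξ ^ 2) ^ (κ / 2) * exp (δ * (1 + ξ ^ 2) ^ a)) * ‖Φ ξ‖ₑ) < ⊤ := by
    by_contra hcon
    rw [not_lt, top_le_iff] at hcon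
    rw [hcon] at h2
    simp at h2
  refine lt_of_eq_of_lt ?_ h3
  congr 1; ext ξ
  rw [ofReal_mul (by positivity), ofReal_norm]

theorem gv_int_pow_of_w {κ a δ : ℝ} (n : ℕ) (hκ : (n:ℝ) ≤ κ) (hδ : 0 ≤ δ) {Φ : ℝ → ℂ} (hm : AEStronglyMeasurable Φ)
    (h : Integrable (fun ξ : ℝ => (1 + ξ ^ 2) ^ (κ / 2) * exp (δ * (1 + ξ ^ 2) ^ a) * ‖Φ ξ‖)) :
    Integrable (fun ξ : ℝ => (ξ : ℂ) ^ n * Φ ξ) := by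
  refine h.mono' (AEStronglyMeasurable.mul (Continuous.aestronglyMeasurable (by fun_prop)) hm) (ae_of_all _ fun ξ => ?_)
  rw [norm_mul, norm_pow, norm_real, norm_eq_abs]
  have hb : 1 ≤ 1 + ξ ^ 2 := by nlinarith [sq_nonneg ξ]
  have h1 : |ξ| ^ n ≤ (1 + ξ ^ 2) ^ (κ / 2) := by
    calc |ξ| ^ n ≤ ((1 + ξ ^ 2) ^ (1 / 2 : ℝ)) ^ n := by
          gcongr
          rw [← sqrt_eq_rpow]
          apply abs_le_sqrt; linarith
      _ = (1 + ξ ^ 2) ^ ((n:ℝ) / 2) := by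
          rw [← rpow_natCast, ← rpow_mul (by positivity)]; congr 1; ring
      _ ≤ _ := rpow_le_rpow_of_exponent_le hb (by linarith)
  have h2 : 1 ≤ exp (δ * (1 + ξ ^ 2) ^ a) := one_le_exp (by positivity)
  calc |ξ| ^ n * ‖Φ ξ‖ = |ξ| ^ n * 1 * ‖Φ ξ‖ := by ring
    _ ≤ _ := by gcongr

theorem gv_FTinv_add {Φ Ψ : ℝ → ℂ} (h1 : Integrable Φ) (h2 : Integrable Ψ) (x : ℝ) :
    FTinv (fun ξ => Φ ξ + Ψ ξ) x = FTinv Φ x + FTinv Ψ x := by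
  have k1 : ∀ {F : ℝ → ℂ}, Integrable F → Integrable (fun ξ : ℝ => Complex.exp (Complex.I * ξ * x) * F ξ) := fun {F} hF =>
    hF.bdd_mul (c := 1) (Continuous.aestronglyMeasurable (by fun_prop)) (ae_of_all _ fun ξ => (gv_norm_exp ξ x).le)
  unfold FTinv
  rw [← mul_add, ← integral_add (k1 h1) (k1 h2)]
  simp only [mul_add]

theorem gv_FT_add {Φ Ψ : ℝ → ℂ} (h1 : Integrable Φ) (h2 : Integrable Ψ) (x : ℝ) :
    FT (fun ξ => Φ ξ + Ψ ξ) x = FT Φ x + FT Ψ x := by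
  have k1 : ∀ {F : ℝ → ℂ}, Integrable F → Integrable (fun ξ : ℝ => Complex.exp (-Complex.I * x * ξ) * F ξ) := fun {F} hF =>
    hF.bdd_mul (c := 1) (Continuous.aestronglyMeasurable (by fun_prop)) (ae_of_all _ fun ξ => (gv_norm_exp' x ξ).le)
  unfold FT
  rw [← integral_add (k1 h1) (k1 h2)]
  simp only [mul_add]

theorem gv_FTinv_const (c : ℂ) (Φ : ℝ → ℂ) (x : ℝ) : FTinv (fun ξ => c * Φ ξ) x = c * FTinv Φ x := by
  unfold FTinv
  rw [mul_left_comm c]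
  congr 1
  rw [← integral_const_mul]
  congr 1; ext ξ; ring

theorem gv_FT_congr {f g : ℝ → ℂ} (h : f =ᵐ[volume] g) : FT f = FT g := by
  ext ξ; unfold FT
  apply integral_congr_ae
  filter_upwards [h] with x hx; rw [hx]

theorem gvW_congr {r a e : ℝ} {f g : ℝ → ℂ} (h : f =ᵐ[volume] g) : gvW r a e f = gvW r a e g := by
  unfold gvW
  apply lintegral_congr_ae
  filter_upwards [h] with x hx; rw [hx]

theorem gvW_add {r a e : ℝ} {Φ Ψ : ℝ → ℂ} (h1 : AEStronglyMeasurable Φ) :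
    gvW r a e (fun ξ => Φ ξ + Ψ ξ) ≤ 2 * (gvW r a e Φ + gvW r a e Ψ) := by
  unfold gvW
  have q : AEMeasurable (fun ξ : ℝ => ofReal ((1 + ξ ^ 2) ^ r * exp (e * (1 + ξ ^ 2) ^ a)) * ‖Φ ξ‖ₑ ^ 2) :=
    AEMeasurable.mul (by fun_prop) (h1.enorm.pow_const 2)
  rw [← lintegral_add_left' q, ← lintegral_const_mul' _ _ (by simp)]
  refine lintegral_mono fun ξ => ?_
  calc _ ≤ _ * (2 * (‖Φ ξ‖ₑ ^ 2 + ‖Ψ ξ‖ₑ ^ 2)) := mul_le_mul' le_rfl ((pow_le_pow_left₀ zero_le (enorm_add_le _ _) 2).trans (gv_sq_add _ _))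
    _ = _ := by ring

theorem gvW_const (r a e : ℝ) (c : ℂ) (Φ : ℝ → ℂ) : gvW r a e (fun ξ => c * Φ ξ) = ofReal (‖c‖ ^ 2) * gvW r a e Φ := by
  unfold gvW
  rw [← lintegral_const_mul' _ _ ofReal_ne_top]
  congr 1; ext ξ
  rw [enorm_mul, mul_pow, ofReal_pow (norm_nonneg _), ofReal_norm]; ring

theorem gvW_mono_r {r r' a e : ℝ} (h : r ≤ r') (G : ℝ → ℂ) : gvW r a e G ≤ gvW r' a e G := by
  unfold gvW
  refine lintegral_mono fun ξ => mul_le_mul' (ofReal_le_ofReal ?_) le_rfl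
  have := rpow_le_rpow_of_exponent_le (show 1 ≤ 1 + ξ ^ 2 by nlinarith [sq_nonneg ξ]) h
  gcongr

theorem gv_F0 {s : ℝ} (hs : 3 / 2 < s) (c1 c2 c3 c4 : ℂ) : ∃ C > (0:ℝ), ∀ a δ : ℝ, 0 < a → a ≤ 1 / 2 → 0 ≤ δ → ∀ v : ℝ → ℂ, Integrable v →
    gvW s a (2 * δ) (FT v) < ⊤ → ∃ F : ℝ → ℂ, Integrable F ∧ Integrable (fun x => c1 * v x + c2 * v x ^ 2 + (c3 * v x ^ 3 + c4 * v x ^ 4)) ∧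
      FT (fun x => c1 * v x + c2 * v x ^ 2 + (c3 * v x ^ 3 + c4 * v x ^ 4)) =ᵐ[volume] F ∧
      gvW s a (2 * δ) F ≤ ofReal C * (gvW s a (2 * δ) (FT v) + gvW s a (2 * δ) (FT v) ^ 2 + gvW s a (2 * δ) (FT v) ^ 3 + gvW s a (2 * δ) (FT v) ^ 4) := by
  obtain ⟨K, hK, halg⟩ := gv_alg (r := s) (by linarith)
  set A := ‖c1‖ ^ 2 + ‖c2‖ ^ 2 * K + ‖c3‖ ^ 2 * K ^ 2 + ‖c4‖ ^ 2 * K ^ 3 with hA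
  refine ⟨4 * A + 1, by positivity, fun a δ ha ha' hδ v hv hX => ?_⟩
  have Uc := gv_FT_cont hv
  set U := FT v with hU
  set X := gvW s a (2 * δ) U with hXd
  have w0 := gv_int_of_W (κ := 0) (r := s) (by linarith) Uc.aestronglyMeasurable hX
  have Ui : Integrable U := by simpa using gv_int_pow_of_w 0 (by simp) hδ Uc.aestronglyMeasurable w0
  have hinv : FTinv U =ᵐ[volume] v := gv_inv_ae hv Ui
  set U2 := gvConv U U with hU2
  set U3 := gvConv U2 U with hU3
  set U4 := gvConv U3 U with hU4
  have i2 : Integrable U2 := gvConv_int Ui Ui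
  have i3 : Integrable U3 := gvConv_int i2 Ui
  have i4 : Integrable U4 := gvConv_int i3 Ui
  have b2 : gvW s a (2 * δ) U2 ≤ ofReal K * X ^ 2 := by rw [sq]; exact halg a δ ha ha' hδ U U Ui.1 Ui.1
  have b3 : gvW s a (2 * δ) U3 ≤ ofReal K ^ 2 * X ^ 3 := by
    refine (halg a δ ha ha' hδ U2 U i2.1 Ui.1).trans ?_
    refine (mul_le_mul' le_rfl (mul_le_mul' b2 le_rfl)).trans (le_of_eq ?_)
    ring
  have b4 : gvW s a (2 * δ) U4 ≤ ofReal K ^ 3 * X ^ 4 := by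
    refine (halg a δ ha ha' hδ U3 U i3.1 Ui.1).trans ?_
    refine (mul_le_mul' le_rfl (mul_le_mul' b3 le_rfl)).trans (le_of_eq ?_)
    ring
  have hF : Integrable (fun ξ => c1 * U ξ + c2 * U2 ξ + (c3 * U3 ξ + c4 * U4 ξ)) :=
    ((Ui.const_mul c1).add (i2.const_mul c2)).add ((i3.const_mul c3).add (i4.const_mul c4))
  have eF : ∀ x, FTinv (fun ξ => c1 * U ξ + c2 * U2 ξ + (c3 * U3 ξ + c4 * U4 ξ)) x =
      c1 * FTinv U x + c2 * FTinv U x ^ 2 + (c3 * FTinv U x ^ 3 + c4 * FTinv U x ^ 4) := by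
    intro x
    rw [gv_FTinv_add (Φ := fun ξ => c1 * U ξ + c2 * U2 ξ) (Ψ := fun ξ => c3 * U3 ξ + c4 * U4 ξ) ((Ui.const_mul c1).add (i2.const_mul c2)) ((i3.const_mul c3).add (i4.const_mul c4)),
      gv_FTinv_add (Ui.const_mul c1) (i2.const_mul c2), gv_FTinv_add (i3.const_mul c3) (i4.const_mul c4),
      gv_FTinv_const, gv_FTinv_const, gv_FTinv_const, gv_FTinv_const, hU4, gvConv_FTinv i3 Ui, hU3, gvConv_FTinv i2 Ui, hU2, gvConv_FTinv Ui Ui]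
    ring
  have ec := gv_FTinv_cont Ui
  have hbd : ∃ M, ∀ x, ‖FTinv U x‖ ≤ M := ⟨_, gv_FTinv_norm U⟩
  obtain ⟨M, hM⟩ := hbd
  have ae1 : (fun x => FTinv (fun ξ => c1 * U ξ + c2 * U2 ξ + (c3 * U3 ξ + c4 * U4 ξ)) x) =ᵐ[volume] fun x => c1 * v x + c2 * v x ^ 2 + (c3 * v x ^ 3 + c4 * v x ^ 4) := by
    filter_upwards [hinv] with x hx
    rw [eF, hx]
  have hint : Integrable (fun x => c1 * v x + c2 * v x ^ 2 + (c3 * v x ^ 3 + c4 * v x ^ 4)) := by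
    have k1 : Integrable (fun x => (c1 + c2 * FTinv U x + (c3 * FTinv U x ^ 2 + c4 * FTinv U x ^ 3)) * v x) := by
      refine hv.bdd_mul (c := ‖c1‖ + ‖c2‖ * M + (‖c3‖ * M ^ 2 + ‖c4‖ * M ^ 3)) (Continuous.aestronglyMeasurable (by fun_prop)) (ae_of_all _ fun x => ?_)
      have := hM x
      refine (norm_add_le _ _).trans (add_le_add ((norm_add_le _ _).trans (add_le_add le_rfl ?_)) ((norm_add_le _ _).trans (add_le_add ?_ ?_)))
      · rw [norm_mul]; gcongr
      · rw [norm_mul, norm_pow]; gcongr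
      · rw [norm_mul, norm_pow]; gcongr
    refine k1.congr ?_
    filter_upwards [hinv] with x hx
    rw [hx]; ring
  refine ⟨_, hF, hint, ?_, ?_⟩
  · rw [← gv_FT_congr ae1]
    exact gv_inv_ae' hF (hint.congr ae1.symm)
  · have p1 : ‖c1‖ ^ 2 ≤ A := by
      have : 0 ≤ ‖c2‖ ^ 2 * K + ‖c3‖ ^ 2 * K ^ 2 + ‖c4‖ ^ 2 * K ^ 3 := by positivity
      rw [hA]; linarith
    have p2 : ‖c2‖ ^ 2 * K ≤ A := by
      have : 0 ≤ ‖c1‖ ^ 2 + ‖c3‖ ^ 2 * K ^ 2 + ‖c4‖ ^ 2 * K ^ 3 := by positivity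
      rw [hA]; linarith
    have p3 : ‖c3‖ ^ 2 * K ^ 2 ≤ A := by
      have : 0 ≤ ‖c1‖ ^ 2 + ‖c2‖ ^ 2 * K + ‖c4‖ ^ 2 * K ^ 3 := by positivity
      rw [hA]; linarith
    have p4 : ‖c4‖ ^ 2 * K ^ 3 ≤ A := by
      have : 0 ≤ ‖c1‖ ^ 2 + ‖c2‖ ^ 2 * K + ‖c3‖ ^ 2 * K ^ 2 := by positivity
      rw [hA]; linarith
    have d1 : gvW s a (2 * δ) (fun ξ => c1 * U ξ) ≤ ofReal A * X := by
      rw [gvW_const]; exact mul_le_mul' (ofReal_le_ofReal p1) le_rfl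
    have d2 : gvW s a (2 * δ) (fun ξ => c2 * U2 ξ) ≤ ofReal A * X ^ 2 := by
      rw [gvW_const]
      refine (mul_le_mul' le_rfl b2).trans ?_
      rw [← mul_assoc, ← ofReal_mul (by positivity)]
      exact mul_le_mul' (ofReal_le_ofReal p2) le_rfl
    have d3 : gvW s a (2 * δ) (fun ξ => c3 * U3 ξ) ≤ ofReal A * X ^ 3 := by
      rw [gvW_const]
      refine (mul_le_mul' le_rfl b3).trans ?_
      rw [← mul_assoc, ← ofReal_pow hK.le, ← ofReal_mul (by positivity)]
      exact mul_le_mul' (ofReal_le_ofReal p3) le_rfl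
    have d4 : gvW s a (2 * δ) (fun ξ => c4 * U4 ξ) ≤ ofReal A * X ^ 4 := by
      rw [gvW_const]
      refine (mul_le_mul' le_rfl b4).trans ?_
      rw [← mul_assoc, ← ofReal_pow hK.le, ← ofReal_mul (by positivity)]
      exact mul_le_mul' (ofReal_le_ofReal p4) le_rfl
    calc _ ≤ 2 * (2 * (ofReal A * X + ofReal A * X ^ 2) + 2 * (ofReal A * X ^ 3 + ofReal A * X ^ 4)) := by
          refine (gvW_add ((Ui.const_mul c1).add (i2.const_mul c2)).1).trans (mul_le_mul' le_rfl (add_le_add ?_ ?_))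
          · exact (gvW_add (Ui.const_mul c1).1).trans (mul_le_mul' le_rfl (add_le_add d1 d2))
          · exact (gvW_add (i3.const_mul c3).1).trans (mul_le_mul' le_rfl (add_le_add d3 d4))
      _ = ofReal (4 * A) * (X + X ^ 2 + X ^ 3 + X ^ 4) := by
          rw [ofReal_mul (by norm_num), show ofReal 4 = 4 by simp]; ring
      _ ≤ _ := mul_le_mul' (ofReal_le_ofReal (by linarith)) le_rfl

theorem gv_w_mul_half (s ξ : ℝ) : (1 + ξ ^ 2) ^ ((s - 1) / 2) * |ξ| ≤ (1 + ξ ^ 2) ^ (s / 2) := by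
  have h1 : |ξ| ≤ (1 + ξ ^ 2) ^ (1 / 2 : ℝ) := by
    rw [← sqrt_eq_rpow]
    apply abs_le_sqrt; linarith
  calc (1 + ξ ^ 2) ^ ((s - 1) / 2) * |ξ| ≤ (1 + ξ ^ 2) ^ ((s - 1) / 2) * (1 + ξ ^ 2) ^ (1 / 2 : ℝ) := by gcongr
    _ = _ := by rw [← rpow_add (by positivity)]; congr 1; ring

theorem gv_W_deriv (s a e : ℝ) (U : ℝ → ℂ) : gvW (s - 1) a e (fun ξ => Complex.I * ξ * U ξ) ≤ gvW s a e U := by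
  unfold gvW
  refine lintegral_mono fun ξ => ?_
  simp only
  rw [gv_sq_ofReal (by positivity), gv_sq_ofReal (by positivity)]
  apply ofReal_le_ofReal
  rw [norm_mul, norm_mul, norm_I, norm_real, norm_eq_abs, one_mul, mul_pow, sq_abs]
  have : (1 + ξ ^ 2) ^ s = (1 + ξ ^ 2) ^ (s - 1) * (1 + ξ ^ 2) := by
    rw [← rpow_add_one (by positivity)]; congr 1; ring
  rw [this]
  have h0 : 0 ≤ (1 + ξ ^ 2) ^ (s - 1) * exp (e * (1 + ξ ^ 2) ^ a) * ‖U ξ‖ ^ 2 := by positivity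
  nlinarith

theorem gv_deriv_FTinv {U : ℝ → ℂ} (h0 : Integrable U) (h1 : Integrable (fun ξ : ℝ => (ξ : ℂ) * U ξ)) (x : ℝ) :
    HasDerivAt (FTinv U) (FTinv (fun ξ => Complex.I * ξ * U ξ) x) x := by
  have h := gvJ_deriv (G := U) (k := 0) (by simpa using h0) (by simpa using h1) x
  have hp : (2 * Real.pi : ℂ) ≠ 0 := by
    have := pi_ne_zero
    simp [this]
  have e0 : FTinv U = fun z => (2 * Real.pi : ℂ)⁻¹ * gvJ U 0 z := by
    ext z; rw [gvJ_eq]; simp only [pow_zero, one_mul]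
    rw [inv_mul_cancel_left₀ hp]
  rw [e0]
  refine (h.const_mul _).congr_deriv ?_
  rw [gvJ_eq, inv_mul_cancel_left₀ hp]
  simp

theorem gv_rhs {s : ℝ} (hs : 3 / 2 < s) (c1 c2 c3 c4 : ℂ) : ∃ C > (0:ℝ), ∀ a δ : ℝ, 0 < a → a ≤ 1 / 2 → 0 ≤ δ → ∀ (u : ℝ → ℝ) (v f : ℝ → ℂ),
    v = (fun x => ((u x : ℝ) : ℂ)) → f = (fun x => (c1 * v x + c2 * v x ^ 2 + (c3 * v x ^ 3 + c4 * v x ^ 4)) + (deriv v x) ^ 2 / 2) →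
    Integrable v → gvW s a (2 * δ) (FT v) < ⊤ →
    Integrable (fun ξ : ℝ => (1 + ξ ^ 2) ^ (s / 2) * exp (δ * (1 + ξ ^ 2) ^ a) * ‖FT v ξ‖) →
    Integrable f → Integrable (fun ξ : ℝ => (1 + ξ ^ 2) ^ ((s - 1) / 2) * exp (δ * (1 + ξ ^ 2) ^ a) * ‖FT f ξ‖) →
    gvW (s - 1) a (2 * δ) (FT f) ≤ ofReal C * (gvW s a (2 * δ) (FT v) + gvW s a (2 * δ) (FT v) ^ 2 + gvW s a (2 * δ) (FT v) ^ 3 + gvW s a (2 * δ) (FT v) ^ 4) := by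
  obtain ⟨C, hC, hF0⟩ := gv_F0 hs c1 c2 c3 c4
  obtain ⟨K, hK, halg⟩ := gv_alg (r := s - 1) (by linarith)
  obtain ⟨K', hK', hcore⟩ := gv_core (r := s - 1) (by linarith)
  refine ⟨2 * (C + K + K'), by positivity, fun a δ ha ha' hδ u v f hvu hfd hv hX hmU hf hwf => ?_⟩
  obtain ⟨F, hF, hf0, hFe, hFW⟩ := hF0 a δ ha ha' hδ v hv hX
  set f0 : ℝ → ℂ := fun x => c1 * v x + c2 * v x ^ 2 + (c3 * v x ^ 3 + c4 * v x ^ 4) with hf0d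
  set P0 : ℝ → ℂ := fun x => (deriv v x) ^ 2 / 2 with hP0
  have Uc := gv_FT_cont hv
  set U := FT v with hU
  set X := gvW s a (2 * δ) U with hXd
  have hP0i : Integrable P0 := (hf.sub hf0).congr (ae_of_all _ fun x => by simp [hfd, hf0d, hP0])
  have eFT : ∀ ξ, FT f ξ = FT f0 ξ + FT P0 ξ := fun ξ => by
    rw [hfd]; exact gv_FT_add hf0 hP0i ξ
  have Pc := gv_FT_cont hP0i
  set P := FT P0 with hP
  -- finiteness of F
  have hFW' : gvW s a (2 * δ) F < ⊤ := by
    refine hFW.trans_lt (mul_lt_top ofReal_lt_top ?_)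
    simp only [ENNReal.add_lt_top]
    exact ⟨⟨⟨hX, pow_lt_top hX⟩, pow_lt_top hX⟩, pow_lt_top hX⟩
  have hwF := gv_int_of_W (r := s) (κ := s - 1) (by linarith) hF.1 hFW'
  have hwP : Integrable (fun ξ : ℝ => (1 + ξ ^ 2) ^ ((s - 1) / 2) * exp (δ * (1 + ξ ^ 2) ^ a) * ‖P ξ‖) := by
    refine (hwf.add hwF).mono' (AEStronglyMeasurable.mul (Measurable.aestronglyMeasurable (by fun_prop)) Pc.norm.aestronglyMeasurable) ?_
    filter_upwards [hFe] with ξ hξ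
    rw [norm_of_nonneg (by positivity), Pi.add_apply, ← mul_add]
    gcongr
    have : P ξ = FT f ξ - F ξ := by rw [eFT, hξ]; ring
    rw [this]; exact norm_sub_le _ _
  have Pi : Integrable P := by
    simpa using gv_int_pow_of_w 0 (by simp; linarith) hδ Pc.aestronglyMeasurable hwP
  have w1 := gv_int_of_W (κ := 1) (r := s) (by linarith) Uc.aestronglyMeasurable hX
  have Ui : Integrable U := by simpa using gv_int_pow_of_w 0 (by simp) hδ Uc.aestronglyMeasurable w1
  have Ui1 : Integrable (fun ξ : ℝ => (ξ : ℂ) * U ξ) := by simpa using gv_int_pow_of_w 1 (by simp) hδ Uc.aestronglyMeasurable w1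
  set G : ℝ → ℂ := fun ξ => Complex.I * ξ * U ξ with hG
  have Gi : Integrable G := (Ui1.const_mul Complex.I).congr (ae_of_all _ fun ξ => by simp [hG, mul_assoc])
  have hd : ∀ x, HasDerivAt (FTinv U) (FTinv G x) x := gv_deriv_FTinv Ui Ui1
  have hinv : FTinv U =ᵐ[volume] v := gv_inv_ae hv Ui
  have hre : ∀ x, (((FTinv U x).re : ℝ) : ℂ) = FTinv U x := gv_real (gv_FTinv_cont Ui) (by rw [← hvu]; exact hinv)
  set g : ℝ → ℝ := fun x => (FTinv G x).re with hg
  have hgG : ∀ x, ((g x : ℝ) : ℂ) = FTinv G x := by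
    intro x
    have h1 : HasDerivAt (fun x => (FTinv U x).im) (FTinv G x).im x := Complex.imCLM.hasFDerivAt.comp_hasDerivAt x (hd x)
    have h2 : (fun x => (FTinv U x).im) = fun _ => 0 := by
      ext y; rw [← hre y]; simp
    rw [h2] at h1
    have h3 := h1.unique (hasDerivAt_const x (0:ℝ))
    apply Complex.ext
    · simp [hg]
    · simp [h3]
  have hch : ∀ x, deriv v x = 0 ∨ deriv v x = ((g x : ℝ) : ℂ) := fun x => by
    rw [hgG]; exact gv_deriv_choice hd hinv.symm x
  have hP0r : ∀ x, P0 x = (((P0 x).re : ℝ) : ℂ) ∧ ((P0 x).re = 0 ∨ (P0 x).re = g x ^ 2 / 2) := by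
    intro x
    rcases hch x with h | h
    · simp [hP0, h]
    · have : P0 x = ((g x ^ 2 / 2 : ℝ) : ℂ) := by simp [hP0, h]
      rw [this]
      exact ⟨by rw [ofReal_re], Or.inr (ofReal_re _)⟩
  have hPinv : FTinv P =ᵐ[volume] P0 := gv_inv_ae hP0i Pi
  have hPc := gv_FTinv_cont Pi
  have hPr : ∀ x, (((FTinv P x).re : ℝ) : ℂ) = FTinv P x := gv_real (u := fun x => (P0 x).re) hPc (by
    filter_upwards [hPinv] with x hx
    rw [hx]; exact (hP0r x).1)
  set p : ℝ → ℝ := fun x => (FTinv P x).re with hp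
  have gc : Continuous g := continuous_re.comp (gv_FTinv_cont Gi)
  have pc : Continuous p := continuous_re.comp hPc
  have hcc : ∀ x, p x = 0 ∨ p x = g x ^ 2 / 2 := by
    have h1 : (fun x => p x * (p x - g x ^ 2 / 2)) =ᵐ[volume] fun _ => (0:ℝ) := by
      filter_upwards [hPinv] with x hx
      have : p x = (P0 x).re := by rw [hp]; simp only; rw [hx]
      rw [this]
      rcases (hP0r x).2 with h | h <;> rw [h] <;> simp
    have h2 := (Continuous.ae_eq_iff_eq volume (by fun_prop) (by fun_prop)).1 h1
    intro x
    rcases mul_eq_zero.1 (congrFun h2 x) with h | h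
    · left; exact h
    · right; linarith
  have hGW : gvW (s - 1) a (2 * δ) G ≤ X := gv_W_deriv s a (2 * δ) U
  have hqi : Integrable (fun x => g x ^ 2) := by
    refine ⟨(gc.pow 2).aestronglyMeasurable, ?_⟩
    rw [hasFiniteIntegral_iff_ofReal (ae_of_all _ fun ξ => by positivity)]
    have h1 : ∀ x, ofReal (g x ^ 2) = ‖FTinv G x‖ₑ ^ 2 := by
      intro x
      rw [← hgG, ← ofReal_norm, ← ofReal_pow (norm_nonneg _), norm_real, norm_eq_abs, sq_abs]
    simp only [h1]
    refine (gv_bessel' Gi).trans_lt (mul_lt_top ofReal_lt_top ?_)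
    refine lt_of_le_of_lt ?_ (hGW.trans_lt hX)
    unfold gvW
    refine lintegral_mono fun ξ => ?_
    have hb : 1 ≤ 1 + ξ ^ 2 := by nlinarith [sq_nonneg ξ]
    have t1 : 1 ≤ (1 + ξ ^ 2) ^ (s - 1) := one_le_rpow hb (by linarith)
    have t2 : 1 ≤ exp (2 * δ * (1 + ξ ^ 2) ^ a) := one_le_exp (by positivity)
    refine le_mul_of_one_le_left zero_le ?_
    rw [one_le_ofReal]
    nlinarith
  have H : GvCore G P g p :=
    { hg := hgG
      hp := hPr
      Pe := by
        rw [hP]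
        apply gv_FT_congr
        filter_upwards [hPinv] with x hx
        rw [hp]; simp only; rw [hPr, hx]
      pi := (hP0i.congr hPinv.symm).re
      qi := hqi
      hc := hcc
      Gi := Gi
      Pi := Pi }
  have hwG : Integrable (fun ξ : ℝ => (1 + ξ ^ 2) ^ ((s - 1) / 2) * exp (δ * (1 + ξ ^ 2) ^ a) * ‖G ξ‖) := by
    refine hmU.mono' (AEStronglyMeasurable.mul (Measurable.aestronglyMeasurable (by fun_prop)) Gi.1.norm) (ae_of_all _ fun ξ => ?_)
    rw [norm_of_nonneg (by positivity), hG]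
    simp only
    rw [norm_mul, norm_mul, norm_I, norm_real, norm_eq_abs, one_mul]
    calc _ = ((1 + ξ ^ 2) ^ ((s - 1) / 2) * |ξ|) * exp (δ * (1 + ξ ^ 2) ^ a) * ‖U ξ‖ := by ring
      _ ≤ _ := by have := gv_w_mul_half s ξ; gcongr
  have hc := hcore a δ ha ha' hδ G P g p H hwG hwP
  have hq : gvW (s - 1) a (2 * δ) (FT (fun x => ((g x ^ 2 / 2 : ℝ) : ℂ))) ≤ ofReal K * X ^ 2 := by
    have cGi := gvConv_int Gi Gi
    have e1 : (fun x => ((g x ^ 2 / 2 : ℝ) : ℂ)) = FTinv (fun ξ => (1 / 2 : ℂ) * gvConv G G ξ) := by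
      ext x
      rw [gv_FTinv_const, gvConv_FTinv Gi Gi, ← hgG]; push_cast; ring
    have e2 := gv_inv_ae' (cGi.const_mul (1 / 2 : ℂ)) (by rw [← e1]; exact (hqi.div_const 2).ofReal)
    rw [e1, gvW_congr e2, gvW_const]
    refine (mul_le_of_le_one_left zero_le ?_).trans ((halg a δ ha ha' hδ G G Gi.1 Gi.1).trans ?_)
    · apply ofReal_le_one.2
      norm_num
    · rw [sq]; exact mul_le_mul' le_rfl (mul_le_mul' hGW hGW)
  have hP2 : gvW (s - 1) a (2 * δ) P ≤ ofReal (K + K') * X ^ 2 := by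
    refine hc.trans ((add_le_add hq (mul_le_mul' le_rfl (pow_le_pow_left₀ zero_le hGW 2))).trans (le_of_eq ?_))
    rw [ofReal_add hK.le hK'.le]; ring
  have hF2 : gvW (s - 1) a (2 * δ) (FT f0) ≤ ofReal C * (X + X ^ 2 + X ^ 3 + X ^ 4) := by
    rw [gvW_congr hFe]
    exact (gvW_mono_r (by linarith) F).trans hFW
  have e3 : FT f = fun ξ => FT f0 ξ + P ξ := funext eFT
  rw [e3]
  refine (gvW_add (gv_FT_cont hf0).aestronglyMeasurable).trans ?_
  have hle : X ^ 2 ≤ X + X ^ 2 + X ^ 3 + X ^ 4 := by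
    rw [add_comm X, add_assoc, add_assoc]; exact le_self_add
  refine (mul_le_mul' le_rfl (add_le_add hF2 (hP2.trans (mul_le_mul' le_rfl hle)))).trans (le_of_eq ?_)
  rw [ofReal_mul (by norm_num), add_assoc C, ofReal_add hC.le (by linarith), show ofReal 2 = 2 by simp]
  ring

theorem gv_FTinv_zero : FTinv (fun _ => 0) = fun _ => 0 := by
  ext x; unfold FTinv; simp

theorem gv_l2_le {m : ℝ → ℂ} {F : ℝ → ℂ} {Y : ENNReal} (hi : Integrable (fun ξ => m ξ * F ξ)) (h : ∫⁻ ξ, ‖m ξ * F ξ‖ₑ ^ 2 ≤ Y) :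
    ∫⁻ x, ‖FTinv (fun ξ => m ξ * F ξ) x‖ₑ ^ 2 ≤ Y := by
  refine (gv_bessel' hi).trans ?_
  refine (mul_le_of_le_one_left zero_le ?_).trans h
  apply ofReal_le_one.2
  rw [div_le_one (by have := pi_pos; positivity)]
  linarith [pi_gt_three]

theorem gv_norm_m (s δ a ξ : ℝ) : ‖(((1 + ξ ^ 2) ^ (s / 2) * exp (δ * (1 + ξ ^ 2) ^ a) : ℝ) : ℂ)‖ =
    (1 + ξ ^ 2) ^ (s / 2) * exp (δ * (1 + ξ ^ 2) ^ a) := by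
  rw [norm_real, norm_of_nonneg (by positivity)]

theorem gv_norm_sym (ξ : ℝ) : ‖Complex.I * (ξ : ℂ) / (1 + (ξ : ℂ) ^ 2)‖ = |ξ| / (1 + ξ ^ 2) := by
  rw [norm_div, norm_mul, norm_I, one_mul, norm_real, norm_eq_abs,
    show (1 + (ξ : ℂ) ^ 2) = ((1 + ξ ^ 2 : ℝ) : ℂ) by push_cast; ring, norm_real, norm_of_nonneg (by positivity)]

theorem gv_mh_W (s δ a : ℝ) (F : ℝ → ℂ) :
    ∫⁻ ξ : ℝ, ‖(((1 + ξ ^ 2) ^ (s / 2) * exp (δ * (1 + ξ ^ 2) ^ a) : ℝ) : ℂ) * (Complex.I * (ξ : ℂ) / (1 + (ξ : ℂ) ^ 2) * F ξ)‖ₑ ^ 2 ≤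
      gvW (s - 1) a (2 * δ) F := by
  unfold gvW
  refine lintegral_mono fun ξ => ?_
  rw [← gv_w_sq]
  refine pow_le_pow_left₀ zero_le ?_ 2
  rw [← ofReal_norm, ← ofReal_norm, ← ofReal_mul (by positivity)]
  apply ofReal_le_ofReal
  rw [norm_mul, norm_mul, gv_norm_m, gv_norm_sym]
  have h1 : (1 + ξ ^ 2) ^ (s / 2) * (|ξ| / (1 + ξ ^ 2)) ≤ (1 + ξ ^ 2) ^ ((s - 1) / 2) := by
    have := gv_w_mul_half (s - 1) ξ
    calc (1 + ξ ^ 2) ^ (s / 2) * (|ξ| / (1 + ξ ^ 2)) = (1 + ξ ^ 2) ^ ((s - 1 - 1) / 2) * |ξ| := by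
          rw [show (s - 1 - 1) / 2 = s / 2 - 1 by ring, rpow_sub_one (by positivity)]; ring
      _ ≤ _ := this
  calc _ = ((1 + ξ ^ 2) ^ (s / 2) * (|ξ| / (1 + ξ ^ 2))) * exp (δ * (1 + ξ ^ 2) ^ a) * ‖F ξ‖ := by ring
    _ ≤ _ := by gcongr

theorem gv_wf {s δ a : ℝ} {F : ℝ → ℂ} (hF : Continuous F)
    (h : Integrable (fun ξ : ℝ => (((1 + ξ ^ 2) ^ (s / 2) * exp (δ * (1 + ξ ^ 2) ^ a) : ℝ) : ℂ) * (Complex.I * (ξ : ℂ) / (1 + (ξ : ℂ) ^ 2) * F ξ))) :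
    Integrable (fun ξ : ℝ => (1 + ξ ^ 2) ^ ((s - 1) / 2) * exp (δ * (1 + ξ ^ 2) ^ a) * ‖F ξ‖) := by
  have hb0 : ∀ ξ : ℝ, 1 + ξ ^ 2 ≠ 0 := fun ξ => by positivity
  have wc : Continuous (fun ξ : ℝ => (1 + ξ ^ 2) ^ ((s - 1) / 2) * exp (δ * (1 + ξ ^ 2) ^ a) * ‖F ξ‖) := by
    have k : ∀ t : ℝ, Continuous (fun ξ : ℝ => (1 + ξ ^ 2) ^ t) := fun t =>
      Continuous.rpow_const (by fun_prop) (fun ξ => Or.inl (hb0 ξ))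
    have k1 := k ((s - 1) / 2)
    have k2 := k a
    fun_prop
  have i1 : Integrable (indicator (Icc (-1) 1) (fun ξ : ℝ => (1 + ξ ^ 2) ^ ((s - 1) / 2) * exp (δ * (1 + ξ ^ 2) ^ a) * ‖F ξ‖)) :=
    (integrable_indicator_iff measurableSet_Icc).2 (wc.continuousOn.integrableOn_compact isCompact_Icc)
  refine ((h.norm.const_mul 2).add i1).mono' wc.aestronglyMeasurable (ae_of_all _ fun ξ => ?_)
  rw [norm_of_nonneg (by positivity), Pi.add_apply]
  by_cases hξ : ξ ∈ Icc (-1:ℝ) 1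
  · rw [indicator_of_mem hξ]
    exact le_add_of_nonneg_left (by positivity)
  · rw [indicator_of_notMem hξ, add_zero, norm_mul, norm_mul, gv_norm_m, gv_norm_sym]
    have hξ' : 1 ≤ |ξ| := by
      by_contra hcon
      apply hξ
      exact abs_le.1 (not_le.1 hcon).le
    have h2 : (1 + ξ ^ 2) ^ ((s - 1) / 2) ≤ 2 * ((1 + ξ ^ 2) ^ (s / 2) * (|ξ| / (1 + ξ ^ 2))) := by
      have e : (1 + ξ ^ 2) ^ ((s - 1) / 2) = (1 + ξ ^ 2) ^ (s / 2) / (1 + ξ ^ 2) * sqrt (1 + ξ ^ 2) := by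
        rw [sqrt_eq_rpow, ← rpow_sub_one (hb0 ξ), ← rpow_add (by positivity)]; congr 1; ring
      have e2 : sqrt (1 + ξ ^ 2) ≤ 2 * |ξ| := by
        rw [sqrt_le_left (by positivity)]
        nlinarith [sq_abs ξ]
      rw [e]
      calc _ ≤ (1 + ξ ^ 2) ^ (s / 2) / (1 + ξ ^ 2) * (2 * |ξ|) := by gcongr
        _ = _ := by ring
    calc _ ≤ (2 * ((1 + ξ ^ 2) ^ (s / 2) * (|ξ| / (1 + ξ ^ 2)))) * exp (δ * (1 + ξ ^ 2) ^ a) * ‖F ξ‖ := by gcongr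
      _ = _ := by ring

theorem gv_GOp_ne {σ δ s : ℝ} {f : ℝ → ℂ} (h : GOp σ δ s f ≠ fun _ => 0) : Integrable f ∧
    Integrable (fun ξ : ℝ => (((1 + ξ ^ 2) ^ (s / 2) * exp (δ * (1 + ξ ^ 2) ^ (1 / (2 * σ))) : ℝ) : ℂ) * FT f ξ) := by
  constructor
  · by_contra hcon
    apply h
    unfold GOp fourierMult
    rw [gv_FT_notInt hcon]
    simp only [Pi.zero_apply, mul_zero]
    exact gv_FTinv_zero
  · by_contra hcon
    apply h
    unfold GOp fourierMult
    rw [gv_FTinv_notInt hcon]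
    rfl

theorem gv_final {s : ℝ} (α β γ Γ : ℝ) (hs : 3 / 2 < s) :
    ∃ C > (0 : ℝ), ∀ σ δ : ℝ, 1 ≤ σ → 0 ≤ δ → ∀ u : ℝ → ℝ, ∀ v : ℝ → ℂ, v = (fun x => ((u x : ℝ) : ℂ)) →
      MemGevrey σ δ s v →
      ‖L2inner (GOp σ δ s (PCH α β γ Γ v)) (GOp σ δ s v)‖ ≤
        C * (gevreyNorm σ δ s v ^ 2 + gevreyNorm σ δ s v ^ 3 + gevreyNorm σ δ s v ^ 4 + gevreyNorm σ δ s v ^ 5) := by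
  obtain ⟨C, hC, hrhs⟩ := gv_rhs hs (-(α + Γ)) 1 (-(β / 3)) (-(γ / 4))
  refine ⟨C + 1, by positivity, fun σ δ hσ hδ u v hvu hmem => ?_⟩
  set N := gevreyNorm σ δ s v with hN
  have hN0 : 0 ≤ N := sqrt_nonneg _
  have ha : 0 < 1 / (2 * σ) := by positivity
  have ha' : 1 / (2 * σ) ≤ 1 / 2 := by
    apply one_div_le_one_div_of_le <;> linarith
  set A := GOp σ δ s (PCH α β γ Γ v) with hA
  set B := GOp σ δ s v with hB
  by_cases hA0 : A = fun _ => 0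
  · rw [hA0]; unfold L2inner; simp; positivity
  by_cases hB0 : B = fun _ => 0
  · rw [hB0]; unfold L2inner; simp; positivity
  obtain ⟨hPi, hmh⟩ := gv_GOp_ne hA0
  obtain ⟨hv, hmU⟩ := gv_GOp_ne hB0
  set f : ℝ → ℂ := fun x => (-(α + Γ) * v x + 1 * v x ^ 2 + (-(β / 3) * v x ^ 3 + -(γ / 4) * v x ^ 4)) + (deriv v x) ^ 2 / 2 with hf
  have hPe : PCH α β γ Γ v = FTinv (fun ξ => Complex.I * (ξ : ℂ) / (1 + (ξ : ℂ) ^ 2) * FT f ξ) := by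
    unfold PCH fourierMult
    congr 1; ext ξ; congr 2; ext x
    rw [hf]; unfold hCH; ring
  have hPne : PCH α β γ Γ v ≠ fun _ => 0 := by
    intro h0
    apply hA0
    rw [hA, h0]
    unfold GOp fourierMult
    have : FT (fun _ => 0) = fun _ => 0 := by ext ξ; unfold FT; simp
    rw [this]
    simp only [mul_zero]
    exact gv_FTinv_zero
  have hfi : Integrable f := by
    by_contra hcon
    apply hPne
    rw [hPe, gv_FT_notInt hcon]
    simp only [Pi.zero_apply, mul_zero]
    exact gv_FTinv_zero
  have hhi : Integrable (fun ξ : ℝ => Complex.I * (ξ : ℂ) / (1 + (ξ : ℂ) ^ 2) * FT f ξ) := by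
    by_contra hcon
    apply hPne
    rw [hPe, gv_FTinv_notInt hcon]
    rfl
  have fc := gv_FT_cont hfi
  have hhc : Continuous (fun ξ : ℝ => Complex.I * (ξ : ℂ) / (1 + (ξ : ℂ) ^ 2) * FT f ξ) := by
    refine Continuous.mul (Continuous.div (by fun_prop) (by fun_prop) fun ξ => ?_) fc
    rw [show (1 + (ξ : ℂ) ^ 2) = ((1 + ξ ^ 2 : ℝ) : ℂ) by push_cast; ring]
    exact Complex.ofReal_ne_zero.2 (by positivity)
  have hFTP : FT (PCH α β γ Γ v) = fun ξ : ℝ => Complex.I * (ξ : ℂ) / (1 + (ξ : ℂ) ^ 2) * FT f ξ := by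
    rw [hPe]; exact gv_inv2 hhc hhi (by rw [← hPe]; exact hPi)
  rw [hFTP] at hmh
  have hwf := gv_wf fc hmh
  have hmU' : Integrable (fun ξ : ℝ => (1 + ξ ^ 2) ^ (s / 2) * exp (δ * (1 + ξ ^ 2) ^ (1 / (2 * σ))) * ‖FT v ξ‖) := by
    refine hmU.norm.congr (ae_of_all _ fun ξ => ?_)
    simp only
    rw [norm_mul, gv_norm_m]
  have hX : gvW s (1 / (2 * σ)) (2 * δ) (FT v) = ofReal (N ^ 2) := by
    rw [hN, gevreyNorm, sq_sqrt (integral_nonneg fun ξ => by unfold gevreyWeight; positivity)]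
    rw [ofReal_integral_eq_lintegral_ofReal hmem (ae_of_all _ fun ξ => by unfold gevreyWeight; positivity)]
    unfold gvW gevreyWeight
    congr 1; ext ξ
    rw [gv_sq_ofReal (by positivity)]
  have key := hrhs (1 / (2 * σ)) δ ha ha' hδ u v f hvu hf hv (by rw [hX]; exact ofReal_lt_top) hmU' hfi hwf
  rw [hX] at key
  have hAl : ∫⁻ x, ‖A x‖ₑ ^ 2 ≤ gvW (s - 1) (1 / (2 * σ)) (2 * δ) (FT f) := by
    rw [hA]; unfold GOp fourierMult
    rw [hFTP]
    exact gv_l2_le hmh (gv_mh_W s δ _ (FT f))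
  have hBl : ∫⁻ x, ‖B x‖ₑ ^ 2 ≤ ofReal (N ^ 2) := by
    rw [← hX, hB]
    refine gv_l2_le hmU (le_of_eq ?_)
    unfold gvW
    congr 1; ext ξ
    rw [← gv_w_sq, enorm_mul]
    congr 2
    rw [← ofReal_norm, gv_norm_m]
  have Ac : Continuous A := by rw [hA]; unfold GOp fourierMult; rw [hFTP]; exact gv_FTinv_cont hmh
  have Bc : Continuous B := gv_FTinv_cont hmU
  have hT : ‖L2inner A B‖ₑ ^ 2 ≤ ofReal (C * (N ^ 2 + N ^ 4 + N ^ 6 + N ^ 8) * N ^ 2) := by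
    have h1 : ‖L2inner A B‖ₑ ≤ ∫⁻ x, ‖A x‖ₑ * ‖B x‖ₑ := by
      unfold L2inner
      refine (enorm_integral_le_lintegral_enorm _).trans (le_of_eq ?_)
      congr 1; ext x
      rw [enorm_mul, ← ofReal_norm ((starRingEnd ℂ) (B x)), RCLike.norm_conj, ofReal_norm]
    have h2 := gv_cs (μ := volume) (f := fun x => ‖A x‖ₑ) (g := fun x => ‖B x‖ₑ) Ac.measurable.enorm.aemeasurable Bc.measurable.enorm.aemeasurable
    refine (pow_le_pow_left₀ zero_le h1 2).trans (h2.trans ((mul_le_mul' (hAl.trans key) hBl).trans (le_of_eq ?_)))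
    rw [← ofReal_pow (by positivity), ← ofReal_pow (by positivity), ← ofReal_pow (by positivity),
      ← ofReal_add (by positivity) (by positivity), ← ofReal_add (by positivity) (by positivity), ← ofReal_add (by positivity) (by positivity),
      ← ofReal_mul (by positivity), ← ofReal_mul (by positivity)]
    congr 1; ring
  rw [← ofReal_norm, ← ofReal_pow (norm_nonneg _), ENNReal.ofReal_le_ofReal_iff (by positivity)] at hT
  refine le_of_sq_le_sq (hT.trans ?_) (by positivity)
  rw [mul_pow]
  have h1 : C ≤ (C + 1) ^ 2 := by nlinarith
  have h2 : (N ^ 2 + N ^ 4 + N ^ 6 + N ^ 8) * N ^ 2 ≤ (N ^ 2 + N ^ 3 + N ^ 4 + N ^ 5) ^ 2 := by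
    have : (N ^ 2 + N ^ 3 + N ^ 4 + N ^ 5) ^ 2 = (N ^ 2 + N ^ 4 + N ^ 6 + N ^ 8) * N ^ 2 + (2 * N ^ 5 + 2 * N ^ 6 + 4 * N ^ 7 + 2 * N ^ 8 + 2 * N ^ 9) := by ring
    rw [this]
    have : 0 ≤ 2 * N ^ 5 + 2 * N ^ 6 + 4 * N ^ 7 + 2 * N ^ 8 + 2 * N ^ 9 := by positivity
    linarith
  rw [mul_assoc]
  exact mul_le_mul h1 h2 (by positivity) (by positivity)

/-- The nonlocal-term energy estimate: for `s > 3/2` there is `C > 0` depending only on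
`s, α, β, γ, Γ` such that for all `σ ≥ 1`, `δ ≥ 0` and real-valued `u ∈ G^δ_{σ,s}(ℝ)`,
`|⟨Λ^s e^{δΛ^{1/σ}}[(1−∂_{xx})^{-1}∂_x(−h(u)+u²+½(∂_x u)²)], Λ^s e^{δΛ^{1/σ}}u⟩| ≤
  C(‖u‖²_{G^δ_{σ,s}} + ‖u‖³_{G^δ_{σ,s}} + ‖u‖⁴_{G^δ_{σ,s}} + ‖u‖⁵_{G^δ_{σ,s}})`. -/
theorem gevrey_nonlocal_energy_estimate (s α β γ Γ : ℝ) (hs : 3 / 2 < s) :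
    ∃ C > (0 : ℝ), ∀ σ δ : ℝ, 1 ≤ σ → 0 ≤ δ → ∀ u : ℝ → ℝ,
      MemGevrey σ δ s (fun x => ((u x : ℝ) : ℂ)) →
      ‖L2inner (GOp σ δ s (PCH α β γ Γ (fun x => ((u x : ℝ) : ℂ))))
          (GOp σ δ s (fun x => ((u x : ℝ) : ℂ)))‖ ≤
        C * (gevreyNorm σ δ s (fun x => ((u x : ℝ) : ℂ)) ^ 2 +
          gevreyNorm σ δ s (fun x => ((u x : ℝ) : ℂ)) ^ 3 +
          gevreyNorm σ δ s (fun x => ((u x : ℝ) : ℂ)) ^ 4 +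
          gevreyNorm σ δ s (fun x => ((u x : ℝ) : ℂ)) ^ 5) := by
  obtain ⟨C, hC, h⟩ := gv_final α β γ Γ hs
  exact ⟨C, hC, fun σ δ hσ hδ u hu => h σ δ hσ hδ u _ rfl hu⟩
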